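/- Let K be a real differential field whose field of constants k is real closed, with k ≠ K. Then for every n ≥ 1 and every matrix A ∈ Mat_n(K), there exists a real Picard–Vessiot field for the equation y′ = Ay over K. -/

import Mathlib

/-- A derivation on a field `F`. -/
structure FieldDeriv (F : Type) [Field F] : Type where
  d : F → F
  map_add : ∀ a b : F, d (a + b) = d a + d b
  leibniz : ∀ a b : F, d (a * b) = a * d b + d a * b

/-- A field is (formally) real if `-1` is not a sum of squares. -/
def IsFormallyRealField (F : Type) [Field F] : Prop :=
  ¬ IsSumSq (-1 : F)

/-- A field is real closed if it is real and no proper algebraic extension of it is real. -/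
def IsRealClosedField (F : Type) [Field F] : Prop :=
  IsFormallyRealField F ∧
    ∀ (E : Type) [Field E] [Algebra F E], Algebra.IsAlgebraic F E →
      IsFormallyRealField E → Function.Surjective (algebraMap F E)

/-- `L/K`, with derivations `dL` extending `dK`, is a Picard--Vessiot field for the
equation `y' = A y`: the derivation of `L` extends that of `K`, there is a fundamental
matrix `F ∈ GL_n(L)` with `F' = A F`, the entries of `F` generate `L` as a field over `K`,
and the constants of `L` are exactly the constants of `K`. -/
def IsPicardVessiot {K L : Type} [Field K] [Field L] [Algebra K L]
    (dK : FieldDeriv K) (dL : FieldDeriv L) {n : ℕ}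
    (A : Matrix (Fin n) (Fin n) K) : Prop :=
  (∀ a : K, dL.d (algebraMap K L a) = algebraMap K L (dK.d a)) ∧
  ∃ F : Matrix (Fin n) (Fin n) L, IsUnit F.det ∧
    (∀ i j, dL.d (F i j) = (A.map (algebraMap K L) * F) i j) ∧
    IntermediateField.adjoin K (Set.range fun q : Fin n × Fin n => F q.1 q.2) = ⊤ ∧
    ∀ x : L, dL.d x = 0 → ∃ a : K, dK.d a = 0 ∧ algebraMap K L a = x

namespace RealPV

open Polynomial

section SumSq

variable {F : Type} [Field F]

theorem neg_one_isSumSq_of_add_eq_zero {s t : F} (hs : IsSumSq s) (ht : IsSumSq t)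
    (h : s + t = 0) (hs0 : s ≠ 0) : IsSumSq (-1 : F) := by
  have : (-1 : F) = t * s * (s⁻¹ * s⁻¹) := by
    have : t = -s := by linear_combination h
    rw [this]; field_simp
  rw [this]
  exact (ht.mul hs).mul (.mul_self _)

theorem isSumSq_inv {s : F} (hs : IsSumSq s) : IsSumSq s⁻¹ := by
  by_cases h : s = 0
  · simpa [h] using hs
  · have : s⁻¹ = s * (s⁻¹ * s⁻¹) := by field_simp
    rw [this]; exact hs.mul (.mul_self _)

theorem isSumSq_map {R S : Type*} [CommRing R] [CommRing S] (f : R →+* S) {s : R}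
    (hs : IsSumSq s) : IsSumSq (f s) := by
  induction hs with
  | zero => simp
  | sq_add a _ ih => simpa using IsSumSq.sq_add (f a) ih

theorem not_isSumSq_of_injective {R S : Type*} [CommRing R] [CommRing S] (f : R →+* S)
    (hS : ¬ IsSumSq (-1 : S)) : ¬ IsSumSq (-1 : R) := fun h => hS (by simpa using isSumSq_map f h)

/-- Sums of squares in `F(√a)`. -/
theorem isSumSq_quadratic {a : F} {z : QuadraticAlgebra F a 0} (hz : IsSumSq z) :
    ∃ s t : F, IsSumSq s ∧ IsSumSq t ∧ z.re = s + a * t := by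
  induction hz with
  | zero => exact ⟨0, 0, by simp, by simp, by simp⟩
  | sq_add w _ ih =>
    obtain ⟨s, t, hs, ht, h⟩ := ih
    refine ⟨w.re * w.re + s, w.im * w.im + t, .sq_add _ hs, .sq_add _ ht, ?_⟩
    simp [h]; ring

/-- A nonzero sum of squares of polynomials over a real field has even degree and its leading
coefficient is a sum of squares. -/
theorem even_natDegree_of_isSumSq (hF : ¬ IsSumSq (-1 : F)) {p : F[X]} (hp : IsSumSq p) :
    Even p.natDegree ∧ IsSumSq p.leadingCoeff := by
  induction hp with
  | zero => simp
  | sq_add a hs ih =>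
    rename_i s
    by_cases ha : a = 0
    · simpa [ha] using ih
    by_cases hs0 : s = 0
    · subst hs0
      simp [natDegree_mul ha ha]
    have haa : a * a ≠ 0 := mul_ne_zero ha ha
    have hea : Even (a * a).natDegree := by simp [natDegree_mul ha ha]
    rcases lt_trichotomy (degree (a * a)) (degree s) with h | h | h
    · rw [natDegree_add_eq_right_of_degree_lt h, leadingCoeff_add_of_degree_lt h]
      exact ih
    · have hl : (a * a).leadingCoeff + s.leadingCoeff ≠ 0 := fun h0 => hF <|
        neg_one_isSumSq_of_add_eq_zero (by simp) ih.2 h0 (by simpa using haa)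
      have hd := natDegree_eq_of_degree_eq h
      refine ⟨?_, ?_⟩
      · have : (a * a + s).natDegree = (a*a).natDegree := by
          have := degree_add_eq_of_leadingCoeff_add_ne_zero hl
          rw [h, max_self, ← h] at this
          exact natDegree_eq_of_degree_eq this
        rw [this]; exact hea
      · rw [leadingCoeff_add_of_degree_eq h hl]
        exact IsSumSq.add (by simp) ih.2
    · rw [natDegree_add_eq_left_of_degree_lt h, leadingCoeff_add_of_degree_lt' h]
      exact ⟨hea, by simp⟩

end SumSq

section Closed

variable {F : Type} [Field F]

theorem isSquare_or_neg_isSumSq (hF : IsRealClosedField F) (a : F) :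
    IsSquare a ∨ IsSumSq (-a) := by
  by_contra! hcon
  obtain ⟨hsq, hns⟩ := hcon
  have : Fact (∀ r : F, r ^ 2 ≠ a + 0 * r) := ⟨fun r hr => hsq ⟨r, by linear_combination -hr⟩⟩
  have hE : IsFormallyRealField (QuadraticAlgebra F a 0) := by
    intro h
    obtain ⟨s, t, hs, ht, he⟩ := isSumSq_quadratic h
    have he' : -1 = s + a * t := by simpa [QuadraticAlgebra.re_one] using he
    have ht0 : t ≠ 0 := by
      rintro rfl
      exact hF.1 (by rw [he']; simpa using hs)
    have : -a = (1 + s) * t⁻¹ := by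
      field_simp; linear_combination he'
    exact hns (by rw [this]; exact (IsSumSq.add .one hs).mul (isSumSq_inv ht))
  obtain ⟨r, hr⟩ := hF.2 (QuadraticAlgebra F a 0) inferInstance hE QuadraticAlgebra.omega
  have := congrArg QuadraticAlgebra.im hr
  simp at this

theorem isSquare_of_isSumSq (hF : IsRealClosedField F) {a : F} (ha : IsSumSq a) : IsSquare a := by
  rcases isSquare_or_neg_isSumSq hF a with h | h
  · exact h
  · by_cases h0 : a = 0
    · simp [h0]
    · exact absurd (neg_one_isSumSq_of_add_eq_zero ha h (by ring) h0) hF.1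

theorem exists_root_of_odd (hF : IsRealClosedField F) (n : ℕ) : ∀ f : F[X], f.natDegree = n →
    Odd n → ∃ x, f.IsRoot x := by
  induction n using Nat.strong_induction_on with
  | _ n ih =>
    intro f hf hn
    have hf0 : f ≠ 0 := by rintro rfl; simp at hf; subst hf; simp at hn
    by_cases hirr : Irreducible f
    · have := Fact.mk hirr
      by_cases hE : IsFormallyRealField (AdjoinRoot f)
      · have : FiniteDimensional F (AdjoinRoot f) := (AdjoinRoot.powerBasis hf0).finite
        obtain ⟨r, hr⟩ := hF.2 (AdjoinRoot f) inferInstance hE (AdjoinRoot.root f)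
        refine ⟨r, ?_⟩
        have h1 := AdjoinRoot.eval₂_root f
        have h2 : algebraMap F (AdjoinRoot f) = AdjoinRoot.of f := rfl
        rw [← hr, h2, eval₂_at_apply] at h1
        exact (AdjoinRoot.of f).injective (by simpa using h1)
      · unfold IsFormallyRealField at hE
        rw [not_not] at hE
        have key : ∀ z : AdjoinRoot f, IsSumSq z → ∃ p : F[X], IsSumSq p ∧ AdjoinRoot.mk f p = z ∧
            p.natDegree ≤ 2 * (n - 1) := by
          intro z hz
          induction hz with
          | zero => exact ⟨0, by simp, by simp, by simp⟩
          | sq_add w _ ih' =>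
            obtain ⟨p, hp, hpz, hd⟩ := ih'
            obtain ⟨q, rfl⟩ := AdjoinRoot.mk_surjective w
            have hq : (q % f).natDegree < n := by
              rw [← hf]; apply natDegree_mod_lt; intro h; rw [hf] at h; subst h; simp at hn
            refine ⟨(q % f) * (q % f) + p, .sq_add _ hp, ?_, ?_⟩
            · have : AdjoinRoot.mk f (q % f) = AdjoinRoot.mk f q := by
                rw [AdjoinRoot.mk_eq_mk, EuclideanDomain.mod_eq_sub_mul_div]
                exact ⟨-(q / f), by ring⟩
              simp [hpz, this]
            · refine (natDegree_add_le _ _).trans (max_le ((natDegree_mul_le).trans ?_) hd)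
              omega
        obtain ⟨p, hp, hpz, hd⟩ := key _ hE
        have hdvd : f ∣ 1 + p := by
          rw [← AdjoinRoot.mk_eq_zero]; simp [hpz]
        obtain ⟨h, hh⟩ := hdvd
        have hS : IsSumSq (1 + p) := IsSumSq.add .one hp
        have hev := (even_natDegree_of_isSumSq hF.1 hS).1
        have hne : 1 + p ≠ 0 := by
          intro h0
          have : IsSumSq (-1 : F[X]) := by
            have : (-1 : F[X]) = p := by linear_combination -h0
            rwa [this]
          exact hF.1 (by simpa using isSumSq_map (evalRingHom (0 : F)) this)
        have hh0 : h ≠ 0 := by rintro rfl; simp at hh; exact hne hh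
        have hdeg : (1 + p).natDegree = n + h.natDegree := by rw [hh, natDegree_mul hf0 hh0, hf]
        have hle : (1 + p).natDegree ≤ 2 * (n - 1) :=
          (natDegree_add_le _ _).trans (max_le (by simp) hd)
        have hn1 : 1 ≤ n := hn.pos
        obtain ⟨x, hx⟩ := ih h.natDegree (by omega) h rfl (by
          rw [hdeg] at hev
          rcases Nat.even_or_odd h.natDegree with h1 | h1
          · exact absurd hev (Nat.not_even_iff_odd.2 (hn.add_even h1))
          · exact h1)
        have : (1 + p).eval x = 0 := by rw [hh]; simp [hx.eq_zero]
        refine absurd ?_ hF.1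
        have h3 : IsSumSq (p.eval x) := by simpa using isSumSq_map (evalRingHom x) hp
        have : p.eval x = -1 := by simp at this; linear_combination this
        rwa [← this]
    · have hnu : ¬ IsUnit f := by
        intro h; have := natDegree_eq_zero_of_isUnit h; rw [hf] at this; subst this; simp at hn
      rw [irreducible_iff] at hirr
      push Not at hirr
      obtain ⟨a, b, rfl, ha, hb⟩ := hirr hnu
      have ha0 : a ≠ 0 := left_ne_zero_of_mul hf0
      have hb0 : b ≠ 0 := right_ne_zero_of_mul hf0
      have hda : 0 < a.natDegree := natDegree_pos_iff_degree_pos.2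
        (degree_pos_of_ne_zero_of_nonunit ha0 ha)
      have hdb : 0 < b.natDegree := natDegree_pos_iff_degree_pos.2
        (degree_pos_of_ne_zero_of_nonunit hb0 hb)
      rw [natDegree_mul ha0 hb0] at hf
      rcases Nat.even_or_odd a.natDegree with h1 | h1
      · rcases Nat.even_or_odd b.natDegree with h2 | h2
        · exact absurd (hf ▸ h1.add h2) (Nat.not_even_iff_odd.2 hn)
        · obtain ⟨x, hx⟩ := ih b.natDegree (by omega) b rfl h2
          exact ⟨x, by simp [hx.eq_zero]⟩
      · obtain ⟨x, hx⟩ := ih a.natDegree (by omega) a rfl h1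
        exact ⟨x, by simp [hx.eq_zero]⟩

theorem IsRealClosedField.isRealClosed (hF : IsRealClosedField F) : IsRealClosed F where
  toIsSemireal := isSemireal_iff_not_isSumSq_neg_one.2 hF.1
  isSquare_or_isSquare_neg a := (isSquare_or_neg_isSumSq hF a).imp id (isSquare_of_isSumSq hF)
  exists_isRoot_of_odd_natDegree {f} hf := exists_root_of_odd hF _ f rfl hf

/-- The canonical order of a real closed field. -/
noncomputable abbrev linearOrderOfRealClosed (F : Type) [Field F] [IsRealClosed F] :
    LinearOrder F :=
  letI := Classical.decPred (fun x : F => IsSquare x)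
  have hadd : ∀ a b : F, IsSquare a → IsSquare b → IsSquare (a + b) := by
    intro a b ha hb
    rcases IsRealClosed.isSquare_or_isSquare_neg (a + b) with h | h
    · exact h
    · by_cases h0 : a + b = 0
      · simp [h0]
      · exact absurd (neg_one_isSumSq_of_add_eq_zero (ha.isSumSq.add hb.isSumSq) h.isSumSq
          (by ring) h0) (IsSemireal.not_isSumSq_neg_one F)
  { le := fun a b => IsSquare (b - a)
    le_refl := fun a => by simp
    le_trans := fun a b c hab hbc => by
      have := hadd _ _ hbc hab
      rwa [show c - b + (b - a) = c - a by ring] at this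
    le_antisymm := fun a b hab hba => by
      by_contra hne
      exact absurd (neg_one_isSumSq_of_add_eq_zero hab.isSumSq hba.isSumSq (by ring)
        (sub_ne_zero.2 (Ne.symm hne))) (IsSemireal.not_isSumSq_neg_one F)
    le_total := fun a b => by
      simpa using IsRealClosed.isSquare_or_isSquare_neg (b - a)
    toDecidableLE := fun a b => inferInstanceAs (Decidable (IsSquare (b - a))) }

theorem isStrictOrderedRing_of_realClosed (F : Type) [Field F] [IsRealClosed F] :
    letI := linearOrderOfRealClosed F
    IsStrictOrderedRing F := by
  let _ := linearOrderOfRealClosed F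
  have hle : ∀ a b : F, a ≤ b ↔ IsSquare (b - a) := fun _ _ => Iff.rfl
  have : IsOrderedAddMonoid F :=
    { add_le_add_left := fun a b hab c => by
        rw [hle] at hab ⊢; simpa using hab }
  have : ZeroLEOneClass F := ⟨by rw [hle]; simp⟩
  refine IsStrictOrderedRing.of_mul_pos fun a b ha hb => ?_
  refine lt_of_le_of_ne ?_ (mul_ne_zero ha.ne' hb.ne').symm
  have h1 := (hle _ _).1 ha.le
  have h2 := (hle _ _).1 hb.le
  rw [hle]; simpa using IsSquare.mul h1 h2

end Closed

theorem exists_realClosed_algebraic (K : Type) [Field K] (hK : IsFormallyRealField K) :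
    ∃ (R : Type) (_ : Field R) (_ : Algebra K R), Algebra.IsAlgebraic K R ∧
      IsRealClosedField R := by
  let Ω := AlgebraicClosure K
  let S : Set (IntermediateField K Ω) := {L | IsFormallyRealField L}
  have hbot : (⊥ : IntermediateField K Ω) ∈ S :=
    not_isSumSq_of_injective (IntermediateField.botEquiv K Ω).toRingEquiv.toRingHom hK
  obtain ⟨M, -, hM⟩ := zorn_le_nonempty₀ S (by
    intro c hc hchain y hy
    have hdir : DirectedOn (· ≤ ·) c := hchain.directedOn
    have : Nonempty c := ⟨⟨y, hy⟩⟩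
    have hmem : ∀ z : Ω, z ∈ sSup c ↔ ∃ L ∈ c, z ∈ L := by
      intro z
      have := IntermediateField.coe_iSup_of_directed (t := fun L : c => L.1) hdir.directed_val
      rw [sSup_eq_iSup', ← SetLike.mem_coe, this]
      simp
    refine ⟨sSup c, ?_, fun z hz => le_sSup hz⟩
    intro hneg
    have key : ∀ z : ((sSup c : IntermediateField K Ω)), IsSumSq z →
        ∃ L ∈ c, ∃ w : L, (w : Ω) = z ∧ IsSumSq w := by
      intro z hz
      induction hz with
      | zero => exact ⟨y, hy, 0, by simp, by simp⟩
      | sq_add a _ ih =>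
        obtain ⟨L, hL, w, hw, hsq⟩ := ih
        obtain ⟨L', hL', ha⟩ := (hmem a).1 a.2
        obtain ⟨L'', hL'', h1, h2⟩ := hdir L hL L' hL'
        refine ⟨L'', hL'', ⟨a, h2 ha⟩ * ⟨a, h2 ha⟩ + IntermediateField.inclusion h1 w, ?_, ?_⟩
        · simp [hw]
        · exact .sq_add _ (isSumSq_map (IntermediateField.inclusion h1).toRingHom hsq)
    obtain ⟨L, hL, w, hw, hsq⟩ := key _ hneg
    refine hc hL ?_
    have : w = -1 := by ext; simpa using hw
    rwa [← this]) ⊥ hbot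
  refine ⟨M, inferInstance, inferInstance, inferInstance, hM.prop, ?_⟩
  intro E _ _ halg hE x
  let f : E →ₐ[M] Ω := IsAlgClosed.lift
  let L : IntermediateField K Ω := (f.fieldRange).restrictScalars K
  have hL : L ∈ S :=
    not_isSumSq_of_injective ((AlgEquiv.ofInjectiveField f).symm.toRingEquiv.toRingHom :
      f.fieldRange →+* E) hE
  have hle : M ≤ L := fun m hm => ⟨algebraMap M E ⟨m, hm⟩, by simp⟩
  have hle' := hM.le_of_ge hL hle
  have hx : f x ∈ M := hle' ⟨x, rfl⟩
  exact ⟨⟨f x, hx⟩, f.injective (by simp)⟩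

/-- The algebra `A[i]`. -/
abbrev Cx (A : Type*) [CommRing A] := QuadraticAlgebra A (-1) 0

instance factCx {R : Type*} [Field R] [IsSemireal R] : Fact (∀ r : R, r ^ 2 ≠ -1 + 0 * r) :=
  ⟨fun r hr => IsSemireal.not_isSumSq_neg_one R (by
    have : (-1 : R) = r * r := by linear_combination -hr
    rw [this]; simp)⟩

theorem isSquare_cx {R : Type} [Field R] [IsRealClosed R] (z : Cx R) : IsSquare z := by
  let _ := linearOrderOfRealClosed R
  have := isStrictOrderedRing_of_realClosed R
  obtain ⟨n, hn0, hn⟩ : ∃ n : R, 0 ≤ n ∧ n * n = z.re * z.re + z.im * z.im := by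
    obtain ⟨n, hn⟩ : IsSquare (z.re * z.re + z.im * z.im) :=
      IsRealClosed.nonneg_iff_isSquare.1 (add_nonneg (mul_self_nonneg _) (mul_self_nonneg _))
    exact ⟨|n|, abs_nonneg _, by rw [hn, abs_mul_abs_self]⟩
  have h1 : |z.re| ≤ n := abs_le_of_sq_le_sq (by nlinarith [mul_self_nonneg z.im]) hn0
  obtain ⟨u, hu⟩ : IsSquare ((n + z.re) / 2) :=
    IsRealClosed.nonneg_iff_isSquare.1 (by have := neg_abs_le z.re; linarith)
  obtain ⟨v, hv⟩ : IsSquare ((n - z.re) / 2) :=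
    IsRealClosed.nonneg_iff_isSquare.1 (by have := le_abs_self z.re; linarith)
  have h2 : (2 * u * v) * (2 * u * v) = z.im * z.im := by
    have : (2 * u * v) * (2 * u * v) = 4 * (u * u) * (v * v) := by ring
    rw [this, ← hu, ← hv]; linear_combination hn
  rcases mul_self_eq_mul_self_iff.1 h2 with h | h
  · refine ⟨⟨u, v⟩, ?_⟩
    ext
    · simp; linear_combination hu - hv
    · simp; linear_combination -h
  · refine ⟨⟨u, -v⟩, ?_⟩
    ext
    · simp; linear_combination hu - hv
    · simp; linear_combination h

theorem finrank_eq_one_of_odd {R N : Type} [Field R] [IsRealClosed R] [Field N] [Algebra R N]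
    [FiniteDimensional R N] (h : Odd (Module.finrank R N)) : Module.finrank R N = 1 := by
  have : CharZero R := inferInstance
  obtain ⟨α, hα⟩ := Field.exists_primitive_element R N
  have hInt : IsIntegral R α := Algebra.IsIntegral.isIntegral α
  have hd : (minpoly R α).natDegree = Module.finrank R N := by
    rw [← IntermediateField.adjoin.finrank hInt, hα, IntermediateField.finrank_top']
  obtain ⟨x, hx⟩ := IsRealClosed.exists_isRoot_of_odd_natDegree (hd ▸ h)
  have := natDegree_eq_of_degree_eq_some (degree_eq_one_of_irreducible_of_root (minpoly.irreducible
      hInt) hx)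
  rw [← hd]; exact this

theorem two_dvd_of_cx {C N : Type} [Field C] [CharZero C] [Field N] [Algebra C N]
    (hsq : ∀ z : C, IsSquare z) : Module.finrank C N ≠ 2 := by
  intro h
  have : FiniteDimensional C N := Module.finite_of_finrank_pos (by omega)
  obtain ⟨α, hα⟩ := Field.exists_primitive_element C N
  have hInt : IsIntegral C α := Algebra.IsIntegral.isIntegral α
  have hd : (minpoly C α).natDegree = 2 := by
    rw [← IntermediateField.adjoin.finrank hInt, hα, IntermediateField.finrank_top', h]
  have hm := minpoly.monic hInt
  have hirr := minpoly.irreducible hInt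
  generalize minpoly C α = p at *
  have hp : p = X ^ 2 + Polynomial.C (p.coeff 1) * X + Polynomial.C (p.coeff 0) := by
    have h2 : p.coeff 2 = 1 := by rw [← hd]; exact hm
    conv_lhs => rw [p.as_sum_range' 3 (by omega)]
    simp [Finset.sum_range_succ, h2, ← C_mul_X_pow_eq_monomial]
    ring
  obtain ⟨s, hs⟩ := hsq ((p.coeff 1) ^ 2 - 4 * p.coeff 0)
  have hroot : p.IsRoot ((- p.coeff 1 + s) / 2) := by
    have e : ∀ b c : C, b ^ 2 - 4 * c = s * s →
        eval ((-b + s) / 2) (X ^ 2 + Polynomial.C b * X + Polynomial.C c) = 0 := by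
      intro b c h
      simp
      field_simp
      linear_combination -h
    have h3 := e _ _ hs
    rwa [← hp] at h3
  have h1 : p.natDegree = 1 :=
    natDegree_eq_of_degree_eq_some (degree_eq_one_of_irreducible_of_root hirr hroot)
  omega

theorem finrank_cx_eq_one {R N : Type} [Field R] [IsRealClosed R] [Field N] [Algebra R N]
    [Algebra (Cx R) N] [IsScalarTower R (Cx R) N] [FiniteDimensional R N] [IsGalois R N] :
    Module.finrank (Cx R) N = 1 := by
  have : FiniteDimensional (Cx R) N := Module.Finite.of_restrictScalars_finite R _ _
  have : IsGalois (Cx R) N := IsGalois.tower_top_of_isGalois R _ _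
  have hp2 : Fact (Nat.Prime 2) := ⟨Nat.prime_two⟩
  obtain ⟨P⟩ : Nonempty (Sylow 2 Gal(N/R)) := inferInstance
  have hodd : Odd (Module.finrank R (IntermediateField.fixedField (P : Subgroup Gal(N/R)))) := by
    have h1 : ¬ 2 ∣ (P : Subgroup Gal(N/R)).index := Sylow.not_dvd_index P
    have h2 := IntermediateField.finrank_fixedField_eq_card (P : Subgroup Gal(N/R))
    have h3 := Module.finrank_mul_finrank R (IntermediateField.fixedField (P : Subgroup Gal(N/R))) N
    have h4 := (P : Subgroup Gal(N/R)).card_mul_index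
    rw [IsGalois.card_aut_eq_finrank, ← h3, h2, mul_comm] at h4
    have h5 := Nat.eq_of_mul_eq_mul_right (Nat.card_pos) h4
    rw [← h5]
    exact Nat.not_even_iff_odd.1 fun h => h1 h.two_dvd
  have h1 := finrank_eq_one_of_odd hodd
  have h2 := IntermediateField.finrank_fixedField_eq_card (P : Subgroup Gal(N/R))
  have h3 := Module.finrank_mul_finrank R (IntermediateField.fixedField (P : Subgroup Gal(N/R))) N
  rw [h1, one_mul, h2] at h3
  obtain ⟨m, hm⟩ := (IsPGroup.iff_card.1 P.isPGroup')
  have h6 := Module.finrank_mul_finrank R (Cx R) N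
  rw [QuadraticAlgebra.finrank_eq_two, ← h3, hm] at h6
  have hdvd : Module.finrank (Cx R) N ∣ 2 ^ m := ⟨2, by omega⟩
  obtain ⟨l, -, hl⟩ := (Nat.dvd_prime_pow Nat.prime_two).1 hdvd
  rcases l with _ | l
  · simpa using hl
  exfalso
  obtain ⟨H, hH⟩ := Sylow.exists_subgroup_card_pow_prime (G := Gal(N/Cx R)) 2 (n := l) (by
    rw [IsGalois.card_aut_eq_finrank, hl]; exact pow_dvd_pow _ (by omega))
  have h7 := IntermediateField.finrank_fixedField_eq_card H
  have h8 := Module.finrank_mul_finrank (Cx R) (IntermediateField.fixedField H) N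
  rw [h7, hH, hl, pow_succ, mul_comm] at h8
  exact two_dvd_of_cx isSquare_cx (Nat.eq_of_mul_eq_mul_left (by positivity) h8)

instance isAlgClosed_cx {R : Type} [Field R] [IsRealClosed R] : IsAlgClosed (Cx R) := by
  let Ω := AlgebraicClosure (Cx R)
  have : Algebra.IsAlgebraic R Ω := Algebra.IsAlgebraic.trans R (Cx R) Ω
  have hz : Function.Surjective (algebraMap (Cx R) Ω) := by
    intro z
    have hzi : IsIntegral (Cx R) z := Algebra.IsIntegral.isIntegral z
    let M := IntermediateField.adjoin (Cx R) {z}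
    have : FiniteDimensional (Cx R) M := IntermediateField.adjoin.finiteDimensional hzi
    have : FiniteDimensional R M := Module.Finite.trans (Cx R) M
    let N := IntermediateField.normalClosure R M Ω
    have : IsScalarTower R M Ω := IsScalarTower.of_algebraMap_eq fun x => rfl
    let _ : Algebra M N := inferInstanceAs (Algebra M (IntermediateField.normalClosure R M Ω))
    have : IsScalarTower M N Ω :=
      inferInstanceAs (IsScalarTower M (IntermediateField.normalClosure R M Ω) Ω)
    have : IsScalarTower R M N :=
      inferInstanceAs (IsScalarTower R M (IntermediateField.normalClosure R M Ω))
    let _ : Algebra (Cx R) N := ((algebraMap M N).comp (algebraMap (Cx R) M)).toAlgebra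
    have : IsScalarTower R (Cx R) N := IsScalarTower.of_algebraMap_eq fun x => by
      rw [IsScalarTower.algebraMap_apply R M N]; rfl
    have : IsScalarTower (Cx R) N Ω := IsScalarTower.of_algebraMap_eq fun x => rfl
    have : FiniteDimensional R N := inferInstance
    have : Normal R N := inferInstance
    have : IsGalois R N := ⟨⟩
    have h := finrank_cx_eq_one (R := R) (N := N)
    have hb := (finrank_eq_one_iff_of_nonzero' (1 : N) one_ne_zero).1 h
    obtain ⟨c, hc⟩ := hb (algebraMap M N ⟨z, IntermediateField.mem_adjoin_simple_self _ z⟩)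
    refine ⟨c, ?_⟩
    have := congrArg (algebraMap N Ω) hc
    rw [Algebra.smul_def, mul_one] at this
    exact this
  exact IsAlgClosed.of_ringEquiv Ω (Cx R)
    (RingEquiv.ofBijective (algebraMap (Cx R) Ω) ⟨FaithfulSMul.algebraMap_injective _ _, hz⟩).symm

theorem mem_range_of_isAlgebraic {R Ω : Type} [Field R] [IsRealClosed R] [Field Ω] [Algebra R Ω]
    [IsSemireal Ω] {b : Ω} (hb : IsAlgebraic R b) : b ∈ Set.range (algebraMap R Ω) := by
  let M := IntermediateField.adjoin R {b}
  have : Algebra.IsAlgebraic R M := IntermediateField.isAlgebraic_adjoin_simple hb.isIntegral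
  let f : M →ₐ[R] Cx R := IsAlgClosed.lift
  let b' : M := ⟨b, IntermediateField.mem_adjoin_simple_self _ b⟩
  by_cases h : (f b').im = 0
  · refine ⟨(f b').re, ?_⟩
    have : algebraMap R M (f b').re = b' := f.injective (by
      ext
      · simp
      · simp [h])
    simpa [b'] using congrArg (algebraMap M Ω) this
  · exfalso
    let c : M := (b' - algebraMap R M (f b').re) * algebraMap R M (f b').im⁻¹
    have hc : c * c = -1 := f.injective (by
      ext
      · simp [c, QuadraticAlgebra.re_one]; field_simp
      · simp [c, QuadraticAlgebra.im_one])
    refine IsSemireal.not_isSumSq_neg_one Ω ?_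
    have : (-1 : Ω) = (c : Ω) * c := by
      rw [← IntermediateField.coe_mul, hc]; simp
    rw [this]; simp

instance isRealClosed_algebraicClosure {F R : Type} [Field F] [Field R] [Algebra F R]
    [IsRealClosed R] : IsRealClosed (algebraicClosure F R) where
  toIsSemireal := isSemireal_iff_not_isSumSq_neg_one.2
    (not_isSumSq_of_injective (algebraMap (algebraicClosure F R) R)
      (IsSemireal.not_isSumSq_neg_one R))
  isSquare_or_isSquare_neg x := by
    have key : ∀ y : algebraicClosure F R, IsSquare (y : R) → IsSquare y := by
      rintro y ⟨z, hz⟩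
      have hz' : z ∈ algebraicClosure F R := by
        rw [mem_algebraicClosure_iff']
        have := (mem_algebraicClosure_iff'.1 y.2)
        rw [hz, ← pow_two] at this
        exact this.of_pow two_pos
      exact ⟨⟨z, hz'⟩, Subtype.ext hz⟩
    rcases IsRealClosed.isSquare_or_isSquare_neg (x : R) with h | h
    · exact .inl (key x h)
    · exact .inr (key (-x) (by simpa using h))
  exists_isRoot_of_odd_natDegree {f} hf := by
    obtain ⟨x, hx⟩ := IsRealClosed.exists_isRoot_of_odd_natDegree
      (f := f.map (algebraMap (algebraicClosure F R) R)) (by simpa using hf)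
    have hf0 : f ≠ 0 := by rintro rfl; simp at hf
    have hxa : IsAlgebraic (algebraicClosure F R) x :=
      ⟨f, hf0, by simpa [IsRoot.def, eval_map_algebraMap] using hx⟩
    have hx' : x ∈ algebraicClosure F R := by
      rw [mem_algebraicClosure_iff]
      exact hxa.restrictScalars F
    refine ⟨⟨x, hx'⟩, (algebraMap (algebraicClosure F R) R).injective ?_⟩
    have h2 := hx.eq_zero
    rw [eval_map] at h2
    have h3 := eval₂_at_apply (p := f) (algebraMap (algebraicClosure F R) R) (⟨x, hx'⟩)
    rw [map_zero, ← h3]; exact h2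

section Trace

variable {F M : Type} [Field F] [LinearOrder F] [IsStrictOrderedRing F]
  [Field M] [LinearOrder M] [IsStrictOrderedRing M] [IsRealClosed M] [Algebra F M]

/-- Complex conjugation as an algebra homomorphism. -/
noncomputable def conjHom (A B : Type) [CommRing A] [CommRing B] [Algebra A B] :
    Cx B →ₐ[A] Cx B :=
  { starRingEnd (Cx B) with
    commutes' := fun r => by
      ext <;> simp [starRingEnd_apply, QuadraticAlgebra.algebraMap_eq,
          IsScalarTower.algebraMap_apply A B (Cx B)] }

@[simp] theorem conjHom_re (A B : Type) [CommRing A] [CommRing B] [Algebra A B] (z : Cx B) :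
    (conjHom A B z).re = z.re := by
  simp [conjHom, starRingEnd_apply]

@[simp] theorem conjHom_im (A B : Type) [CommRing A] [CommRing B] [Algebra A B] (z : Cx B) :
    (conjHom A B z).im = -z.im := by
  simp [conjHom, starRingEnd_apply]

variable {L : Type} [Field L] [Algebra F L] [FiniteDimensional F L]

theorem sum_embeddings_sq {ι : Type} [Fintype ι] (v : ι → L) (w : ι → F)
    (hv : ∀ i j, i ≠ j → Algebra.trace F L (v i * v j) = 0)
    (hw : ∀ i, Algebra.trace F L (v i * v i) = w i) (x : ι → M) :
    ∑ σ : L →ₐ[F] Cx M, (∑ i, algebraMap M (Cx M) (x i) * σ (v i)) ^ 2 =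
      algebraMap M (Cx M) (∑ i, algebraMap F M (w i) * x i ^ 2) := by
  classical
  have h1 : ∀ σ : L →ₐ[F] Cx M, (∑ i, algebraMap M (Cx M) (x i) * σ (v i)) ^ 2 =
      ∑ i, ∑ j, algebraMap M (Cx M) (x i * x j) * σ (v i * v j) := by
    intro σ
    rw [pow_two, Finset.sum_mul_sum]
    refine Finset.sum_congr rfl fun i _ => Finset.sum_congr rfl fun j _ => ?_
    simp only [map_mul]; ring
  simp_rw [h1]
  rw [Finset.sum_comm]
  simp_rw [Finset.sum_comm (s := (Finset.univ : Finset (L →ₐ[F] Cx M))), ← Finset.mul_sum,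
    ← trace_eq_sum_embeddings]
  rw [map_sum]
  refine Finset.sum_congr rfl fun i _ => ?_
  rw [Finset.sum_eq_single i]
  · rw [hw, map_mul, map_mul, map_pow, IsScalarTower.algebraMap_apply F M (Cx M)]; ring
  · intro j _ hj
    rw [hv i j hj.symm]; simp
  · simp

theorem exists_ker {ι S : Type} [Fintype ι] [Finite S] (T : (ι → M) →ₗ[M] (S → M))
    (I : Finset ι) (h : Nat.card S < I.card) :
    ∃ x : ι → M, x ≠ 0 ∧ (∀ i, i ∉ I → x i = 0) ∧ T x = 0 := by
  classical
  have := Fintype.ofFinite S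
  rw [Nat.card_eq_fintype_card] at h
  let E : (I → M) →ₗ[M] (ι → M) :=
    { toFun := fun y i => if hi : i ∈ I then y ⟨i, hi⟩ else 0
      map_add' := fun y z => by ext i; by_cases hi : i ∈ I <;> simp [hi]
      map_smul' := fun c y => by ext i; by_cases hi : i ∈ I <;> simp [hi] }
  have hlt : Module.finrank M (S → M) < Module.finrank M (I → M) := by simpa using h
  obtain ⟨y, hy, hy0⟩ := (Submodule.ne_bot_iff _).1
    (LinearMap.ker_ne_bot_of_finrank_lt (f := T.comp E) hlt)
  refine ⟨E y, ?_, ?_, ?_⟩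
  · intro h0
    refine hy0 (funext fun i => ?_)
    have := congrFun h0 i.1
    simpa [E] using this
  · intro i hi; simp [E, hi]
  · simpa using hy

/-- The number of negative (`ε = 1`) or positive (`ε = -1`) weights of a diagonalised trace form is
bounded by any set of embeddings that controls the other ones. -/
theorem card_le_of_control {ι : Type} [Fintype ι] (v : ι → L) (w : ι → F)
    (hv : ∀ i j, i ≠ j → Algebra.trace F L (v i * v j) = 0)
    (hw : ∀ i, Algebra.trace F L (v i * v i) = w i) (hmono : StrictMono (algebraMap F M))
    (ε : F) (S : Set (L →ₐ[F] Cx M)) (g : Cx M →ₗ[M] M)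
    (hctrl : ∀ x : ι → M, (∀ σ ∈ S, g (∑ i, algebraMap M (Cx M) (x i) * σ (v i)) = 0) →
      ∀ σ : L →ₐ[F] Cx M,
        0 ≤ (algebraMap F M ε) * ((∑ i, algebraMap M (Cx M) (x i) * σ (v i)) ^ 2).re)
    (I : Finset ι) (hI : ∀ i ∈ I, ε * w i < 0) : I.card ≤ Nat.card S := by
  by_contra! hlt
  have : Finite S := inferInstance
  let T : (ι → M) →ₗ[M] (S → M) :=
    { toFun := fun x σ => g (∑ i, algebraMap M (Cx M) (x i) * σ.1 (v i))
      map_add' := fun x y => by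
        ext σ; simp [add_mul, Finset.sum_add_distrib]
      map_smul' := fun c x => by
        ext σ
        simp only [Pi.smul_apply, smul_eq_mul, map_mul, mul_assoc, ← Finset.mul_sum,
          RingHom.id_apply]
        rw [← Algebra.smul_def, map_smul, smul_eq_mul] }
  obtain ⟨x, hx0, hxI, hTx⟩ := exists_ker T I hlt
  have hpos := hctrl x (fun σ hσ => congrFun hTx ⟨σ, hσ⟩)
  have hsum := congrArg QuadraticAlgebra.re (sum_embeddings_sq (M := M) v w hv hw x)
  have hre : ∀ f : (L →ₐ[F] Cx M) → Cx M, (∑ σ, f σ).re = ∑ σ, (f σ).re := fun f =>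
    map_sum (QuadraticAlgebra.reₗ (R := M) (a := -1) (b := 0)) f _
  rw [hre] at hsum
  have h1 : 0 ≤ algebraMap F M ε * ∑ i, algebraMap F M (w i) * x i ^ 2 := by
    have : (algebraMap M (Cx M) (∑ i, algebraMap F M (w i) * x i ^ 2)).re =
      ∑ i, algebraMap F M (w i) * x i ^ 2 := rfl
    rw [← this, ← hsum, Finset.mul_sum]
    exact Finset.sum_nonneg fun σ _ => hpos σ
  obtain ⟨i₀, hi₀⟩ : ∃ i, x i ≠ 0 := by
    by_contra! h; exact hx0 (funext h)
  have hterm : ∀ i, algebraMap F M ε * (algebraMap F M (w i) * x i ^ 2) ≤ 0 := by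
    intro i
    by_cases hi : i ∈ I
    · have := hmono (hI i hi)
      rw [map_mul, map_zero] at this
      rw [← mul_assoc]
      exact mul_nonpos_of_nonpos_of_nonneg this.le (sq_nonneg _)
    · simp [hxI i hi]
  have h2 : algebraMap F M ε * ∑ i, algebraMap F M (w i) * x i ^ 2 < 0 := by
    rw [Finset.mul_sum]
    refine Finset.sum_neg' (fun i _ => hterm i) ⟨i₀, Finset.mem_univ _, ?_⟩
    have hi : i₀ ∈ I := by by_contra h; exact hi₀ (hxI _ h)
    have := hmono (hI _ hi)
    rw [map_mul, map_zero] at this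
    rw [← mul_assoc]
    exact mul_neg_of_neg_of_pos this (by positivity)
  exact absurd h1 h2.not_ge

end Trace

section Trace

variable {F M : Type} [Field F] [LinearOrder F] [IsStrictOrderedRing F]
  [Field M] [LinearOrder M] [IsStrictOrderedRing M] [IsRealClosed M] [Algebra F M]
variable {L : Type} [Field L] [Algebra F L] [FiniteDimensional F L]

theorem conj_comp_sum {ι : Type} [Fintype ι] (v : ι → L) (x : ι → M) (σ : L →ₐ[F] Cx M) :
    ∑ i, algebraMap M (Cx M) (x i) * ((conjHom F M).comp σ) (v i) =
      conjHom F M (∑ i, algebraMap M (Cx M) (x i) * σ (v i)) := by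
  rw [map_sum]
  refine Finset.sum_congr rfl fun i _ => ?_
  rw [map_mul]
  congr 1
  ext <;> simp

theorem conj_comp_eq {α : L} (hα : IntermediateField.adjoin F {α} = ⊤) (σ : L →ₐ[F] Cx M)
    (h : (σ α).im = 0) : (conjHom F M).comp σ = σ := by
  refine AlgHom.ext fun x => ?_
  have hx : x ∈ IntermediateField.adjoin F {α} := hα ▸ IntermediateField.mem_top
  induction hx using IntermediateField.adjoin_induction with
  | mem y hy =>
    obtain rfl : y = α := hy
    ext <;> simp [h]
  | algebraMap y => simp only [AlgHom.commutes]
  | add y z _ _ h1 h2 => rw [map_add, h1, h2, map_add]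
  | inv y _ h1 => rw [map_inv₀, h1, map_inv₀]
  | mul y z _ _ h1 h2 => rw [map_mul, h1, h2, map_mul]

theorem exists_root_iff_neg_lt {ι : Type} [Fintype ι] (v : ι → L) (w : ι → F)
    (hv : ∀ i j, i ≠ j → Algebra.trace F L (v i * v j) = 0)
    (hw : ∀ i, Algebra.trace F L (v i * v i) = w i) (hmono : StrictMono (algebraMap F M))
    (hw0 : ∀ i, w i ≠ 0) (hcard : Fintype.card ι = Module.finrank F L)
    {α : L} (hα : IntermediateField.adjoin F {α} = ⊤) :
    (∃ σ : L →ₐ[F] Cx M, (σ α).im = 0) ↔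
      2 * (Finset.univ.filter fun i => w i < 0).card < Fintype.card ι := by
  classical
  let S : Set (L →ₐ[F] Cx M) := {σ | 0 < (σ α).im}
  let S' : Set (L →ₐ[F] Cx M) := {σ | (σ α).im < 0}
  let R : Set (L →ₐ[F] Cx M) := {σ | (σ α).im = 0}
  have hconj : ∀ σ : L →ₐ[F] Cx M, (conjHom F M).comp ((conjHom F M).comp σ) = σ := by
    intro σ; ext <;> simp
  have hSS' : Nat.card S = Nat.card S' := by
    refine Nat.card_congr
      { toFun := fun σ => ⟨(conjHom F M).comp σ.1, by
          have : 0 < (σ.1 α).im := σ.2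
          simpa [S'] using this⟩
        invFun := fun σ => ⟨(conjHom F M).comp σ.1, by
          have : (σ.1 α).im < 0 := σ.2
          simpa [S] using this⟩
        left_inv := fun σ => Subtype.ext (hconj _)
        right_inv := fun σ => Subtype.ext (hconj _) }
  have htot : Fintype.card ι = 2 * Nat.card S + Nat.card R := by
    have h2 : 2 * Nat.card S = Nat.card S + Nat.card S' := by omega
    rw [hcard, ← AlgHom.card F L (Cx M), h2]
    simp only [Nat.card_eq_fintype_card, S, S', R, Set.coe_ofPred, Fintype.card_subtype]
    rw [← Finset.card_univ, ← Finset.card_union_of_disjoint, ← Finset.card_union_of_disjoint]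
    · congr 1
      ext σ
      rcases lt_trichotomy (σ α).im 0 with h | h | h <;> simp [h]
    · rw [Finset.disjoint_left]
      intro σ h1 h2
      simp only [Finset.mem_union, Finset.mem_filter, Finset.mem_univ, true_and] at h1 h2
      rcases h1 with h1 | h1 <;> linarith
    · rw [Finset.disjoint_left]
      intro σ h1 h2
      simp only [Finset.mem_filter, Finset.mem_univ, true_and] at h1 h2
      linarith
  have him : ∀ x : ι → M,
      (∀ σ ∈ S, (∑ i, algebraMap M (Cx M) (x i) * σ (v i)).im = 0) →
      ∀ σ : L →ₐ[F] Cx M, (∑ i, algebraMap M (Cx M) (x i) * σ (v i)).im = 0 := by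
    intro x hx σ
    rcases lt_trichotomy (σ α).im 0 with h | h | h
    · have := hx ((conjHom F M).comp σ) (by simpa [S] using h)
      rw [conj_comp_sum, conjHom_im] at this
      exact neg_eq_zero.1 this
    · have := conj_comp_sum v x σ
      rw [conj_comp_eq hα σ h] at this
      have := congrArg QuadraticAlgebra.im this
      rw [conjHom_im] at this
      linarith
    · exact hx σ h
  have hq : (Finset.univ.filter fun i => w i < 0).card ≤ Nat.card S := by
    refine card_le_of_control (M := M) v w hv hw hmono 1 S
      (QuadraticAlgebra.imₗ (R := M) (a := -1) (b := 0)) ?_ _ (by simp)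
    intro x hx σ
    have h1 := him x hx σ
    rw [pow_two]
    simp only [map_one, one_mul, QuadraticAlgebra.re_mul, h1]
    nlinarith [mul_self_nonneg (∑ i, algebraMap M (Cx M) (x i) * σ (v i)).re]
  constructor
  · rintro ⟨σ, hσ⟩
    have : 0 < Nat.card R := Nat.card_pos_iff.2 ⟨⟨⟨σ, hσ⟩⟩, inferInstance⟩
    omega
  · intro hlt
    by_contra hno
    push Not at hno
    have hp : (Finset.univ.filter fun i => 0 < w i).card ≤ Nat.card S := by
      refine card_le_of_control (M := M) v w hv hw hmono (-1) S
        (QuadraticAlgebra.reₗ (R := M) (a := -1) (b := 0)) ?_ _ (by simp)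
      intro x hx σ
      have h1 : (∑ i, algebraMap M (Cx M) (x i) * σ (v i)).re = 0 := by
        rcases lt_or_gt_of_ne (hno σ) with h | h
        · have := hx ((conjHom F M).comp σ) (by simpa [S] using h)
          rw [conj_comp_sum] at this
          exact (conjHom_re F M _).symm.trans this
        · exact hx σ h
      rw [pow_two]
      simp only [map_neg, map_one, QuadraticAlgebra.re_mul, h1]
      nlinarith [mul_self_nonneg (∑ i, algebraMap M (Cx M) (x i) * σ (v i)).im]
    have hR : Nat.card R = 0 := by
      rw [Nat.card_eq_zero]; left
      exact ⟨fun σ => hno σ.1 σ.2⟩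
    have hpq : (Finset.univ.filter fun i => w i < 0).card +
        (Finset.univ.filter fun i => 0 < w i).card = Fintype.card ι := by
      rw [← Finset.card_univ, ← Finset.card_union_of_disjoint]
      · congr 1
        ext i
        rcases lt_or_gt_of_ne (hw0 i) with h | h <;> simp [h]
      · rw [Finset.disjoint_left]
        intro i h1 h2
        simp only [Finset.mem_filter, Finset.mem_univ, true_and] at h1 h2
        exact lt_asymm h1 h2
    omega

theorem exists_embedding_iff_isRoot (f : F[X]) [Fact (Irreducible f)] :
    (∃ σ : AdjoinRoot f →ₐ[F] Cx M, (σ (AdjoinRoot.root f)).im = 0) ↔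
      ∃ m : M, aeval m f = 0 := by
  constructor
  · rintro ⟨σ, hσ⟩
    refine ⟨(σ (AdjoinRoot.root f)).re, ?_⟩
    have h1 : algebraMap M (Cx M) (σ (AdjoinRoot.root f)).re = σ (AdjoinRoot.root f) := by
      ext <;> simp [hσ]
    have h2 : aeval (σ (AdjoinRoot.root f)) f = 0 := by
      rw [aeval_algHom_apply, AdjoinRoot.aeval_eq]; simp
    rw [← h1, aeval_algebraMap_apply] at h2
    exact (algebraMap M (Cx M)).injective (by simpa using h2)
  · rintro ⟨m, hm⟩
    have h0 : aeval (algebraMap M (Cx M) m) f = 0 := by rw [aeval_algebraMap_apply, hm, map_zero]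
    refine ⟨AdjoinRoot.liftAlgHom f (Algebra.ofId F (Cx M)) (algebraMap M (Cx M) m)
      (by simpa [aeval_def] using h0), ?_⟩
    simp

end Trace

section Transfer

variable {F M N : Type} [Field F] [LinearOrder F] [IsStrictOrderedRing F]
  [Field M] [LinearOrder M] [IsStrictOrderedRing M] [IsRealClosed M] [Algebra F M]
  [Field N] [LinearOrder N] [IsStrictOrderedRing N] [IsRealClosed N] [Algebra F N]

theorem root_transfer_irreducible (hM : StrictMono (algebraMap F M))
    (hN : StrictMono (algebraMap F N)) (f : F[X]) (hf : Irreducible f)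
    (h : ∃ m : M, aeval m f = 0) : ∃ m : N, aeval m f = 0 := by
  have := Fact.mk hf
  let L := AdjoinRoot f
  have : FiniteDimensional F L := (AdjoinRoot.powerBasis hf.ne_zero).finite
  have : Invertible (2 : F) := invertibleOfNonzero two_ne_zero
  have hnd := traceForm_nondegenerate F L
  obtain ⟨v, hv⟩ := LinearMap.BilinForm.exists_orthogonal_basis (B := Algebra.traceForm F L)
    ⟨fun x y => by simp [Algebra.traceForm_apply, mul_comm]⟩
  let w : Fin (Module.finrank F L) → F := fun i => Algebra.trace F L (v i * v i)
  have hvo : ∀ i j, i ≠ j → Algebra.trace F L (v i * v j) = 0 := by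
    intro i j hij
    have := hv hij
    simpa [Algebra.traceForm_apply] using this
  have hw0 : ∀ i, w i ≠ 0 := by
    intro i h0
    refine v.ne_zero i (hnd.1 (v i) fun y => ?_)
    have : (Algebra.traceForm F L (v i)) = 0 := by
      refine v.ext fun j => ?_
      by_cases hij : i = j
      · subst hij; simpa [Algebra.traceForm_apply] using h0
      · simpa [Algebra.traceForm_apply] using hvo i j hij
    rw [this]; simp
  have hα : IntermediateField.adjoin F {AdjoinRoot.root f} = (⊤ : IntermediateField F L) := by
    rw [eq_top_iff]
    intro x _
    have := (IntermediateField.algebra_adjoin_le_adjoin F {AdjoinRoot.root f})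
    rw [AdjoinRoot.adjoinRoot_eq_top] at this
    exact this trivial
  rw [← exists_embedding_iff_isRoot, exists_root_iff_neg_lt v w hvo (fun _ => rfl) hN hw0
    (by simp) hα]
  rwa [← exists_embedding_iff_isRoot, exists_root_iff_neg_lt v w hvo (fun _ => rfl) hM hw0
    (by simp) hα] at h

theorem root_transfer (hM : StrictMono (algebraMap F M))
    (hN : StrictMono (algebraMap F N)) (f : F[X]) (hf : f ≠ 0)
    (h : ∃ m : M, aeval m f = 0) : ∃ m : N, aeval m f = 0 := by
  obtain ⟨m, hm⟩ := h
  have halg : IsIntegral F m := IsAlgebraic.isIntegral ⟨f, hf, hm⟩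
  obtain ⟨x, hx⟩ := root_transfer_irreducible hM hN _ (minpoly.irreducible halg)
    ⟨m, minpoly.aeval F m⟩
  obtain ⟨g, hg⟩ := minpoly.dvd F m hm
  exact ⟨x, by rw [hg, map_mul, hx, zero_mul]⟩

theorem exists_embedding (hM : StrictMono (algebraMap F M))
    (hN : StrictMono (algebraMap F N)) [Algebra.IsAlgebraic F M] : Nonempty (M →ₐ[F] N) :=
  Field.nonempty_algHom_of_exists_root fun x => root_transfer hM hN _
    (minpoly.ne_zero (Algebra.IsIntegral.isIntegral x)) ⟨x, minpoly.aeval F x⟩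

end Transfer

theorem strictMono_of_realClosed {R E : Type} [Field R] [LinearOrder R] [IsStrictOrderedRing R]
    [IsRealClosed R] [Field E] [LinearOrder E] [IsStrictOrderedRing E] (f : R →+* E) :
    StrictMono f := by
  intro a b h
  obtain ⟨c, hc⟩ := (IsRealClosed.nonneg_iff_isSquare (R := R)).1 (sub_pos.2 h).le
  have hc0 : f c ≠ 0 := by
    rw [ne_eq, map_eq_zero]
    rintro rfl
    have := sub_pos.2 h
    simp [hc] at this
  have : f b - f a = f c * f c := by rw [← map_sub, hc, map_mul]
  have h2 : 0 < f c * f c := mul_self_pos.2 hc0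
  exact sub_pos.1 (this ▸ h2)

section Unique
variable {F M E : Type} [Field F] [Field M] [LinearOrder M] [IsStrictOrderedRing M]
  [IsRealClosed M] [Field E] [LinearOrder E] [IsStrictOrderedRing E] [Algebra F M] [Algebra F E]

theorem algEquiv_eq_self [Algebra.IsAlgebraic F M] (σ : M →ₐ[F] M) (a : M) : σ a = a := by
  have hmono : StrictMono σ := strictMono_of_realClosed σ.toRingHom
  by_contra hne
  have hinj : Function.Injective fun n : ℕ => σ^[n] a := by
    rcases lt_or_gt_of_ne hne with h | h
    · refine (strictAnti_nat_of_succ_lt fun n => ?_).injective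
      rw [Function.iterate_succ_apply]
      exact (hmono.iterate n) h
    · refine (strictMono_nat_of_lt_succ fun n => ?_).injective
      rw [Function.iterate_succ_apply]
      exact (hmono.iterate n) h
  have hroot : ∀ n : ℕ, σ^[n] a ∈ (minpoly F a).rootSet M := by
    intro n
    rw [mem_rootSet]
    refine ⟨minpoly.ne_zero (Algebra.IsIntegral.isIntegral a), ?_⟩
    induction n with
    | zero => simp
    | succ n ih =>
      rw [Function.iterate_succ_apply', aeval_algHom_apply, ih, map_zero]
  exact (Set.infinite_of_injective_forall_mem hinj hroot) (rootSet_finite _ _)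

theorem algHom_unique [Algebra.IsAlgebraic F M] (φ ψ : M →ₐ[F] E) : φ = ψ := by
  have hmem : ∀ a, φ a ∈ ψ.range := by
    intro a
    let _ : Algebra M E := ψ.toRingHom.toAlgebra
    have : IsScalarTower F M E := IsScalarTower.of_algebraMap_eq fun x => (ψ.commutes x).symm
    have ha : IsAlgebraic F (φ a) := (Algebra.IsAlgebraic.isAlgebraic a).algHom φ
    obtain ⟨b, hb⟩ := mem_range_of_isAlgebraic (R := M)
        (ha.extendScalars (algebraMap F M).injective)
    exact ⟨b, hb⟩
  let e := AlgEquiv.ofInjective ψ ψ.toRingHom.injective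
  let σ : M →ₐ[F] M := e.symm.toAlgHom.comp (φ.codRestrict ψ.range hmem)
  have h : ∀ a, ψ (σ a) = φ a := by
    intro a
    have : e (σ a) = φ.codRestrict ψ.range hmem a := e.apply_symm_apply _
    have h2 := congrArg Subtype.val this
    exact h2
  ext a
  rw [← h, algEquiv_eq_self]
end Unique

section Cut
variable {R M E : Type} [Field R] [LinearOrder R] [IsStrictOrderedRing R] [IsRealClosed R]
  [Field M] [LinearOrder M] [IsStrictOrderedRing M]
  [Field E] [LinearOrder E] [IsStrictOrderedRing E] [Algebra R M] [Algebra R E]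

theorem sign_aeval_eq {m : M} {y : E} (h1 : ∀ a : R, algebraMap R M a < m ↔ algebraMap R E a < y)
    (h2 : ∀ a : R, m < algebraMap R M a ↔ y < algebraMap R E a) (p : R[X]) :
    SignType.sign (aeval m p) = SignType.sign (aeval y p) := by
  have hM := strictMono_of_realClosed (algebraMap R M)
  have hE := strictMono_of_realClosed (algebraMap R E)
  have hC : ∀ c : R, SignType.sign (aeval m (C c)) = SignType.sign (aeval y (C c)) := by
    intro c
    rcases lt_trichotomy c 0 with h | h | h
    · have a := hM h
      have b := hE h
      rw [map_zero] at a b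
      rw [aeval_C, aeval_C, sign_neg a, sign_neg b]
    · simp [h]
    · have a := hM h
      have b := hE h
      rw [map_zero] at a b
      rw [aeval_C, aeval_C, sign_pos a, sign_pos b]
  have hlin : ∀ a : R, SignType.sign (aeval m (X - C a)) = SignType.sign (aeval y (X - C a)) := by
    intro a
    simp only [map_sub, aeval_X, aeval_C]
    rcases lt_trichotomy m (algebraMap R M a) with h | h | h
    · rw [sign_neg (sub_neg.2 h), sign_neg (sub_neg.2 ((h2 a).1 h))]
    · have : y = algebraMap R E a := by
        apply le_antisymm
        · exact not_lt.1 fun h' => absurd ((h1 a).2 h') (by simp [h])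
        · exact not_lt.1 fun h' => absurd ((h2 a).2 h') (by simp [h])
      simp [h, this]
    · rw [sign_pos (sub_pos.2 h), sign_pos (sub_pos.2 ((h1 a).1 h))]
  induction p using UniqueFactorizationMonoid.induction_on_prime with
  | h₁ => simp
  | h₂ u hu =>
    obtain ⟨c, -, rfl⟩ := Polynomial.isUnit_iff.1 hu
    exact hC c
  | h₃ f p hf hp ih =>
    rw [map_mul (aeval m), map_mul (aeval y), sign_mul, sign_mul, ih]
    congr 1
    have hirr := hp.irreducible
    by_cases hr : ∃ a, p.IsRoot a
    · obtain ⟨a, ha⟩ := hr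
      obtain ⟨q, rfl⟩ := dvd_iff_isRoot.2 ha
      rcases hirr.isUnit_or_isUnit rfl with h | h
      · exact absurd h (not_isUnit_X_sub_C a)
      · obtain ⟨c, -, rfl⟩ := Polynomial.isUnit_iff.1 h
        rw [map_mul (aeval m), map_mul (aeval y), sign_mul, sign_mul, hlin, hC]
    · obtain ⟨z, hz⟩ := IsAlgClosed.exists_aeval_eq_zero (Cx R) p hirr.degree_pos.ne'
      have hb : z.im ≠ 0 := by
        intro h
        refine hr ⟨z.re, ?_⟩
        have hz' : z = algebraMap R (Cx R) z.re := by
          ext <;> simp [QuadraticAlgebra.algebraMap_eq, h]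
        rw [hz', aeval_algebraMap_apply, map_eq_zero] at hz
        simpa [IsRoot] using hz
      let q : R[X] := (X - C z.re) ^ 2 + C (z.im ^ 2)
      have hq : q = (X - C z.re) ^ 2 + C (z.im ^ 2) := rfl
      have hqz : aeval z q = 0 := by
        simp only [hq, map_add, map_sub, map_pow, aeval_X, aeval_C]
        ext <;> simp [QuadraticAlgebra.algebraMap_eq, pow_two]
      have hdvd : p ∣ q := by
        have h1 := minpoly.dvd R z hqz
        have h2 := minpoly.eq_of_irreducible hirr hz
        rw [← h2] at h1
        exact (dvd_mul_right _ _).trans h1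
      obtain ⟨s, hs⟩ := hdvd
      have hqd : q.natDegree = 2 := by
        rw [hq]; compute_degree!
      have hq0 : q ≠ 0 := by rintro h; simp [h] at hqd
      have hs0 : s ≠ 0 := by rintro rfl; simp [hs] at hq0
      have hpd : 2 ≤ p.natDegree := by
        have : 0 < p.natDegree := hirr.natDegree_pos
        by_contra hlt
        have : p.natDegree = 1 := by omega
        exact hr (exists_root_of_degree_eq_one ((degree_eq_iff_natDegree_eq_of_pos one_pos).2 this))
      have hsd : s.natDegree = 0 := by
        have := natDegree_mul hp.ne_zero hs0
        rw [← hs, hqd] at this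
        omega
      obtain ⟨c, rfl⟩ := natDegree_eq_zero.1 hsd
      have e1 : SignType.sign (aeval m q) = 1 := by
        apply sign_pos
        simp only [hq, map_add, map_sub, map_pow, aeval_X, aeval_C]
        have : algebraMap R M z.im ≠ 0 := by simpa using hb
        positivity
      have e2 : SignType.sign (aeval y q) = 1 := by
        apply sign_pos
        simp only [hq, map_add, map_sub, map_pow, aeval_X, aeval_C]
        have : algebraMap R E z.im ≠ 0 := by simpa using hb
        positivity
      rw [hs, map_mul (aeval _), sign_mul] at e1 e2
      rw [← hC] at e2
      revert e1 e2
      generalize SignType.sign (aeval m (C c)) = t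
      generalize SignType.sign (aeval m p) = t1
      generalize SignType.sign (aeval y p) = t2
      decide +revert

open IntermediateField in
theorem exists_cut_embedding [IsRealClosed M] [IsRealClosed E] {m : M} {y : E}
    [Algebra.IsAlgebraic R⟮m⟯ M]
    (hm : m ∉ Set.range (algebraMap R M))
    (h1 : ∀ a : R, algebraMap R M a < m ↔ algebraMap R E a < y)
    (h2 : ∀ a : R, m < algebraMap R M a ↔ y < algebraMap R E a) :
    ∃ φ : M →ₐ[R] E, φ m = y := by
  have hsign := sign_aeval_eq h1 h2
  have hmt : Transcendental R m := fun h => hm (mem_range_of_isAlgebraic h)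
  have hyt : Transcendental R y := by
    intro ⟨p, hp0, hp⟩
    refine hmt ⟨p, hp0, ?_⟩
    rw [← sign_eq_zero_iff, hsign, hp, sign_zero]
  let e := (RatFunc.algEquivOfTranscendental m hmt).symm.trans
    (RatFunc.algEquivOfTranscendental y hyt)
  let g : R⟮m⟯ →ₐ[R] E := (R⟮y⟯).val.comp e.toAlgHom
  have hg : ∀ p : R[X], g (aeval (AdjoinSimple.gen R m) p) = aeval y p := by
    intro p
    simp only [g, e, AlgHom.comp_apply]
    change (R⟮y⟯).val ((RatFunc.algEquivOfTranscendental y hyt)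
      ((RatFunc.algEquivOfTranscendental m hmt).symm _)) = _
    rw [RatFunc.algEquivOfTranscendental_symm_aeval, RatFunc.algEquivOfTranscendental_algebraMap,
      ← aeval_algHom_apply]
    rfl
  let _ : Algebra R⟮m⟯ E := g.toRingHom.toAlgebra
  have hgm : ∀ x : R⟮m⟯, 0 < x → 0 < g x := by
    intro x hx
    obtain ⟨r, s, hrs⟩ := (mem_adjoin_simple_iff R (x : M)).1 x.2
    have hx' : (0 : M) < (x : M) := hx
    have hs : aeval m s ≠ 0 := by
      intro h
      rw [hrs, h, div_zero] at hx'
      exact lt_irrefl _ hx'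
    have hval : ∀ p : R[X], ((aeval (AdjoinSimple.gen R m) p : R⟮m⟯) : M) = aeval m p := by
      intro p
      change (R⟮m⟯).val _ = _
      rw [← aeval_algHom_apply]
      rfl
    have hxe : x * aeval (AdjoinSimple.gen R m) s = aeval (AdjoinSimple.gen R m) r := by
      apply Subtype.ext
      simp only [MulMemClass.coe_mul, hval]
      rw [hrs, div_mul_cancel₀ _ hs]
    have hgx := congrArg g hxe
    rw [map_mul, hg, hg] at hgx
    have hxs : (x : M) * aeval m s = aeval m r := by rw [hrs, div_mul_cancel₀ _ hs]
    have e1 := congrArg SignType.sign hgx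
    have e2 := congrArg SignType.sign hxs
    rw [sign_mul, ← hsign, ← hsign] at e1
    rw [sign_mul, sign_pos hx', one_mul] at e2
    rw [← e2] at e1
    have e3 : SignType.sign (aeval m s) ≠ 0 := by rwa [ne_eq, sign_eq_zero_iff]
    rw [← sign_eq_one_iff]
    revert e1 e3
    generalize SignType.sign (aeval m s) = t
    generalize SignType.sign (g x) = t1
    decide +revert
  have hM : StrictMono (algebraMap R⟮m⟯ M) := fun a b h => h
  have hE : StrictMono (algebraMap R⟮m⟯ E) := by
    intro a b h
    have := hgm (b - a) (sub_pos.2 h)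
    rw [map_sub] at this
    exact sub_pos.1 this
  obtain ⟨f⟩ := exists_embedding hM hE
  have hf : ∀ x : R⟮m⟯, f x = g x := fun x => f.commutes x
  refine ⟨{ f with commutes' := fun r => ?_ }, ?_⟩
  · have := hf (algebraMap R _ r)
    rw [g.commutes] at this
    exact this
  · have := hf (AdjoinSimple.gen R m)
    have h3 := hg X
    rw [aeval_X, aeval_X] at h3
    rw [h3] at this
    exact this

open IntermediateField in
theorem algHom_ext_cut [IsRealClosed M] {m : M} [Algebra.IsAlgebraic R⟮m⟯ M]
    {φ ψ : M →ₐ[R] E} (h : φ m = ψ m) : φ = ψ := by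
  let _ : Algebra R⟮m⟯ E := (φ.comp (R⟮m⟯).val).toRingHom.toAlgebra
  have hψ : ∀ x : R⟮m⟯, ψ x = φ x := by
    have : (ψ.comp (R⟮m⟯).val) = (φ.comp (R⟮m⟯).val) := by
      apply IntermediateField.algHom_ext_of_eq_adjoin _ rfl
      rintro x hx
      obtain rfl := Set.mem_singleton_iff.1 hx
      exact h.symm
    exact fun x => DFunLike.congr_fun this x
  let φ' : M →ₐ[R⟮m⟯] E := { φ with commutes' := fun r => rfl }
  let ψ' : M →ₐ[R⟮m⟯] E := { ψ with commutes' := fun r => hψ r }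
  have := algHom_unique φ' ψ'
  ext x
  exact DFunLike.congr_fun this x

end Cut

section Star
open Filter

/-- An ultrafilter on the finite subsets of `E` containing all the cones `{S | a ∈ S}`. -/
noncomputable def starFilter (E : Type) : Ultrafilter (Finset E) :=
  Ultrafilter.of (atTop : Filter (Finset E))

theorem eventually_mem_starFilter {E : Type} (a : E) : ∀ᶠ S in (starFilter E : Filter (Finset E)),
    a ∈ S := by
  have h : ∀ᶠ S in (atTop : Filter (Finset E)), a ∈ S := by
    filter_upwards [eventually_ge_atTop {a}] with S hS
    exact hS (Finset.mem_singleton_self a)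
  exact (Ultrafilter.of_le (atTop : Filter (Finset E))) h

/-- The ultrapower of `E` along `starFilter I`. -/
def Star (I E : Type) : Type := (starFilter I : Filter (Finset I)).Germ E

variable {I E : Type} [Field E]

noncomputable instance : Field (Star I E) :=
  inferInstanceAs (Field ((starFilter I : Filter (Finset I)).Germ E))

noncomputable instance [LinearOrder E] : LinearOrder (Star I E) :=
  inferInstanceAs (LinearOrder ((starFilter I : Filter (Finset I)).Germ E))

instance [LinearOrder E] [IsStrictOrderedRing E] : IsStrictOrderedRing (Star I E) :=
  inferInstanceAs (IsStrictOrderedRing ((starFilter I : Filter (Finset I)).Germ E))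

/-- The class of a family in the ultrapower. -/
noncomputable def Star.mkHom : (Finset I → E) →+* Star I E :=
  Filter.Germ.coeRingHom (R := E) (starFilter I : Filter (Finset I))

noncomputable instance {k : Type} [CommSemiring k] [Algebra k E] : Algebra k (Star I E) :=
  (Star.mkHom.comp (algebraMap k (Finset I → E))).toAlgebra

/-- The class of a family in the ultrapower, as an algebra map. -/
noncomputable def Star.mk (k : Type) [CommSemiring k] [Algebra k E] : (Finset I →
    E) →ₐ[k] Star I E :=
  { Star.mkHom with commutes' := fun _ => rfl }

instance {k l : Type} [CommSemiring k] [CommSemiring l] [Algebra k l] [Algebra l E] [Algebra k E]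
    [IsScalarTower k l E] : IsScalarTower k l (Star I E) :=
  IsScalarTower.of_algebraMap_eq fun x => by
    change Star.mkHom _ = Star.mkHom _
    congr 1
    ext i
    exact IsScalarTower.algebraMap_apply k l E x

theorem Star.mkHom_surjective : Function.Surjective (Star.mkHom (I := I) (E := E)) :=
  fun x => Filter.Germ.inductionOn x fun f => ⟨f, rfl⟩

theorem Star.mkHom_eq_iff {f g : Finset I → E} :
    Star.mkHom f = Star.mkHom g ↔ ∀ᶠ S in (starFilter I : Filter (Finset I)), f S = g S :=
  Filter.Germ.coe_eq

theorem Star.mkHom_lt_iff [LinearOrder E] {f g : Finset I → E} :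
    Star.mkHom f < Star.mkHom g ↔ ∀ᶠ S in (starFilter I : Filter (Finset I)), f S < g S :=
  Filter.Germ.coe_lt

theorem Star.algebraMap_eq {k : Type} [CommSemiring k] [Algebra k E] (a : k) :
    algebraMap k (Star I E) a = Star.mkHom fun _ => algebraMap k E a := rfl

theorem Star.aeval_mk {k σ : Type} [CommSemiring k] [Algebra k E] (x : σ → Finset I → E)
    (p : MvPolynomial σ k) :
    MvPolynomial.aeval (fun s => (Star.mkHom (x s) : Star I E)) p =
      Star.mkHom fun S => MvPolynomial.aeval (fun s => x s S) p := by
  have h1 : MvPolynomial.aeval (fun s => (Star.mkHom (x s) : Star I E)) p =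
      Star.mk k (MvPolynomial.aeval x p) :=
    (MvPolynomial.comp_aeval_apply x (Star.mk k) p).symm
  have h2 : (MvPolynomial.aeval x p : Finset I → E) =
      fun S => MvPolynomial.aeval (fun s => x s S) p := by
    ext S
    exact MvPolynomial.comp_aeval_apply x (Pi.evalAlgHom k (fun _ : Finset I => E) S) p
  rw [h1, h2]
  rfl

theorem Star.aeval_mk_eq_zero_iff {k σ : Type} [CommSemiring k] [Algebra k E]
    (x : σ → Finset I → E) (p : MvPolynomial σ k) :
    MvPolynomial.aeval (fun s => (Star.mkHom (x s) : Star I E)) p = 0 ↔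
      ∀ᶠ S in (starFilter I : Filter (Finset I)), MvPolynomial.aeval (fun s => x s S) p = 0 := by
  rw [Star.aeval_mk, ← map_zero (Star.mkHom (I := I) (E := E)), Star.mkHom_eq_iff]
  rfl

instance [LinearOrder E] [IsStrictOrderedRing E] [IsRealClosed E] : IsRealClosed (Star I E) := by
  refine IsRealClosed.of_linearOrderedField ?_ ?_
  · intro x hx
    obtain ⟨f, rfl⟩ := Star.mkHom_surjective x
    have h : ∀ᶠ S in (starFilter I : Filter (Finset I)), 0 ≤ f S := Filter.Germ.coe_nonneg.1 hx
    have h2 : ∀ S, ∃ r, 0 ≤ f S → f S = r * r := by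
      intro S
      by_cases h : 0 ≤ f S
      · obtain ⟨r, hr⟩ := IsRealClosed.nonneg_iff_isSquare.1 h
        exact ⟨r, fun _ => hr⟩
      · exact ⟨0, fun h' => absurd h' h⟩
    choose r hr using h2
    refine ⟨Star.mkHom r, ?_⟩
    rw [← map_mul, Star.mkHom_eq_iff]
    exact h.mono fun S hS => hr S hS
  · intro p hp
    let n := p.natDegree
    choose c hc using fun i => Star.mkHom_surjective (I := I) (E := E) (p.coeff i)
    let q : Finset I → E[X] := fun S => ∑ i ∈ Finset.range (n + 1), C (c i S) * X ^ i
    have hcoeff : ∀ S, (q S).coeff n = c n S := by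
      intro S
      simp [q, coeff_C_mul, coeff_X_pow]
    have hdeg : ∀ S, (q S).natDegree ≤ n := by
      intro S
      refine natDegree_sum_le_of_forall_le _ _ fun i hi => ?_
      exact (natDegree_C_mul_X_pow_le _ _).trans (Nat.lt_succ_iff.1 (Finset.mem_range.1 hi))
    have hlead : ∀ᶠ S in (starFilter I : Filter (Finset I)), c n S ≠ 0 := by
      have h0 : ¬ ∀ᶠ S in (starFilter I : Filter (Finset I)), c n S = 0 := by
        intro h
        have h1 : Star.mkHom (c n) = (0 : Star I E) := by
          rw [← map_zero Star.mkHom, Star.mkHom_eq_iff]; exact h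
        rw [hc] at h1
        have : p ≠ 0 := by rintro rfl; simp at hp
        exact leadingCoeff_ne_zero.2 this h1
      exact Ultrafilter.eventually_not.2 h0
    have hroot : ∀ S, ∃ r, c n S ≠ 0 → (q S).eval r = 0 := by
      intro S
      by_cases h : c n S = 0
      · exact ⟨0, fun h' => absurd h h'⟩
      · have hd : (q S).natDegree = n := natDegree_eq_of_le_of_coeff_ne_zero (hdeg S)
          (by rwa [hcoeff])
        obtain ⟨r, hr⟩ := IsRealClosed.exists_isRoot_of_odd_natDegree (f := q S) (by rwa [hd])
        exact ⟨r, fun _ => hr⟩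
    choose r hr using hroot
    refine ⟨Star.mkHom r, ?_⟩
    rw [IsRoot, eval_eq_sum_range]
    simp_rw [← hc, ← map_pow, ← map_mul]
    rw [← map_sum, ← map_zero Star.mkHom, Star.mkHom_eq_iff]
    filter_upwards [hlead] with S hS
    have := hr S hS
    simpa [q, eval_finsetSum, n] using this
end Star

section AL
variable {R M : Type} [Field R] [LinearOrder R] [IsStrictOrderedRing R] [IsRealClosed R]
  [Field M] [LinearOrder M] [IsStrictOrderedRing M] [IsRealClosed M] [Algebra R M]

open IntermediateField in
theorem exists_star_embedding (m : M) [Algebra.IsAlgebraic R⟮m⟯ M] :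
    Nonempty (M →ₐ[R] Star R R) := by
  have hmono := strictMono_of_realClosed (algebraMap R M)
  by_cases hm : m ∈ Set.range (algebraMap R M)
  · have : Algebra.IsAlgebraic R R⟮m⟯ := by
      obtain ⟨a, rfl⟩ := hm
      exact isAlgebraic_adjoin_simple isIntegral_algebraMap
    have halg : ∀ x : M, x ∈ Set.range (algebraMap R M) := by
      intro x
      have hx : IsAlgebraic R⟮m⟯ x := Algebra.IsAlgebraic.isAlgebraic x
      exact mem_range_of_isAlgebraic (hx.restrictScalars R)
    let e : R ≃ₐ[R] M := AlgEquiv.ofBijective (Algebra.ofId R M) ⟨(algebraMap R M).injective, halg⟩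
    exact ⟨(Algebra.ofId R (Star R R)).comp e.symm.toAlgHom⟩
  · have hz : ∀ S : Finset R, ∃ z : R, ∀ a ∈ S, (algebraMap R M a < m → a < z) ∧
        (m < algebraMap R M a → z < a) := by
      intro S
      classical
      have key : ∃ z : R, (∀ a ∈ S.filter (fun a => algebraMap R M a < m), a < z) ∧
          ∀ a ∈ S.filter (fun a => m < algebraMap R M a), z < a := by
        obtain ⟨z, h1, h2⟩ := Order.exists_between_finsets
          (lo := S.filter (fun a => algebraMap R M a < m))
          (hi := S.filter (fun a => m < algebraMap R M a)) (by
          intro x hx y hy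
          exact hmono.lt_iff_lt.1 ((Finset.mem_filter.1 hx).2.trans (Finset.mem_filter.1 hy).2))
        exact ⟨z, h1, h2⟩
      obtain ⟨z, h1, h2⟩ := key
      exact ⟨z, fun a ha => ⟨fun h => h1 a (Finset.mem_filter.2 ⟨ha, h⟩),
        fun h => h2 a (Finset.mem_filter.2 ⟨ha, h⟩)⟩⟩
    choose z hz using hz
    have hl : ∀ a : R, algebraMap R M a < m → algebraMap R (Star R R) a < Star.mkHom z := by
      intro a ha
      rw [Star.algebraMap_eq, Star.mkHom_lt_iff]
      filter_upwards [eventually_mem_starFilter a] with S hS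
      exact (hz S a hS).1 ha
    have hr : ∀ a : R, m < algebraMap R M a → Star.mkHom z < algebraMap R (Star R R) a := by
      intro a ha
      rw [Star.algebraMap_eq, Star.mkHom_lt_iff]
      filter_upwards [eventually_mem_starFilter a] with S hS
      exact (hz S a hS).2 ha
    have hne : ∀ a : R, algebraMap R M a ≠ m := fun a h => hm ⟨a, h⟩
    obtain ⟨φ, -⟩ := exists_cut_embedding (E := Star R R) (y := Star.mkHom z) hm
      (fun a => ⟨hl a, fun h => by
        rcases lt_or_gt_of_ne (hne a) with h' | h'
        · exact h'
        · exact absurd (hr a h') h.not_gt⟩)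
      (fun a => ⟨hr a, fun h => by
        rcases lt_or_gt_of_ne (hne a) with h' | h'
        · exact absurd (hl a h') h.not_gt
        · exact h'⟩)
    exact ⟨φ⟩
end AL

section Chain
variable {k E : Type} [Field k] [Field E] [Algebra k E]

open IntermediateField

/-- The relative algebraic closure in `E` of the subfield generated by `s` over `k`. -/
noncomputable def rcl (k : Type) {E : Type} [Field k] [Field E] [Algebra k E] (s : Set E) :
    IntermediateField k E :=
  (algebraicClosure (adjoin k s) E).restrictScalars k

theorem mem_rcl {s : Set E} {x : E} : x ∈ rcl k s ↔ IsAlgebraic (adjoin k s) x :=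
  mem_algebraicClosure_iff

theorem adjoin_le_rcl (s : Set E) : adjoin k s ≤ rcl k s := fun x hx =>
  mem_rcl.2 (isAlgebraic_algebraMap (⟨x, hx⟩ : adjoin k s))

theorem rcl_mono {s t : Set E} (h : s ⊆ t) : rcl k s ≤ rcl k t := by
  intro x hx
  rw [mem_rcl] at hx ⊢
  exact hx.ringHom_of_comp_eq (inclusion (adjoin.mono k s t h)).toRingHom (RingHom.id E)
    (inclusion (adjoin.mono k s t h)).toRingHom.injective rfl

instance [IsRealClosed E] (s : Set E) : IsRealClosed (rcl k s) :=
  isRealClosed_algebraicClosure (F := adjoin k s) (R := E)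

theorem rcl_empty [IsRealClosed k] [IsRealClosed E] : rcl k (∅ : Set E) = ⊥ := by
  rw [eq_bot_iff]
  intro x hx
  rw [mem_rcl] at hx
  have : Algebra.IsAlgebraic k (adjoin k (∅ : Set E)) := by
    rw [adjoin_empty]
    exact Algebra.IsAlgebraic.of_finite k _
  exact mem_bot.2 (mem_range_of_isAlgebraic (hx.restrictScalars k))

theorem isAlgebraic_adjoin_insert {N N' : IntermediateField k E} (h : N ≤ N') {s : Set E}
    (hs : s ⊆ N) (x : N') (hle : adjoin k (insert (x : E) s) ≤ N')
    (halg : ∀ b ∈ N', IsAlgebraic (adjoin k (insert (x : E) s)) b) :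
    let _ : Algebra N N' := (inclusion h).toRingHom.toAlgebra
    Algebra.IsAlgebraic N⟮x⟯ N' := by
  intro _
  let F0 := adjoin k (insert (x : E) s)
  have hmem : ∀ z : F0, inclusion hle z ∈ N⟮x⟯ := by
    let T : IntermediateField k E :=
      { (N⟮x⟯.toSubfield.map N'.val.toRingHom) with
        algebraMap_mem' := by
          intro r
          exact ⟨algebraMap N N' (algebraMap k N r), N⟮x⟯.algebraMap_mem _, rfl⟩ }
    have hT : F0 ≤ T := by
      rw [adjoin_le_iff]
      rintro y (rfl | hy)
      · exact ⟨x, mem_adjoin_simple_self _ _, rfl⟩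
      · exact ⟨algebraMap N N' ⟨y, hs hy⟩,
          N⟮x⟯.algebraMap_mem _, rfl⟩
    rintro ⟨z, hz⟩
    obtain ⟨y, hy, rfl⟩ := hT hz
    exact hy
  let f : F0 →+* N⟮x⟯ := (inclusion hle).toRingHom.codRestrict N⟮x⟯.toSubfield hmem
  refine ⟨fun b => ?_⟩
  have hb : IsAlgebraic F0 (b : E) := halg b b.2
  let _ : Algebra F0 N' := (inclusion hle).toRingHom.toAlgebra
  have hb' : IsAlgebraic F0 b :=
    IsAlgebraic.of_ringHom_of_comp_eq (RingHom.id F0) N'.val.toRingHom hb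
      (fun z => ⟨z, rfl⟩) N'.val.toRingHom.injective rfl
  exact hb'.ringHom_of_comp_eq f (RingHom.id N') f.injective rfl

theorem rcl_induction [IsRealClosed k] [IsRealClosed E] {P : IntermediateField k E → Prop}
    (step : ∀ (N N' : IntermediateField k E) (h : N ≤ N') (x : N'), IsRealClosed N →
      IsRealClosed N' →
      (let _ : Algebra N N' := (inclusion h).toRingHom.toAlgebra
       Algebra.IsAlgebraic N⟮x⟯ N') → P N' → P N)
    (s : Set E) (hs : s.Finite) (hP : P (rcl k s)) : P ⊥ := by
  induction s, hs using Set.Finite.induction_on with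
  | empty => rwa [rcl_empty] at hP
  | @insert a s ha hs ih =>
    exact ih (step _ _ (rcl_mono (Set.subset_insert a s)) _ inferInstance inferInstance
      (isAlgebraic_adjoin_insert _ ((subset_adjoin _ _).trans (adjoin_le_rcl s))
        ⟨a, adjoin_le_rcl _ (subset_adjoin _ _ (Set.mem_insert a s))⟩ (adjoin_le_rcl _)
        fun _ hb => mem_rcl.1 hb) hP)

/-- Real closed fields are existentially closed in their real closed extensions. -/
theorem exists_zero_of_exists_zero [IsRealClosed k] [IsRealClosed E] {σ : Type} [Finite σ]
    (f : MvPolynomial σ k) (h : ∃ y : σ → E, MvPolynomial.aeval y f = 0) :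
    ∃ y : σ → k, MvPolynomial.aeval y f = 0 := by
  have hbot : ∃ y : σ → (⊥ : IntermediateField k E), MvPolynomial.aeval y f = 0 := by
    obtain ⟨y, hy⟩ := h
    refine rcl_induction (P := fun N => ∃ y : σ → N, MvPolynomial.aeval y f = 0) ?_ (Set.range y)
      (Set.finite_range y) ?_
    · rintro N N' h x hN hN' halg ⟨y, hy⟩
      let _ : Algebra N N' := (inclusion h).toRingHom.toAlgebra
      have : IsScalarTower k N N' := IsScalarTower.of_algebraMap_eq fun _ => rfl
      let _ := linearOrderOfRealClosed N
      have := isStrictOrderedRing_of_realClosed N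
      let _ := linearOrderOfRealClosed N'
      have := isStrictOrderedRing_of_realClosed N'
      have : Algebra.IsAlgebraic N⟮x⟯ N' := halg
      obtain ⟨φ⟩ := exists_star_embedding (R := N) x
      choose z hz using fun s => Star.mkHom_surjective (φ (y s))
      have h0 : MvPolynomial.aeval (fun s => (Star.mkHom (z s) : Star N N)) f = 0 := by
        simp_rw [hz]
        have := MvPolynomial.comp_aeval_apply y (φ.restrictScalars k) f
        rw [hy, map_zero] at this
        exact this.symm
      rw [Star.aeval_mk_eq_zero_iff] at h0
      obtain ⟨S, hS⟩ := h0.exists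
      exact ⟨_, hS⟩
    · refine ⟨fun s => ⟨y s, adjoin_le_rcl _ (subset_adjoin _ _ ⟨s, rfl⟩)⟩, ?_⟩
      apply (rcl k (Set.range y)).val.toRingHom.injective
      rw [map_zero, ← hy]
      exact MvPolynomial.comp_aeval_apply _ (rcl k (Set.range y)).val f
  obtain ⟨y, hy⟩ := hbot
  let e := botEquiv k E
  refine ⟨fun s => e (y s), ?_⟩
  have := MvPolynomial.comp_aeval_apply y e.toAlgHom f
  rw [hy, map_zero] at this
  exact this.symm

end Chain

section HalfPower
variable {R : Type} [Field R] [CharZero R] {n : Type} [Fintype n] [DecidableEq n]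

open PowerSeries in
theorem X_pow_dvd_matrix_pow {M : Matrix n n R⟦X⟧} (hM : ∀ a b, (PowerSeries.X : R⟦X⟧) ∣ M a b)
    (j : ℕ) (a b : n) : (PowerSeries.X : R⟦X⟧) ^ j ∣ (M ^ j) a b := by
  induction j generalizing a b with
  | zero => simp
  | succ j ih =>
    rw [pow_succ, pow_succ, Matrix.mul_apply]
    exact Finset.dvd_sum fun c _ => mul_dvd_mul (ih a c) (hM c b)

/-- The binomial coefficient polynomial `X (X - 1) ⋯ (X - j + 1) / j!`. -/
noncomputable def binomPoly (R : Type) [Field R] (j : ℕ) : R[X] :=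
  C ((j.factorial : R)⁻¹) * descPochhammer R j

theorem eval_binomPoly (j N : ℕ) : (binomPoly R j).eval (N : R) = N.choose j := by
  rw [binomPoly, eval_mul, eval_C, descPochhammer_eval_eq_descFactorial,
    Nat.descFactorial_eq_factorial_mul_choose, Nat.cast_mul, inv_mul_cancel_left₀]
  exact_mod_cast j.factorial_ne_zero

/-- The interpolation `λ ↦ (1 + M) ^ λ` of the powers of `1 + M`, as a power series whose
coefficients are polynomials in `λ`. -/
noncomputable def powInterp (M : Matrix n n (PowerSeries R)) : Matrix n n (PowerSeries R[X]) :=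
  Matrix.of fun a b => PowerSeries.mk fun m => ∑ j ∈ Finset.range (m + 1),
    binomPoly R j * C (PowerSeries.coeff m ((M ^ j) a b))

theorem map_eval_powInterp {M : Matrix n n (PowerSeries R)}
    (hM : ∀ a b, (PowerSeries.X : PowerSeries R) ∣ M a b) (N : ℕ) :
    (powInterp M).map (PowerSeries.map (evalRingHom (N : R))) = (1 + M) ^ N := by
  ext a b m
  have h1 : (1 + M) ^ N = ∑ j ∈ Finset.range (N + 1), (N.choose j : R) • M ^ j := by
    rw [add_comm, (Commute.one_right M).add_pow]
    refine Finset.sum_congr rfl fun j _ => ?_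
    rw [one_pow, mul_one, ← Nat.cast_comm, ← nsmul_eq_mul, Nat.cast_smul_eq_nsmul]
  have h2 : ∀ j, m < j → PowerSeries.coeff m ((M ^ j) a b) = 0 := fun j hj =>
    PowerSeries.X_pow_dvd_iff.1 (X_pow_dvd_matrix_pow hM j a b) m hj
  have hl : PowerSeries.coeff m (((powInterp M).map
      (PowerSeries.map (evalRingHom (N : R)))) a b) =
      ∑ j ∈ Finset.range (m + 1), (N.choose j : R) * PowerSeries.coeff m ((M ^ j) a b) := by
    simp [powInterp, eval_finsetSum, eval_binomPoly]
  have hr : PowerSeries.coeff m (((1 + M) ^ N) a b) =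
      ∑ j ∈ Finset.range (N + 1), (N.choose j : R) * PowerSeries.coeff m ((M ^ j) a b) := by
    rw [h1, Matrix.sum_apply, map_sum]
    refine Finset.sum_congr rfl fun j _ => ?_
    rw [Matrix.smul_apply, map_smul, smul_eq_mul]
  rw [hl, hr]
  rcases le_total m N with h | h
  · refine Finset.sum_subset (Finset.range_mono (by omega)) fun j _ hj => ?_
    rw [h2 j (by simpa [Nat.lt_succ_iff] using hj), mul_zero]
  · refine (Finset.sum_subset (Finset.range_mono (by omega)) fun j _ hj => ?_).symm
    rw [Nat.choose_eq_zero_of_lt (by simpa [Nat.lt_succ_iff] using hj), Nat.cast_zero, zero_mul]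

theorem eq_zero_of_map_eval_eq_zero {f : PowerSeries R[X]}
    (h : ∀ N : ℕ, PowerSeries.map (evalRingHom (N : R)) f = 0) : f = 0 := by
  ext1 m
  rw [map_zero]
  refine Polynomial.eq_zero_of_infinite_isRoot _
    (Set.infinite_of_injective_forall_mem (f := fun N : ℕ => (N : R)) Nat.cast_injective fun N =>
        ?_)
  have := congrArg (PowerSeries.coeff m) (h N)
  simpa using this

theorem exists_half_power {r : Matrix n n (PowerSeries R)}
    (hr : ∀ a b, PowerSeries.constantCoeff (r a b) = (1 : Matrix n n R) a b) :
    ∃ u : Matrix n n (PowerSeries R), u * u = r ∧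
      (∀ a b, PowerSeries.constantCoeff (u a b) = (1 : Matrix n n R) a b) ∧
      ∀ f : MvPolynomial (n × n) (PowerSeries R),
        (∀ N : ℕ, MvPolynomial.eval (fun p => (r ^ N) p.1 p.2) f = 0) →
        MvPolynomial.eval (fun p => u p.1 p.2) f = 0 := by
  let M := r - 1
  have hM : ∀ a b, (PowerSeries.X : PowerSeries R) ∣ M a b := by
    intro a b
    rw [PowerSeries.X_dvd_iff]
    simp only [M, Matrix.sub_apply, map_sub, hr]
    by_cases h : a = b <;> simp [h, Matrix.one_apply]
  have hMr : 1 + M = r := by simp [M]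
  have hN := map_eval_powInterp hM
  rw [hMr] at hN
  let ev : R → (PowerSeries R[X] →+* PowerSeries R) := fun c => PowerSeries.map (evalRingHom c)
  refine ⟨(powInterp M).map (ev 2⁻¹), ?_, ?_, ?_⟩
  · let dbl : PowerSeries R[X] →+* PowerSeries R[X] :=
      PowerSeries.map (compRingHom (2 * Polynomial.X))
    have key : powInterp M * powInterp M = (powInterp M).map dbl := by
      ext1 a b
      rw [← sub_eq_zero]
      refine eq_zero_of_map_eval_eq_zero fun N => ?_
      rw [map_sub, sub_eq_zero]
      have h1 : (powInterp M * powInterp M).map (ev N) = r ^ (2 * N) := by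
        rw [Matrix.map_mul, hN, two_mul, pow_add]
      have h2 : ((powInterp M).map dbl).map (ev N) = r ^ (2 * N) := by
        rw [← hN (2 * N), Matrix.map_map]
        congr 1
        ext f m
        simp [dbl, ev]
      have h3 := h1.trans h2.symm
      exact congrFun (congrFun h3 a) b
    rw [← Matrix.map_mul, key, Matrix.map_map]
    have h1 := hN 1
    rw [pow_one] at h1
    rw [← h1]
    congr 1
    ext f m
    simp [dbl, ev]
  · intro a b
    rw [← PowerSeries.coeff_zero_eq_constantCoeff_apply]
    simp [powInterp, ev, binomPoly]
    by_cases h : a = b <;> simp [h, Matrix.one_apply]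
  · intro f hf
    let F : PowerSeries R[X] := MvPolynomial.eval₂ (PowerSeries.map C)
      (fun p => powInterp M p.1 p.2) f
    have hF : ∀ c, ev c F = MvPolynomial.eval (fun p => ((powInterp M).map (ev c)) p.1 p.2) f := by
      intro c
      simp only [F]
      rw [MvPolynomial.hom_eval₂, MvPolynomial.eval, MvPolynomial.coe_eval₂Hom]
      congr 1
      ext g m
      simp [ev]
    have h0 : F = 0 := eq_zero_of_map_eval_eq_zero fun N => by
      change ev N F = 0
      rw [hF, hN]
      exact hf N
    rw [← hF, h0, map_zero]

theorem isSquare_of_constantCoeff_one {f : PowerSeries R}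
    (hf : PowerSeries.constantCoeff f = 1) : IsSquare f := by
  obtain ⟨u, hu, -, -⟩ := exists_half_power (n := Unit) (r := Matrix.of fun _ _ => f)
    (by intro a b; simp [hf])
  refine ⟨u () (), ?_⟩
  have := congrFun (congrFun hu ()) ()
  simpa [Matrix.mul_apply] using this.symm

end HalfPower

section ExtendDerivation
open TensorProduct

theorem exists_derivation_extension {k A B : Type} [CommRing k] [CommRing A] [CommRing B]
    [Algebra k A] [Algebra A B] [Algebra k B] [IsScalarTower k A B] [Algebra.FormallyEtale A B]
    (D : Derivation k A B) : ∃ D' : Derivation k B B, ∀ a, D' (algebraMap A B a) = D a := by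
  let l : B ⊗[A] Ω[A⁄k] →ₗ[B] B := D.liftKaehlerDifferential.liftBaseChange B
  let e := KaehlerDifferential.tensorKaehlerEquivOfFormallyEtale k A B
  refine ⟨(l.comp e.symm.toLinearMap).compDer (KaehlerDifferential.D k B), fun a => ?_⟩
  change l (e.symm (KaehlerDifferential.D k B (algebraMap A B a))) = _
  rw [KaehlerDifferential.tensorKaehlerEquivOfFormallyEtale_symm_D_algebraMap]
  simp [l]

end ExtendDerivation

section Taylor
variable {R : Type} [CommRing R] [Algebra ℚ R]

/-- The coefficients `D^n r / n!` of the Taylor expansion. -/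
noncomputable def taylorFun (D : Derivation ℤ R R) (r : R) : PowerSeries R :=
  PowerSeries.mk fun n => ((n.factorial : ℚ)⁻¹) • (D^[n] r)

theorem constantCoeff_taylorFun (D : Derivation ℤ R R) (r : R) :
    PowerSeries.constantCoeff (taylorFun D r) = r := by
  rw [← PowerSeries.coeff_zero_eq_constantCoeff_apply]
  simp [taylorFun]

theorem derivative_taylorFun (D : Derivation ℤ R R) (r : R) :
    PowerSeries.derivative R (taylorFun D r) = taylorFun D (D r) := by
  ext n
  rw [PowerSeries.coeff_derivative, taylorFun, taylorFun, PowerSeries.coeff_mk,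
    PowerSeries.coeff_mk, Function.iterate_succ_apply]
  have : ((n : R) + 1) = algebraMap ℚ R ((n : ℚ) + 1) := by simp
  rw [this, mul_comm, ← Algebra.smul_def, smul_smul]
  congr 1
  rw [Nat.factorial_succ]
  push_cast
  field_simp

theorem powerSeries_ext_derivative {f g : ℕ → PowerSeries R}
    (hf : ∀ n, PowerSeries.derivative R (f n) = f (n + 1))
    (hg : ∀ n, PowerSeries.derivative R (g n) = g (n + 1))
    (h : ∀ n, PowerSeries.constantCoeff (f n) = PowerSeries.constantCoeff (g n)) (n : ℕ) :
    f n = g n := by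
  ext m
  induction m generalizing n with
  | zero => simpa using h n
  | succ m ih =>
    have h1 := ih (n + 1)
    rw [← hf, ← hg, PowerSeries.coeff_derivative, PowerSeries.coeff_derivative] at h1
    have : IsUnit ((m : R) + 1) := by
      have : ((m : R) + 1) = algebraMap ℚ R ((m : ℚ) + 1) := by simp
      rw [this]
      exact IsUnit.map _ (IsUnit.mk0 _ (by positivity))
    exact this.mul_left_injective h1

theorem powerSeries_hom_ext {S : Type} [AddCommGroup S] (D : S → S) {f g : S →+ PowerSeries R}
    (hf : ∀ s, PowerSeries.derivative R (f s) = f (D s))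
    (hg : ∀ s, PowerSeries.derivative R (g s) = g (D s))
    (h : ∀ s, PowerSeries.constantCoeff (f s) = PowerSeries.constantCoeff (g s)) : f = g := by
  ext1 s
  refine powerSeries_ext_derivative (f := fun n => f (D^[n] s)) (g := fun n => g (D^[n] s))
    (fun n => ?_) (fun n => ?_) (fun n => h _) 0
  · rw [hf, Function.iterate_succ_apply']
  · rw [hg, Function.iterate_succ_apply']

theorem taylorFun_add (D : Derivation ℤ R R) (a b : R) :
    taylorFun D (a + b) = taylorFun D a + taylorFun D b := by
  ext n
  simp only [taylorFun, PowerSeries.coeff_mk, map_add]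
  rw [iterate_map_add, smul_add]

theorem taylorFun_mul (D : Derivation ℤ R R) (a b : R) :
    taylorFun D (a * b) = taylorFun D a * taylorFun D b := by
  ext n
  induction n generalizing a b with
  | zero =>
    simp [constantCoeff_taylorFun]
  | succ n ih =>
    have h1 : PowerSeries.coeff n (PowerSeries.derivative R (taylorFun D (a * b))) =
        PowerSeries.coeff n (PowerSeries.derivative R (taylorFun D a * taylorFun D b)) := by
      rw [derivative_taylorFun, D.leibniz, Derivation.leibniz, derivative_taylorFun,
        derivative_taylorFun]
      simp only [smul_eq_mul, taylorFun_add, map_add, ih]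
    rw [PowerSeries.coeff_derivative, PowerSeries.coeff_derivative] at h1
    have : IsUnit ((n : R) + 1) := by
      have : ((n : R) + 1) = algebraMap ℚ R ((n : ℚ) + 1) := by simp
      rw [this]
      exact IsUnit.map _ (IsUnit.mk0 _ (by positivity))
    exact this.mul_left_injective h1

theorem taylorFun_of_eq_zero (D : Derivation ℤ R R) {r : R} (h : D r = 0) :
    taylorFun D r = PowerSeries.C r := by
  ext n
  rw [taylorFun, PowerSeries.coeff_mk, PowerSeries.coeff_C]
  rcases n with _ | n
  · simp
  · rw [Function.iterate_succ_apply, h]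
    simp [iterate_map_zero]

/-- The Taylor expansion `r ↦ ∑ (D^n r / n!) tⁿ` as a ring homomorphism. -/
noncomputable def taylorHom (D : Derivation ℤ R R) : R →+* PowerSeries R where
  toFun := taylorFun D
  map_add' := taylorFun_add D
  map_mul' := taylorFun_mul D
  map_zero' := by rw [taylorFun_of_eq_zero D (map_zero D), map_zero]
  map_one' := by rw [taylorFun_of_eq_zero D D.map_one_eq_zero, map_one]

theorem constantCoeff_taylorHom (D : Derivation ℤ R R) (r : R) :
    PowerSeries.constantCoeff (taylorHom D r) = r := constantCoeff_taylorFun D r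

theorem derivative_taylorHom (D : Derivation ℤ R R) (r : R) :
    PowerSeries.derivative R (taylorHom D r) = taylorHom D (D r) := derivative_taylorFun D r

theorem taylorHom_of_eq_zero (D : Derivation ℤ R R) {r : R} (h : D r = 0) :
    taylorHom D r = PowerSeries.C r := taylorFun_of_eq_zero D h

end Taylor

section TaylorField
open IntermediateField

theorem exists_derivation_of_transcendental {F R : Type} [Field F] [CharZero F] [Field R]
    [Algebra F R] {x : R} (hx : Transcendental F x) [Algebra.IsAlgebraic F⟮x⟯ R] :
    ∃ D : Derivation F R R, D x = 1 := by
  let e := RatFunc.algEquivOfTranscendental x hx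
  let _ : Algebra (RatFunc F) R := ((F⟮x⟯).val.comp e.toAlgHom).toRingHom.toAlgebra
  let _ : Algebra F[X] R := (aeval x).toRingHom.toAlgebra
  have : IsScalarTower F F[X] R := IsScalarTower.of_algebraMap_eq fun r => (aeval_C x r).symm
  have : IsScalarTower F[X] (RatFunc F) R := IsScalarTower.of_algebraMap_eq fun p => by
    change aeval x p = ((e (algebraMap _ _ p) : F⟮x⟯) : R)
    rw [RatFunc.algEquivOfTranscendental_algebraMap]
    change _ = (F⟮x⟯).val _
    rw [← aeval_algHom_apply]
    rfl
  have : Algebra.IsAlgebraic (RatFunc F) R :=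
    Algebra.IsAlgebraic.of_ringHom_of_comp_eq e.toAlgHom.toRingHom (RingHom.id R)
      e.surjective Function.injective_id rfl
  have : CharZero (RatFunc F) :=
      charZero_of_injective_algebraMap (algebraMap F (RatFunc F)).injective
  have : Algebra.FormallyEtale (RatFunc F) R := Algebra.FormallyEtale.of_isSeparable _ _
  have : Algebra.FormallyEtale F[X] (RatFunc F) :=
    Algebra.FormallyEtale.of_isLocalization (nonZeroDivisors F[X])
  have : Algebra.FormallyEtale F[X] R := Algebra.FormallyEtale.comp F[X] (RatFunc F) R
  obtain ⟨D, hD⟩ := exists_derivation_extension (k := F) (A := F[X]) (B := R)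
    (Polynomial.mkDerivation F (1 : R))
  refine ⟨D, ?_⟩
  have := hD X
  rw [Polynomial.mkDerivation_X] at this
  rw [← this]
  congr 1
  exact (aeval_X x).symm

theorem exists_taylor_of_transcendental {F R : Type} [Field F] [CharZero F] [Field R]
    [Algebra F R] {x : R} (hx : Transcendental F x) [Algebra.IsAlgebraic F⟮x⟯ R] :
    ∃ Θ : R →ₐ[F] PowerSeries R, Θ x = PowerSeries.C x + PowerSeries.X ∧
      ∀ r, PowerSeries.constantCoeff (Θ r) = r := by
  have : CharZero R := charZero_of_injective_algebraMap (algebraMap F R).injective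
  obtain ⟨D, hD⟩ := exists_derivation_of_transcendental hx
  let D' : Derivation ℤ R R := D.restrictScalars ℤ
  refine ⟨{ taylorHom D' with commutes' := fun r => ?_ }, ?_, constantCoeff_taylorHom D'⟩
  · exact (taylorHom_of_eq_zero D' (D.map_algebraMap r)).trans
      (PowerSeries.algebraMap_apply (R := F) (A := R)).symm
  · change taylorHom D' x = _
    refine PowerSeries.derivative.ext ?_ ?_
    · rw [derivative_taylorHom]
      change taylorHom D' (D x) = _
      rw [hD, map_one, map_add, PowerSeries.derivative_C, PowerSeries.derivative_X, zero_add]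
    · simp [constantCoeff_taylorHom]

end TaylorField

/-! ### Polynomial relations -/

section Rel
variable {k J W : Type} [Field k]

/-- The relation on `J`-tuples obtained by projecting the zero set of the polynomial `Q`. -/
def Rel (Q : MvPolynomial (J ⊕ (J ⊕ W)) k) {A : Type} [CommRing A] (f : k →+* A) (a b : J → A) :
    Prop :=
  ∃ w : W → A, Q.eval₂ f (Sum.elim a (Sum.elim b w)) = 0

theorem Rel.map {Q : MvPolynomial (J ⊕ (J ⊕ W)) k} {A B : Type} [CommRing A] [CommRing B]
    {f : k →+* A} {f' : k →+* B} {a b : J → A} (h : Rel Q f a b) (g : A →+* B)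
    (hg : g.comp f = f') : Rel Q f' (fun j => g (a j)) (fun j => g (b j)) := by
  obtain ⟨w, hw⟩ := h
  refine ⟨fun j => g (w j), ?_⟩
  have := congrArg g hw
  rw [map_zero, MvPolynomial.hom_eval₂, hg] at this
  rw [← this]
  congr 1
  ext (j | j | j) <;> rfl

theorem Rel.descend [Finite W] {Q : MvPolynomial (J ⊕ (J ⊕ W)) k} {A B : Type} [Field A] [Field B]
    [IsRealClosed A] [IsRealClosed B]
    {f : k →+* A} {a b : J → A} (g : A →+* B)
    (h : Rel Q (g.comp f) (fun j => g (a j)) (fun j => g (b j))) : Rel Q f a b := by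
  let _ : Algebra A B := g.toAlgebra
  let F : MvPolynomial W A := Q.eval₂ (MvPolynomial.C.comp f)
    (Sum.elim (fun j => MvPolynomial.C (a j))
      (Sum.elim (fun j => MvPolynomial.C (b j)) MvPolynomial.X))
  have key : ∀ w : W → A, MvPolynomial.aeval w F = Q.eval₂ f (Sum.elim a (Sum.elim b w)) := by
    intro w
    change (MvPolynomial.aeval w).toRingHom F = _
    simp only [F]
    rw [MvPolynomial.hom_eval₂]
    congr 1
    · ext r; simp
    · ext (j | j | j) <;> simp
  obtain ⟨w, hw⟩ := h
  obtain ⟨y, hy⟩ := exists_zero_of_exists_zero F (E := B) ⟨w, by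
    rw [← hw]
    change (MvPolynomial.aeval w).toRingHom F = _
    simp only [F]
    rw [MvPolynomial.hom_eval₂]
    congr 1
    · ext r; simp [RingHom.algebraMap_toAlgebra]
    · ext (j | j | j) <;> simp [RingHom.algebraMap_toAlgebra]⟩
  exact ⟨y, by rw [← key, hy]⟩

theorem Star.eval₂_mk_eq_zero_iff {I E k σ : Type} [CommRing k] [Field E] (f : k →+* E)
    (x : σ → Finset I → E) (p : MvPolynomial σ k) :
    MvPolynomial.eval₂ ((algebraMap E (Star I E)).comp f)
      (fun s => (Star.mkHom (x s) : Star I E)) p = 0 ↔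
      ∀ᶠ S in (starFilter I : Filter (Finset I)), MvPolynomial.eval₂ f (fun s => x s S) p = 0 := by
  have := Star.aeval_mk_eq_zero_iff (I := I) x (p.map f)
  rw [MvPolynomial.aeval_def, MvPolynomial.eval₂_map] at this
  rw [this]
  simp [MvPolynomial.aeval_def, MvPolynomial.eval₂_map]

theorem Rel.of_star {I E : Type} [Field E] {Q : MvPolynomial (J ⊕ (J ⊕ W)) k} {f : k →+* E}
    {a b : J → Finset I → E}
    (h : Rel Q ((algebraMap E (Star I E)).comp f) (fun j => Star.mkHom (a j))
      (fun j => Star.mkHom (b j))) :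
    ∀ᶠ S in (starFilter I : Filter (Finset I)), Rel Q f (fun j => a j S) (fun j => b j S) := by
  obtain ⟨w, hw⟩ := h
  choose v hv using fun s => Star.mkHom_surjective (w s)
  have := (Star.eval₂_mk_eq_zero_iff f (Sum.elim a (Sum.elim b v)) Q).1 (by
    rw [← hw]
    congr 1
    ext (j | j | j) <;> simp [hv])
  filter_upwards [this] with S hS
  refine ⟨fun j => v j S, ?_⟩
  rw [← hS]
  congr 1
  ext (j | j | j) <;> rfl

theorem Rel.star {I E : Type} [Field E] {Q : MvPolynomial (J ⊕ (J ⊕ W)) k} {f : k →+* E}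
    {a b : J → Finset I → E} (h : ∀ S, Rel Q f (fun j => a j S) (fun j => b j S)) :
    Rel Q ((algebraMap E (Star I E)).comp f) (fun j => Star.mkHom (a j))
      (fun j => Star.mkHom (b j)) := by
  choose v hv using h
  refine ⟨fun j => Star.mkHom fun S => v S j, ?_⟩
  have := (Star.eval₂_mk_eq_zero_iff f
    (Sum.elim a (Sum.elim b fun j S => v S j)) Q).2 (Filter.Eventually.of_forall fun S => by
      rw [← hv S]
      congr 1
      ext (j | j | j) <;> rfl)
  rw [← this]
  congr 1
  ext (j | j | j) <;> rfl

/-- The coordinatewise map between ultrapowers. -/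
noncomputable def Star.map (I : Type) {E F : Type} [Field E] [Field F] (f : E →+* F) :
    Star I E →+* Star I F :=
  Ideal.Quotient.lift (RingHom.ker (Star.mkHom (I := I) (E := E)))
    ((Star.mkHom (I := I) (E := F)).comp (RingHom.pi fun S => f.comp (Pi.evalRingHom _ S)))
    (fun x hx => by
      rw [RingHom.mem_ker, ← map_zero Star.mkHom, Star.mkHom_eq_iff] at hx
      change Star.mkHom (fun S => f (x S)) = 0
      rw [← map_zero Star.mkHom, Star.mkHom_eq_iff]
      filter_upwards [hx] with S hS
      simp [hS]) |>.comp
    (RingHom.quotientKerEquivOfSurjective (Star.mkHom_surjective (I := I) (E := E))).symm.toRingHom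

theorem Star.map_mkHom {I E F : Type} [Field E] [Field F] (f : E →+* F) (x : Finset I → E) :
    Star.map I f (Star.mkHom x) = Star.mkHom fun S => f (x S) := by
  have : (RingHom.quotientKerEquivOfSurjective (Star.mkHom_surjective (I := I) (E := E))).symm
      (Star.mkHom x) = Ideal.Quotient.mk (RingHom.ker (Star.mkHom (I := I) (E := E))) x := by
    rw [RingEquiv.symm_apply_eq]
    rfl
  rw [Star.map, RingHom.comp_apply]
  erw [this]
  rfl

end Rel

section Transport
open IntermediateField

theorem isAlgebraic_rcl_singleton {E Ω : Type} [Field E] [Field Ω] [Algebra E Ω] (t : Ω)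
    (t' : rcl E {t}) (ht : (t' : Ω) = t) : Algebra.IsAlgebraic E⟮t'⟯ (rcl E {t}) := by
  let N' := rcl E {t}
  have hmem : ∀ z : E⟮t⟯, inclusion (adjoin_le_rcl {t}) z ∈ E⟮t'⟯ := by
    rintro ⟨z, hz⟩
    have h1 : E⟮t'⟯.map N'.val = E⟮t⟯ := by
      rw [adjoin_map, Set.image_singleton]
      simp [N', ht]
    rw [← h1] at hz
    obtain ⟨y, hy, rfl⟩ := hz
    exact hy
  let f : E⟮t⟯ →+* E⟮t'⟯ :=
    (inclusion (adjoin_le_rcl {t})).toRingHom.codRestrict E⟮t'⟯.toSubfield hmem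
  refine ⟨fun b => ?_⟩
  have hb : IsAlgebraic E⟮t⟯ (b : Ω) := mem_rcl.1 b.2
  let _ : Algebra E⟮t⟯ N' := (inclusion (adjoin_le_rcl {t})).toRingHom.toAlgebra
  have hb' : IsAlgebraic E⟮t⟯ b :=
    IsAlgebraic.of_ringHom_of_comp_eq (RingHom.id E⟮t⟯) N'.val.toRingHom hb
      (fun z => ⟨z, rfl⟩) N'.val.toRingHom.injective rfl
  exact hb'.ringHom_of_comp_eq f (RingHom.id N') f.injective rfl

variable {F R E Ω E' : Type} [Field F] [Field R] [Field E] [Field Ω] [Field E']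
  [Algebra F R] [Algebra F E] [Algebra E Ω] [Algebra E E']

theorem mem_rcl_of_isAlgebraic [Algebra F Ω] [IsScalarTower F E Ω] {x : R}
    [Algebra.IsAlgebraic F⟮x⟯ R] (g : R →ₐ[F] Ω) {t : Ω} (hx : g x ∈ E⟮t⟯) (r : R) :
    g r ∈ rcl E {t} := by
  rw [mem_rcl]
  have hmem : ∀ z : F⟮x⟯, g z ∈ E⟮t⟯ := by
    rintro ⟨z, hz⟩
    have : F⟮x⟯ ≤ ((E⟮t⟯).restrictScalars F).comap g := by
      rw [adjoin_simple_le_iff]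
      exact hx
    exact this hz
  let f : F⟮x⟯ →+* E⟮t⟯ := (g.toRingHom.comp (F⟮x⟯).val.toRingHom).codRestrict E⟮t⟯.toSubfield hmem
  have hr : IsAlgebraic F⟮x⟯ r := Algebra.IsAlgebraic.isAlgebraic r
  exact hr.ringHom_of_comp_eq f g.toRingHom f.injective rfl

variable [LinearOrder E] [IsStrictOrderedRing E] [IsRealClosed E]
  [LinearOrder Ω] [IsStrictOrderedRing Ω] [IsRealClosed Ω]
  [LinearOrder E'] [IsStrictOrderedRing E'] [IsRealClosed E']

theorem Rel.transport {k J W : Type} [Field k] [Finite W] {Q : MvPolynomial (J ⊕ (J ⊕ W)) k}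
    {f : k →+* E} [Algebra F Ω] [IsScalarTower F E Ω] [Algebra F E'] [IsScalarTower F E E'] {x : R}
    [Algebra.IsAlgebraic F⟮x⟯ R] (g : R →ₐ[F] Ω) {t : Ω} {y : E'}
    (ht : t ∉ Set.range (algebraMap E Ω))
    (h1 : ∀ a : E, algebraMap E Ω a < t ↔ algebraMap E E' a < y)
    (h2 : ∀ a : E, t < algebraMap E Ω a ↔ y < algebraMap E E' a)
    {c : E} (hx : g x = algebraMap E Ω c + t) {a : J → R} {b : J → E}
    (h : Rel Q ((algebraMap E Ω).comp f) (fun j => g (a j)) (fun j => algebraMap E Ω (b j))) :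
    ∃ g' : R →ₐ[F] E', g' x = algebraMap E E' c + y ∧
      Rel Q ((algebraMap E E').comp f) (fun j => g' (a j)) (fun j => algebraMap E E' (b j)) := by
  have hxt : g x ∈ E⟮t⟯ := by
    rw [hx]
    exact add_mem (E⟮t⟯.algebraMap_mem c) (mem_adjoin_simple_self E t)
  let N := rcl E {t}
  have htN : t ∈ N := adjoin_le_rcl _ (mem_adjoin_simple_self E t)
  let t' : N := ⟨t, htN⟩
  have : Algebra.IsAlgebraic E⟮t'⟯ N := isAlgebraic_rcl_singleton t t' rfl
  have : IsRealClosed N := inferInstanceAs (IsRealClosed (rcl E {t}))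
  let gN : R →+* N := g.toRingHom.codRestrict N.toSubfield fun r => mem_rcl_of_isAlgebraic g hxt r
  have hgN : ∀ r, (gN r : Ω) = g r := fun r => rfl
  obtain ⟨φ, hφ⟩ := exists_cut_embedding (R := E) (M := N) (E := E') (m := t') (y := y)
    (by
      rintro ⟨e, he⟩
      exact ht ⟨e, congrArg Subtype.val he⟩) h1 h2
  let g' : R →ₐ[F] E' := { φ.toRingHom.comp gN with
    commutes' := fun r => by
      have : gN (algebraMap F R r) = algebraMap E N (algebraMap F E r) := by
        apply Subtype.ext
        rw [hgN, g.commutes, IsScalarTower.algebraMap_apply F E Ω]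
        rfl
      change φ (gN (algebraMap F R r)) = _
      rw [this, φ.commutes, ← IsScalarTower.algebraMap_apply F E E'] }
  refine ⟨g', ?_, ?_⟩
  · change φ (gN x) = _
    have : gN x = algebraMap E N c + t' := Subtype.ext (by rw [hgN, hx]; rfl)
    rw [this, map_add, φ.commutes, hφ]
  · have hN : Rel Q ((algebraMap E N).comp f) (fun j => gN (a j)) (fun j => algebraMap E N (b j)) :=
      Rel.descend (A := N) (B := Ω) N.val.toRingHom h
    have := hN.map (f' := (algebraMap E E').comp f) φ.toRingHom (by
      rw [← RingHom.comp_assoc]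
      congr 1
      exact φ.comp_algebraMap)
    simp only [AlgHom.toRingHom_eq_coe, RingHom.coe_coe, φ.commutes] at this
    exact this
end Transport

section Infinitesimal

theorem isFormallyRealField_laurentSeries {R : Type} [Field R] [LinearOrder R]
    [IsStrictOrderedRing R] : IsFormallyRealField (LaurentSeries R) := by
  have : ¬ IsSumSq (-1 : Lex (HahnSeries ℤ R)) := IsSemireal.not_isSumSq_neg_one _
  let e : LaurentSeries R →+* Lex (HahnSeries ℤ R) :=
    { toFun := toLex, map_one' := rfl, map_mul' := fun _ _ => rfl, map_zero' := rfl,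
      map_add' := fun _ _ => rfl }
  exact not_isSumSq_of_injective e this

/-- A real closed field containing the power series ring, in which the variable is infinitesimal
of prescribed sign. -/
theorem exists_infinitesimal (R : Type) [Field R] [LinearOrder R] [IsStrictOrderedRing R]
    [IsRealClosed R] (neg : Prop) : ∃ (Ω : Type) (_ : Field Ω) (_ : LinearOrder Ω)
      (_ : IsStrictOrderedRing Ω) (_ : IsRealClosed Ω) (_ : Algebra R Ω)
      (ι : PowerSeries R →ₐ[R] Ω), (neg → ι PowerSeries.X < 0) ∧ (¬ neg → 0 < ι PowerSeries.X) ∧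
      ∀ r : R, 0 < r → |ι PowerSeries.X| < algebraMap R Ω r := by
  obtain ⟨Ω, _, _, halg, hΩ⟩ :=
    exists_realClosed_algebraic (LaurentSeries R) isFormallyRealField_laurentSeries
  have := IsRealClosedField.isRealClosed hΩ
  let _ := linearOrderOfRealClosed Ω
  have := isStrictOrderedRing_of_realClosed Ω
  let j : PowerSeries R →+* Ω :=
    (algebraMap (LaurentSeries R) Ω).comp (HahnSeries.ofPowerSeries ℤ R)
  have hj : Function.Injective j :=
    (algebraMap (LaurentSeries R) Ω).injective.comp HahnSeries.ofPowerSeries_injective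
  let _ : Algebra R Ω := (j.comp PowerSeries.C).toAlgebra
  let ι₀ : PowerSeries R →ₐ[R] Ω :=
    { j with
      commutes' := fun r => congrArg j (PowerSeries.algebraMap_apply (R := R) (A := R) (r := r)) }
  have hX : ι₀ PowerSeries.X ≠ 0 := by
    intro h
    exact PowerSeries.X_ne_zero (hj (h.trans (map_zero j).symm))
  have hsq : ∀ f : PowerSeries R, 0 < PowerSeries.constantCoeff f → 0 ≤ ι₀ f := by
    intro f hf
    obtain ⟨c, hc⟩ := IsRealClosed.nonneg_iff_isSquare.1 hf.le
    have hc0 : c ≠ 0 := by rintro rfl; simp at hc; exact hf.ne' hc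
    obtain ⟨u, hu⟩ := isSquare_of_constantCoeff_one (f := PowerSeries.C (c⁻¹ * c⁻¹) * f) (by
      rw [map_mul, PowerSeries.constantCoeff_C, hc]
      field_simp)
    have : f = (PowerSeries.C c * u) * (PowerSeries.C c * u) := by
      calc f = PowerSeries.C (c * c) * (PowerSeries.C (c⁻¹ * c⁻¹) * f) := by
            rw [← mul_assoc, ← map_mul]
            have : c * c * (c⁻¹ * c⁻¹) = 1 := by field_simp
            rw [this, map_one, one_mul]
        _ = _ := by rw [hu, map_mul]; ring
    rw [this, map_mul]
    exact mul_self_nonneg _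
  have hle : ∀ r : R, 0 < r → |ι₀ PowerSeries.X| ≤ algebraMap R Ω r := by
    intro r hr
    rw [abs_le]
    have h1 := hsq (PowerSeries.C r + PowerSeries.X) (by simpa using hr)
    have h2 := hsq (PowerSeries.C r - PowerSeries.X) (by simpa using hr)
    have h3 : ι₀ (PowerSeries.C r) = algebraMap R Ω r := rfl
    rw [map_add, h3] at h1
    rw [map_sub, h3] at h2
    constructor <;> linarith
  have hmono := strictMono_of_realClosed (algebraMap R Ω)
  have hlt : ∀ r : R, 0 < r → |ι₀ PowerSeries.X| < algebraMap R Ω r := fun r hr =>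
    (hle (r / 2) (by positivity)).trans_lt (hmono (by linarith))
  let σ : PowerSeries R →ₐ[R] PowerSeries R :=
    { PowerSeries.rescale (-1 : R) with
      commutes' := fun r => by
        change PowerSeries.rescale (-1) _ = _
        ext n
        rw [PowerSeries.coeff_rescale, PowerSeries.algebraMap_apply, PowerSeries.coeff_C]
        split_ifs with h <;> simp [h] }
  have hσ : (ι₀.comp σ) PowerSeries.X = - ι₀ PowerSeries.X := by
    rw [← map_neg]
    change ι₀ (PowerSeries.rescale (-1) PowerSeries.X) = _
    rw [PowerSeries.rescale_X]
    simp
  refine ⟨Ω, inferInstance, inferInstance, inferInstance, inferInstance, inferInstance, ?_⟩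
  rcases lt_or_gt_of_ne hX with h | h <;> by_cases hneg : neg
  · exact ⟨ι₀, fun _ => h, fun h => absurd hneg h, hlt⟩
  · refine ⟨ι₀.comp σ, fun h => absurd h hneg, fun _ => by rw [hσ]; linarith, ?_⟩
    rwa [hσ, abs_neg]
  · refine ⟨ι₀.comp σ, fun _ => by rw [hσ]; linarith, fun h => absurd hneg h, ?_⟩
    rwa [hσ, abs_neg]
  · exact ⟨ι₀, fun h => absurd h hneg, fun _ => h, hlt⟩

end Infinitesimal

/-- A relation on the zero set of `P` which is an equivalence relation over every real closed
field and whose classes are formally open. -/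
structure IsFormallyOpenRel {k J W : Type} [Field k] (P : Set (MvPolynomial J k))
    (Q : MvPolynomial (J ⊕ (J ⊕ W)) k) : Prop where
  refl : ∀ (R : Type) [Field R] [IsRealClosed R] (f : k →+* R) (a : J → R),
    (∀ p ∈ P, p.eval₂ f a = 0) → Rel Q f a a
  symm : ∀ (R : Type) [Field R] [IsRealClosed R] (f : k →+* R) (a b : J → R),
    (∀ p ∈ P, p.eval₂ f a = 0) → (∀ p ∈ P, p.eval₂ f b = 0) → Rel Q f a b → Rel Q f b a
  trans : ∀ (R : Type) [Field R] [IsRealClosed R] (f : k →+* R) (a b c : J → R),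
    (∀ p ∈ P, p.eval₂ f a = 0) → (∀ p ∈ P, p.eval₂ f b = 0) → (∀ p ∈ P, p.eval₂ f c = 0) →
    Rel Q f a b → Rel Q f b c → Rel Q f a c
  local_const : ∀ (R : Type) [Field R] [IsRealClosed R] (f : k →+* R) (a : J → PowerSeries R),
    (∀ p ∈ P, p.eval₂ (PowerSeries.C.comp f) a = 0) →
    Rel Q (PowerSeries.C.comp f) a (fun j => PowerSeries.C (PowerSeries.constantCoeff (a j)))

section OpenRel
open IntermediateField
variable {k J W F R E : Type} [Field k] [Finite W] [Field F] [Field R] [Field E]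
  [LinearOrder F] [IsStrictOrderedRing F] [IsRealClosed F]
  [LinearOrder R] [IsStrictOrderedRing R] [IsRealClosed R]
  [LinearOrder E] [IsStrictOrderedRing E] [IsRealClosed E]
  [Algebra F R] [Algebra F E]
  {P : Set (MvPolynomial J k)} {Q : MvPolynomial (J ⊕ (J ⊕ W)) k}

theorem eval₂_map_eq_zero {A B : Type} [CommRing A] [CommRing B] {f : k →+* A} {f' : k →+* B}
    {a : J → A} (ha : ∀ p ∈ P, p.eval₂ f a = 0) (g : A →+* B) (hg : g.comp f = f') :
    ∀ p ∈ P, p.eval₂ f' (fun j => g (a j)) = 0 := by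
  intro p hp
  have := congrArg g (ha p hp)
  rwa [map_zero, MvPolynomial.hom_eval₂, hg] at this

theorem cut_of_infinitesimal {E₁ : Type} [Field E₁] [LinearOrder E₁] [IsStrictOrderedRing E₁]
    [Algebra R E₁] {t : E₁} (hm : StrictMono (algebraMap R E₁)) (ht0 : t ≠ 0)
    (ht : ∀ r : R, 0 < r → |t| < algebraMap R E₁ r) (r : R) :
    (algebraMap R E₁ r < t ↔ (r < 0 ∨ (r = 0 ∧ ¬ t < 0))) ∧
      (t < algebraMap R E₁ r ↔ (0 < r ∨ (r = 0 ∧ t < 0))) := by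
  rcases lt_trichotomy r 0 with h | rfl | h
  · have := ht (-r) (by linarith)
    rw [map_neg, abs_lt, neg_neg] at this
    exact ⟨by simp [h, this.1], by simp [h.ne, h.not_gt, this.1.le]⟩
  · simp [lt_iff_le_and_ne, ht0, ht0.symm]
  · have := ht r h
    rw [abs_lt] at this
    exact ⟨by simp [h.ne', h.not_gt, this.2.le], by simp [h, this.2]⟩

theorem IsFormallyOpenRel.rel_of_infinitesimal (H : IsFormallyOpenRel P Q) (f : k →+* F) {x : R}
    [Algebra.IsAlgebraic F⟮x⟯ R] (φ ψ : R →ₐ[F] E) (hδ : ∀ r : R, 0 < r → |ψ x - φ x| < φ r)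
    (a : J → R) (ha : ∀ p ∈ P, p.eval₂ ((algebraMap F R).comp f) a = 0) :
    Rel Q ((algebraMap F E).comp f) (fun j => ψ (a j)) (fun j => φ (a j)) := by
  by_cases hx : φ x = ψ x
  · have := algHom_ext_cut hx
    subst this
    exact H.refl E _ _ (eval₂_map_eq_zero ha φ.toRingHom (by
      rw [← RingHom.comp_assoc]; congr 1; exact φ.comp_algebraMap))
  have hxF : Transcendental F x := by
    intro halg
    obtain ⟨c, rfl⟩ := mem_range_of_isAlgebraic halg
    exact hx (by rw [φ.commutes, ψ.commutes])
  obtain ⟨Θ, hΘ, hΘ0⟩ := exists_taylor_of_transcendental hxF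
  obtain ⟨Ω, _, _, _, _, _, ι, h1, h2, h3⟩ := exists_infinitesimal R (ψ x - φ x < 0)
  let _ : Algebra F Ω := ((algebraMap R Ω).comp (algebraMap F R)).toAlgebra
  have : IsScalarTower F R Ω := IsScalarTower.of_algebraMap_eq fun _ => rfl
  let _ : Algebra R E := φ.toRingHom.toAlgebra
  have : IsScalarTower F R E := IsScalarTower.of_algebraMap_eq fun r => (φ.commutes r).symm
  have hloc := H.local_const R ((algebraMap F R).comp f) (fun j => Θ (a j))
    (eval₂_map_eq_zero ha Θ.toRingHom (by
      rw [← RingHom.comp_assoc, ← RingHom.comp_assoc]; congr 1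
      ext1 r
      exact (Θ.commutes r).trans PowerSeries.algebraMap_apply))
  have hloc' := hloc.map (f' := (algebraMap R Ω).comp ((algebraMap F R).comp f)) ι.toRingHom (by
    rw [← RingHom.comp_assoc]; congr 1
    ext1 r
    exact ι.commutes r)
  simp only [hΘ0] at hloc'
  have hC : ∀ r, ι (PowerSeries.C r) = algebraMap R Ω r := ι.commutes
  have hΘa : Rel Q ((algebraMap R Ω).comp ((algebraMap F R).comp f))
      (fun j => ((ι.restrictScalars F).comp Θ) (a j)) (fun j => algebraMap R Ω (a j)) := by
    have h : (fun j => ι.toRingHom (PowerSeries.C (a j))) = fun j => algebraMap R Ω (a j) :=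
      funext fun j => hC _
    rw [h] at hloc'
    exact hloc'
  have hmono := strictMono_of_realClosed (algebraMap R E)
  have hmonoΩ := strictMono_of_realClosed (algebraMap R Ω)
  have hφ : ∀ r, φ r = algebraMap R E r := fun r => rfl
  have hX0 : ι PowerSeries.X ≠ 0 := by
    by_cases h : ψ x - φ x < 0
    · exact (h1 h).ne
    · exact (h2 h).ne'
  have hXlt : ι PowerSeries.X < 0 ↔ ψ x - φ x < 0 :=
    ⟨fun h => by_contra fun h' => h.not_gt (h2 h'), h1⟩
  have k1 := cut_of_infinitesimal hmonoΩ hX0 h3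
  have k2 := cut_of_infinitesimal hmono (sub_ne_zero.2 (Ne.symm hx)) hδ
  obtain ⟨g', hg', hrel⟩ := Rel.transport (F := F) (E := R) (Ω := Ω) (E' := E) (x := x)
    ((ι.restrictScalars F).comp Θ) (t := ι PowerSeries.X) (y := ψ x - φ x)
    (by
      rintro ⟨r, hr⟩
      have := k1 r
      rw [hr] at this
      simp only [lt_irrefl, false_iff, not_or, not_and, not_not] at this
      rcases lt_trichotomy r 0 with h | h | h
      · exact this.1.1 h
      · exact this.2.2 h (this.1.2 h)
      · exact this.2.1 h)
    (fun r => by rw [(k1 r).1, (k2 r).1, hXlt]) (fun r => by rw [(k1 r).2, (k2 r).2, hXlt])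
    (c := x) (by
      change ι (Θ x) = _
      rw [hΘ, map_add, hC]) (a := a) (b := a) hΘa
  have : g' = ψ := algHom_ext_cut (m := x) (by rw [hg', ← hφ]; ring)
  rw [this] at hrel
  have hf : (algebraMap R E).comp ((algebraMap F R).comp f) = (algebraMap F E).comp f := by
    rw [← RingHom.comp_assoc]; congr 1; exact φ.comp_algebraMap
  rw [hf] at hrel
  exact hrel

theorem IsFormallyOpenRel.exists_nhds_rel (H : IsFormallyOpenRel P Q) (f : k →+* F) {x : R}
    [Algebra.IsAlgebraic F⟮x⟯ R] (a : J → R)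
    (ha : ∀ p ∈ P, p.eval₂ ((algebraMap F R).comp f) a = 0) (φ : R →ₐ[F] E) :
    ∃ ε : E, 0 < ε ∧ ∀ ψ : R →ₐ[F] E, |ψ x - φ x| < ε →
      Rel Q ((algebraMap F E).comp f) (fun j => ψ (a j)) (fun j => φ (a j)) := by
  by_contra! hcon
  have hS : ∀ S : Finset E, ∃ ε : E, 0 < ε ∧ ∀ e ∈ S, 0 < e → ε ≤ e := by
    intro S
    classical
    induction S using Finset.induction_on with
    | empty => exact ⟨1, one_pos, by simp⟩
    | insert e S _ ih =>
      obtain ⟨ε, h0, h⟩ := ih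
      by_cases he : 0 < e
      · refine ⟨min e ε, lt_min he h0, fun e' he' hpos => ?_⟩
        rcases Finset.mem_insert.1 he' with rfl | h'
        · exact min_le_left _ _
        · exact (min_le_right _ _).trans (h _ h' hpos)
      · refine ⟨ε, h0, fun e' he' hpos => ?_⟩
        rcases Finset.mem_insert.1 he' with rfl | h'
        · exact absurd hpos he
        · exact h _ h' hpos
  choose ε hε0 hε using hS
  choose ψ hψ1 hψ2 using fun S => hcon (ε S) (hε0 S)
  let φs : R →ₐ[F] Star E E := { (algebraMap E (Star E E)).comp φ.toRingHom with
    commutes' := fun r => congrArg (algebraMap E (Star E E)) (φ.commutes r) }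
  let ψs : R →ₐ[F] Star E E := { Star.mkHom.comp (RingHom.pi fun S => (ψ S).toRingHom) with
    commutes' := fun r => congrArg Star.mkHom (funext fun S => (ψ S).commutes r) }
  have hinf : ∀ r : R, 0 < r → |ψs x - φs x| < φs r := by
    intro r hr
    have h0 : 0 < φ r := by
      have := strictMono_of_realClosed φ.toRingHom hr
      rwa [map_zero] at this
    have hlt : ∀ᶠ S in (starFilter E : Filter (Finset E)), |ψ S x - φ x| < φ r := by
      filter_upwards [eventually_mem_starFilter (φ r)] with S hS
      exact (hψ1 S).trans_le (hε S _ hS h0)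
    have e1 : ψs x - φs x = Star.mkHom fun S => ψ S x - φ x :=
      (map_sub Star.mkHom (fun S => ψ S x) (fun S => φ x)).symm
    have e2 : -φs r = Star.mkHom fun S => - φ r := (map_neg Star.mkHom _).symm
    rw [abs_lt, e2, e1]
    exact ⟨Star.mkHom_lt_iff.2 (hlt.mono fun S h => (abs_lt.1 h).1),
      Star.mkHom_lt_iff.2 (hlt.mono fun S h => (abs_lt.1 h).2)⟩
  have := H.rel_of_infinitesimal f φs ψs hinf a ha
  obtain ⟨S, hS⟩ := (Rel.of_star (I := E) (f := (algebraMap F E).comp f)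
    (a := fun j S => ψ S (a j)) (b := fun j S => φ (a j)) this).exists
  exact hψ2 S hS

end OpenRel

/-- A locally constant relation jumping between `p` and `q` jumps at a gap. -/
theorem exists_jump {E : Type} [Field E] [LinearOrder E] [IsStrictOrderedRing E] {p q : E}
    (hpq : p ≤ q) (r : E → Prop) (hp : r p) (hq : ¬ r q)
    (hloc : ∀ y ∈ Set.Icc p q, ∃ ε : E, 0 < ε ∧ ∀ z ∈ Set.Icc p q, |z - y| < ε → (r z ↔ r y))
    (S : Finset E) :
    ∃ l ∈ Set.Icc p q, ∃ w ∈ Set.Icc p q, r l ∧ ¬ r w ∧ l < w ∧ ∀ e ∈ S, e < l ∨ w < e := by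
  classical
  let L : Set E := {y | y ∈ Set.Icc p q ∧ ∀ z ∈ Set.Icc p q, z ≤ y → r z}
  have hpL : p ∈ L := ⟨⟨le_rfl, hpq⟩, fun z hz hzp => by rwa [le_antisymm hzp hz.1]⟩
  have hL : ∀ y ∈ L, ∃ y' ∈ L, y < y' := by
    intro y hy
    obtain ⟨ε, h0, hε⟩ := hloc y hy.1
    have hry : r y := hy.2 y hy.1 le_rfl
    refine ⟨y + ε / 2, ⟨⟨by linarith [hy.1.1], ?_⟩, fun z hz hzy => ?_⟩, by linarith⟩
    · by_contra! h
      refine hq ((hε q ⟨hpq, le_rfl⟩ ?_).2 hry)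
      rw [abs_lt]
      constructor <;> linarith [hy.1.2]
    · rcases le_total z y with h | h
      · exact hy.2 z hz h
      · exact (hε z hz (by rw [abs_lt]; constructor <;> linarith)).2 hry
  have hB : ∀ y ∈ Set.Icc p q, ¬ r y → ∃ y' ∈ Set.Icc p q, ¬ r y' ∧ y' < y := by
    intro y hy hry
    obtain ⟨ε, h0, hε⟩ := hloc y hy
    have h1 : p ≤ y - ε / 2 := by
      by_contra! h
      refine hry ((hε p ⟨le_rfl, hpq⟩ ?_).1 hp)
      rw [abs_lt]
      constructor <;> linarith [hy.1]
    refine ⟨y - ε / 2, ⟨h1, by linarith [hy.2]⟩, fun h =>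
        hry ((hε _ ⟨h1, by linarith [hy.2]⟩ ?_).1 h),
      by linarith⟩
    rw [abs_lt]; constructor <;> linarith
  have hU : ∀ y ∈ Set.Icc p q, y ∉ L → ∃ y' ∈ Set.Icc p q, ¬ r y' ∧ y' < y := by
    intro y hy hyL
    have : ∃ z ∈ Set.Icc p q, z ≤ y ∧ ¬ r z := by
      by_contra! h
      exact hyL ⟨hy, h⟩
    obtain ⟨z, hz, hzy, hrz⟩ := this
    obtain ⟨z', hz', hrz', hlt⟩ := hB z hz hrz
    exact ⟨z', hz', hrz', hlt.trans_le hzy⟩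
  obtain ⟨l₀, hl₀, hmax⟩ := (insert p (S.filter (· ∈ L))).exists_max_image id
    ⟨p, Finset.mem_insert_self _ _⟩
  have hl₀L : l₀ ∈ L := by
    rcases Finset.mem_insert.1 hl₀ with rfl | h
    · exact hpL
    · exact (Finset.mem_filter.1 h).2
  obtain ⟨l, hl, hll⟩ := hL l₀ hl₀L
  obtain ⟨w₀, hw₀, hmin⟩ := (insert q (S.filter fun e => e ∈ Set.Icc p q ∧
      e ∉ L)).exists_min_image id
    ⟨q, Finset.mem_insert_self _ _⟩
  have hqL : q ∉ L := fun h => hq (h.2 q ⟨hpq, le_rfl⟩ le_rfl)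
  have hw₀U : w₀ ∈ Set.Icc p q ∧ w₀ ∉ L := by
    rcases Finset.mem_insert.1 hw₀ with rfl | h
    · exact ⟨⟨hpq, le_rfl⟩, hqL⟩
    · exact (Finset.mem_filter.1 h).2
  obtain ⟨w, hw, hrw, hlt⟩ := hU w₀ hw₀U.1 hw₀U.2
  refine ⟨l, hl.1, w, hw, hl.2 l hl.1 le_rfl, hrw, ?_, fun e he => ?_⟩
  · by_contra! h
    exact hrw (hl.2 w hw h)
  · by_cases h1 : e < p
    · exact Or.inl (h1.trans_le hl.1.1)
    by_cases h2 : q < e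
    · exact Or.inr (hw.2.trans_lt h2)
    have heI : e ∈ Set.Icc p q := ⟨not_lt.1 h1, not_lt.1 h2⟩
    by_cases heL : e ∈ L
    · exact Or.inl ((hmax e (Finset.mem_insert_of_mem (Finset.mem_filter.2 ⟨he,
        heL⟩))).trans_lt hll)
    · exact Or.inr (hlt.trans_le (hmin e (Finset.mem_insert_of_mem
        (Finset.mem_filter.2 ⟨he, heI, heL⟩))))

section OpenRel
open IntermediateField
variable {k J W F R E : Type} [Field k] [Finite W] [Field F] [Field R] [Field E]
  [LinearOrder F] [IsStrictOrderedRing F] [IsRealClosed F]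
  [LinearOrder R] [IsStrictOrderedRing R] [IsRealClosed R]
  [LinearOrder E] [IsStrictOrderedRing E] [IsRealClosed E]
  [Algebra F R] [Algebra F E]
  {P : Set (MvPolynomial J k)} {Q : MvPolynomial (J ⊕ (J ⊕ W)) k}

/-- The homomorphism into an ultrapower given by a family of homomorphisms. -/
noncomputable def Star.lift {I : Type} (χ : Finset I → R →ₐ[F] E) : R →ₐ[F] Star I E :=
  { Star.mkHom.comp (RingHom.pi fun S => (χ S).toRingHom) with
    commutes' := fun r => congrArg Star.mkHom (funext fun S => (χ S).commutes r) }

theorem Star.lift_apply {I : Type} (χ : Finset I → R →ₐ[F] E) (r : R) :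
    Star.lift χ r = Star.mkHom fun S => χ S r := rfl

theorem IsFormallyOpenRel.rel_of_le (H : IsFormallyOpenRel P Q) (f : k →+* F) {x : R}
    [Algebra.IsAlgebraic F⟮x⟯ R] (a : J → R)
    (ha : ∀ p ∈ P, p.eval₂ ((algebraMap F R).comp f) a = 0) (φ ψ : R →ₐ[F] E) (hle : φ x ≤ ψ x) :
    Rel Q ((algebraMap F E).comp f) (fun j => ψ (a j)) (fun j => φ (a j)) := by
  have hza : ∀ χ : R →ₐ[F] E, ∀ p ∈ P, p.eval₂ ((algebraMap F E).comp f) (fun j => χ (a j)) = 0 :=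
    fun χ => eval₂_map_eq_zero ha χ.toRingHom (by
      rw [← RingHom.comp_assoc]; congr 1; exact χ.comp_algebraMap)
  by_contra hbad
  have hx : x ∉ Set.range (algebraMap F R) := by
    rintro ⟨c, hc⟩
    have : φ = ψ := algHom_ext_cut (m := x) (by rw [← hc, φ.commutes, ψ.commutes])
    subst this
    exact hbad (H.refl E _ _ (hza _))
  have hφm := strictMono_of_realClosed φ.toRingHom
  have hψm := strictMono_of_realClosed ψ.toRingHom
  have hχ : ∀ y : E, ∃ χ : R →ₐ[F] E, φ x ≤ y → y ≤ ψ x → χ x = y := by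
    intro y
    by_cases hy : φ x ≤ y ∧ y ≤ ψ x
    · obtain ⟨χ, hχ⟩ := exists_cut_embedding (R := F) (M := R) (E := E) (m := x) (y := y) hx
        (fun c => ⟨fun h => by
            rw [← φ.commutes]; exact (hφm h).trans_le hy.1,
          fun h => by
            rw [← ψ.commutes] at h; exact hψm.lt_iff_lt.1 (h.trans_le hy.2)⟩)
        (fun c => ⟨fun h => by
            rw [← ψ.commutes]; exact hy.2.trans_lt (hψm h),
          fun h => by
            rw [← φ.commutes] at h; exact hφm.lt_iff_lt.1 (hy.1.trans_lt h)⟩)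
      exact ⟨χ, fun _ _ => hχ⟩
    · exact ⟨φ, fun h1 h2 => absurd ⟨h1, h2⟩ hy⟩
  choose χ hχ using hχ
  have hχφ : χ (φ x) = φ := algHom_ext_cut (m := x) (hχ _ le_rfl hle)
  have hχψ : χ (ψ x) = ψ := algHom_ext_cut (m := x) (hχ _ hle le_rfl)
  let r : E → Prop := fun y =>
    Rel Q ((algebraMap F E).comp f) (fun j => χ y (a j)) (fun j => φ (a j))
  have hjump := exists_jump hle r (by simp only [r]; rw [hχφ]; exact H.refl E _ _ (hza _))
    (by simp only [r]; rwa [hχψ]) (by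
      intro y hy
      obtain ⟨ε, h0, hε⟩ := H.exists_nhds_rel f (x := x) a ha (χ y)
      refine ⟨ε, h0, fun z hz hzy => ?_⟩
      have h1 := hε (χ z) (by rwa [hχ y hy.1 hy.2, hχ z hz.1 hz.2])
      exact ⟨fun h => H.trans E _ _ _ _ (hza _) (hza _) (hza _)
          (H.symm E _ _ _ (hza _) (hza _) h1) h,
        fun h => H.trans E _ _ _ _ (hza _) (hza _) (hza _) h1 h⟩)
  choose l hl w hw hrl hrw hlw hgap using hjump
  have hg : ∀ e : E, (algebraMap E (Star E E) e < Star.mkHom l ↔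
      algebraMap E (Star E E) e < Star.mkHom w) ∧ (Star.mkHom l < algebraMap E (Star E E) e ↔
      Star.mkHom w < algebraMap E (Star E E) e) := by
    intro e
    simp only [Star.algebraMap_eq, Algebra.algebraMap_self, RingHom.id_apply, Star.mkHom_lt_iff]
    refine ⟨Filter.eventually_congr ?_, Filter.eventually_congr ?_⟩ <;>
      filter_upwards [eventually_mem_starFilter e] with S hS
    · exact ⟨fun h => h.trans (hlw S), fun h => (hgap S e hS).resolve_right h.not_gt⟩
    · exact ⟨fun h => (hgap S e hS).resolve_left h.not_gt, fun h => (hlw S).trans h⟩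
  have hlr : (Star.mkHom l : Star E E) ∉ Set.range (algebraMap E (Star E E)) := by
    rintro ⟨e, he⟩
    have h1 : (Star.mkHom l : Star E E) < Star.mkHom w :=
      Star.mkHom_lt_iff.2 (Filter.Eventually.of_forall hlw)
    have h2 := (hg e).1
    rw [he] at h2
    exact lt_irrefl _ (h2.2 h1)
  have hR := Rel.star (I := E) (f := (algebraMap F E).comp f) (Q := Q)
    (a := fun j S => χ (l S) (a j)) (b := fun j S => φ (a j)) hrl
  obtain ⟨g', hg', hrel⟩ := Rel.transport (F := F) (E := E) (Ω := Star E E) (E' := Star E E)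
    (x := x) (Q := Q) (f := (algebraMap F E).comp f) (Star.lift fun S => χ (l S))
    (t := Star.mkHom l) (y := Star.mkHom w) hlr (fun e => (hg e).1) (fun e => (hg e).2) (c := 0)
    (by
      rw [map_zero, zero_add, Star.lift_apply]
      congr 1
      ext S
      exact hχ _ (hl S).1 (hl S).2) (a := a) (b := fun j => φ (a j)) hR
  have : g' = Star.lift fun S => χ (w S) := algHom_ext_cut (m := x) (by
    rw [hg', map_zero, zero_add, Star.lift_apply]
    congr 1
    ext S
    exact (hχ _ (hw S).1 (hw S).2).symm)
  rw [this] at hrel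
  obtain ⟨S, hS⟩ := (Rel.of_star (I := E) (f := (algebraMap F E).comp f)
    (a := fun j S => χ (w S) (a j)) (b := fun j S => φ (a j)) hrel).exists
  exact hrw S hS

theorem IsFormallyOpenRel.rel_of_algHom (H : IsFormallyOpenRel P Q) (f : k →+* F) {x : R}
    [Algebra.IsAlgebraic F⟮x⟯ R] (a : J → R)
    (ha : ∀ p ∈ P, p.eval₂ ((algebraMap F R).comp f) a = 0) (φ ψ : R →ₐ[F] E) :
    Rel Q ((algebraMap F E).comp f) (fun j => ψ (a j)) (fun j => φ (a j)) := by
  rcases le_total (φ x) (ψ x) with h | h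
  · exact H.rel_of_le f a ha φ ψ h
  · have hza : ∀ χ : R →ₐ[F] E, ∀ p ∈ P,
        p.eval₂ ((algebraMap F E).comp f) (fun j => χ (a j)) = 0 :=
      fun χ => eval₂_map_eq_zero ha χ.toRingHom (by
        rw [← RingHom.comp_assoc]; congr 1; exact χ.comp_algebraMap)
    exact H.symm E _ _ _ (hza _) (hza _) (H.rel_of_le f a ha ψ φ h)
end OpenRel

section Base
open IntermediateField

theorem IsFormallyOpenRel.exists_rel_of_isAlgebraic {k J W F R : Type} [Field k] [Finite W]
    [Field F] [Field R] [LinearOrder F] [IsStrictOrderedRing F] [IsRealClosed F]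
    [LinearOrder R] [IsStrictOrderedRing R] [IsRealClosed R] [Algebra F R]
    {P : Set (MvPolynomial J k)} {Q : MvPolynomial (J ⊕ (J ⊕ W)) k}
    (H : IsFormallyOpenRel P Q) (hP : P.Finite) (f : k →+* F) (x : R)
    [Algebra.IsAlgebraic F⟮x⟯ R] (a : J → R)
    (ha : ∀ p ∈ P, p.eval₂ ((algebraMap F R).comp f) a = 0) :
    ∃ b : J → F, (∀ p ∈ P, p.eval₂ f b = 0) ∧
      Rel Q ((algebraMap F R).comp f) (fun j => algebraMap F R (b j)) a := by
  obtain ⟨φ⟩ := exists_star_embedding (R := F) x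
  choose z hz using fun j => Star.mkHom_surjective (φ (a j))
  let φ₁ : R →ₐ[F] Star F R :=
    { (Star.map F (algebraMap F R)).comp φ.toRingHom with
      commutes' := fun c =>
        (congrArg (Star.map F (algebraMap F R)) (φ.commutes c)).trans (Star.map_mkHom _ _) }
  have h1 := H.rel_of_algHom f (x := x) a ha (IsScalarTower.toAlgHom F R (Star F R)) φ₁
  have h2 : (fun j => φ₁ (a j)) = fun j => Star.mkHom fun S => algebraMap F R (z j S) := by
    ext j
    change Star.map F (algebraMap F R) (φ (a j)) = _
    rw [← hz, Star.map_mkHom]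
  rw [h2] at h1
  have h3 := Rel.of_star (I := F) (f := (algebraMap F R).comp f)
    (a := fun j S => algebraMap F R (z j S)) (b := fun j S => a j) h1
  have h4 : ∀ᶠ S in (starFilter F : Filter (Finset F)), ∀ p ∈ P,
      p.eval₂ f (fun j => z j S) = 0 := by
    rw [Filter.eventually_all_finite hP]
    intro p hp
    rw [← Star.eval₂_mk_eq_zero_iff]
    simp_rw [hz]
    exact eval₂_map_eq_zero ha φ.toRingHom (by
      rw [← RingHom.comp_assoc]; congr 1; exact φ.comp_algebraMap) p hp
  obtain ⟨S, h5, h6⟩ := (h3.and h4).exists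
  exact ⟨fun j => z j S, h6, h5⟩

/-- Every class of a formally open relation contains a point over the ground field. -/
theorem IsFormallyOpenRel.exists_rel {k J W E : Type} [Field k] [Finite W] [Finite J]
    [IsRealClosed k] [Field E] [IsRealClosed E] [Algebra k E]
    {P : Set (MvPolynomial J k)} {Q : MvPolynomial (J ⊕ (J ⊕ W)) k}
    (H : IsFormallyOpenRel P Q) (hP : P.Finite) (a : J → E)
    (ha : ∀ p ∈ P, p.eval₂ (algebraMap k E) a = 0) :
    ∃ b : J → k, (∀ p ∈ P, p.eval₂ (RingHom.id k) b = 0) ∧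
      Rel Q (algebraMap k E) (fun j => algebraMap k E (b j)) a := by
  have hbot : ∃ b : J → (⊥ : IntermediateField k E),
      (∀ p ∈ P, p.eval₂ (algebraMap k (⊥ : IntermediateField k E)) b = 0) ∧
        Rel Q (algebraMap k E) (fun j => (b j : E)) a := by
    refine rcl_induction (P := fun N : IntermediateField k E => ∃ b : J → N, (∀ p ∈ P,
        p.eval₂ (algebraMap k N) b = 0) ∧
      Rel Q (algebraMap k E) (fun j => (b j : E)) a) ?_ (Set.range a) (Set.finite_range a) ?_
    · rintro N N' h x hN hN' halg ⟨b, hb, hrel⟩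
      let _ : Algebra N N' := (inclusion h).toRingHom.toAlgebra
      let _ := linearOrderOfRealClosed N
      have := isStrictOrderedRing_of_realClosed N
      let _ := linearOrderOfRealClosed N'
      have := isStrictOrderedRing_of_realClosed N'
      have : Algebra.IsAlgebraic N⟮x⟯ N' := halg
      obtain ⟨c, hc, hcrel⟩ := H.exists_rel_of_isAlgebraic hP (algebraMap k N) x b hb
      refine ⟨c, hc, H.trans E _ _ _ _ ?_ ?_ ha (hcrel.map N'.val.toRingHom rfl) hrel⟩
      · exact eval₂_map_eq_zero hc N.val.toRingHom rfl
      · exact eval₂_map_eq_zero hb N'.val.toRingHom rfl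
    · refine ⟨fun j => ⟨a j, adjoin_le_rcl _ (subset_adjoin _ _ ⟨j, rfl⟩)⟩, fun p hp => ?_,
        H.refl E _ _ ha⟩
      apply (rcl k (Set.range a)).val.toRingHom.injective
      rw [map_zero, ← ha p hp, MvPolynomial.hom_eval₂]
      rfl
  obtain ⟨b, hb, hrel⟩ := hbot
  let e := botEquiv k E
  refine ⟨fun j => e (b j), ?_, ?_⟩
  · exact eval₂_map_eq_zero hb e.toAlgHom.toRingHom e.toAlgHom.comp_algebraMap
  · have : ∀ y : (⊥ : IntermediateField k E), algebraMap k E (e y) = y := fun y => by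
      obtain ⟨c, rfl⟩ := e.symm.surjective y
      rw [e.apply_symm_apply]
      rfl
    simpa only [this] using hrel

end Base

section MatrixSets
variable {k m : Type} [Field k] [Fintype m] [DecidableEq m]

/-- The matrix `M` is a zero of all polynomials in the set `S`. -/
def IsZero (S : Set (MvPolynomial (m × m) k)) {A : Type} [CommRing A] (f : k →+* A)
    (M : Matrix m m A) : Prop :=
  ∀ p ∈ S, p.eval₂ f (fun q => M q.1 q.2) = 0

theorem IsZero.map {S : Set (MvPolynomial (m × m) k)} {A B : Type} [CommRing A] [CommRing B]
    {f : k →+* A} {f' : k →+* B} {M : Matrix m m A} (h : IsZero S f M) (g : A →+* B)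
    (hg : g.comp f = f') : IsZero S f' (M.map g) := by
  intro p hp
  have := congrArg g (h p hp)
  rwa [map_zero, MvPolynomial.hom_eval₂, hg] at this

/-- The generic equation for conjugacy of two matrices by an element of the zero set of `G`. -/
noncomputable def conjPoly (G : Finset (MvPolynomial (m × m) k)) :
    MvPolynomial ((m × m) ⊕ ((m × m) ⊕ ((m × m) ⊕ (m × m)))) k :=
  let a : Matrix m m (MvPolynomial ((m × m) ⊕ ((m × m) ⊕ ((m × m) ⊕ (m × m)))) k) :=
    .of fun i j => MvPolynomial.X (.inl (i, j))
  let b : Matrix m m (MvPolynomial ((m × m) ⊕ ((m × m) ⊕ ((m × m) ⊕ (m × m)))) k) :=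
    .of fun i j => MvPolynomial.X (.inr (.inl (i, j)))
  let u : Matrix m m (MvPolynomial ((m × m) ⊕ ((m × m) ⊕ ((m × m) ⊕ (m × m)))) k) :=
    .of fun i j => MvPolynomial.X (.inr (.inr (.inl (i, j))))
  let v : Matrix m m (MvPolynomial ((m × m) ⊕ ((m × m) ⊕ ((m × m) ⊕ (m × m)))) k) :=
    .of fun i j => MvPolynomial.X (.inr (.inr (.inr (i, j))))
  ∑ p ∈ G, (p.eval₂ MvPolynomial.C (fun q => u q.1 q.2)) ^ 2 +
    ∑ p ∈ G, (p.eval₂ MvPolynomial.C (fun q => v q.1 q.2)) ^ 2 +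
    ∑ q : m × m, ((u * v - 1) q.1 q.2) ^ 2 + ∑ q : m × m, ((u * a * v - b) q.1 q.2) ^ 2

theorem eval₂_conjPoly (G : Finset (MvPolynomial (m × m) k)) {A : Type} [CommRing A] (f : k →+* A)
    (a b u v : Matrix m m A) :
    (conjPoly G).eval₂ f (Sum.elim (fun q => a q.1 q.2) (Sum.elim (fun q => b q.1 q.2)
      (Sum.elim (fun q => u q.1 q.2) (fun q => v q.1 q.2)))) =
    ∑ p ∈ G, (p.eval₂ f (fun q => u q.1 q.2)) ^ 2 +
    ∑ p ∈ G, (p.eval₂ f (fun q => v q.1 q.2)) ^ 2 +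
    ∑ q : m × m, ((u * v - 1) q.1 q.2) ^ 2 + ∑ q : m × m, ((u * a * v - b) q.1 q.2) ^ 2 := by
  have hC : ∀ w : (m × m) ⊕ ((m × m) ⊕ ((m × m) ⊕ (m × m))) → A,
      (MvPolynomial.eval₂Hom f w).comp MvPolynomial.C = f := fun w => by ext r; simp
  rw [← MvPolynomial.coe_eval₂Hom]
  simp only [conjPoly, map_add, map_sum, map_pow, Matrix.sub_apply, map_sub, Matrix.mul_apply,
    map_mul, Matrix.of_apply, MvPolynomial.eval₂Hom_X', Sum.elim_inl, Sum.elim_inr,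
    MvPolynomial.hom_eval₂, hC]
  congr! 5 with q hq
  simp only [Matrix.one_apply]
  split_ifs <;> simp

theorem conjPoly_eq_zero_of {G : Finset (MvPolynomial (m × m) k)} {A : Type} [CommRing A]
    {f : k →+* A} {a b u v : Matrix m m A} (hu : IsZero G f u) (hv : IsZero G f v)
    (huv : u * v = 1) (h : u * a * v = b) :
    Rel (conjPoly G) f (fun q => a q.1 q.2) (fun q => b q.1 q.2) := by
  refine ⟨Sum.elim (fun q => u q.1 q.2) (fun q => v q.1 q.2), ?_⟩
  rw [eval₂_conjPoly, huv, h, Finset.sum_eq_zero fun p hp => by rw [hu p hp]; ring,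
    Finset.sum_eq_zero fun p hp => by rw [hv p hp]; ring]
  simp

theorem rel_conjPoly_iff {G : Finset (MvPolynomial (m × m) k)} {A : Type} [Field A] [IsRealClosed A]
    {f : k →+* A} {a b : m × m → A} :
    Rel (conjPoly G) f a b ↔ ∃ u v : Matrix m m A, IsZero G f u ∧ IsZero G f v ∧ u * v = 1 ∧
      u * (.of fun i j => a (i, j)) * v = .of fun i j => b (i, j) := by
  constructor
  · rintro ⟨w, hw⟩
    let _ := linearOrderOfRealClosed A
    have := isStrictOrderedRing_of_realClosed A
    have e := eval₂_conjPoly G f (.of fun i j => a (i, j)) (.of fun i j => b (i, j))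
      (.of fun i j => w (.inl (i, j))) (.of fun i j => w (.inr (i, j)))
    have e' : (conjPoly G).eval₂ f (Sum.elim a (Sum.elim b w)) = 0 := hw
    have ew : w = Sum.elim (fun q => w (.inl q)) (fun q => w (.inr q)) := by
      ext (q | q) <;> rfl
    rw [ew] at e'
    replace e := e'.symm.trans e
    have n1 : ∀ M : Matrix m m A, 0 ≤ ∑ p ∈ G, (p.eval₂ f (fun q => M q.1 q.2)) ^ 2 := fun M =>
      Finset.sum_nonneg fun _ _ => sq_nonneg _
    have n3 : ∀ M : Matrix m m A, 0 ≤ ∑ q : m × m, (M q.1 q.2) ^ 2 := fun M =>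
      Finset.sum_nonneg fun _ _ => sq_nonneg _
    have n4 : ∀ M : Matrix m m A, ∑ q : m × m, (M q.1 q.2) ^ 2 = 0 → M = 0 := by
      intro M hM
      rw [Finset.sum_eq_zero_iff_of_nonneg fun _ _ => sq_nonneg _] at hM
      ext i j
      exact pow_eq_zero_iff two_ne_zero |>.1 (hM (i, j) (Finset.mem_univ _))
    have e := e.symm
    rw [add_eq_zero_iff_of_nonneg (add_nonneg (add_nonneg (n1 _) (n1 _)) (n3 _)) (n3 _),
      add_eq_zero_iff_of_nonneg (add_nonneg (n1 _) (n1 _)) (n3 _),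
      add_eq_zero_iff_of_nonneg (n1 _) (n1 _)] at e
    obtain ⟨⟨⟨e1, e2⟩, e3⟩, e4⟩ := e
    refine ⟨_, _, fun p hp => ?_, fun p hp => ?_, sub_eq_zero.1 (n4 _ e3), sub_eq_zero.1 (n4 _ e4)⟩
    · rw [Finset.sum_eq_zero_iff_of_nonneg fun _ _ => sq_nonneg _] at e1
      exact pow_eq_zero_iff two_ne_zero |>.1 (e1 p hp)
    · rw [Finset.sum_eq_zero_iff_of_nonneg fun _ _ => sq_nonneg _] at e2
      exact pow_eq_zero_iff two_ne_zero |>.1 (e2 p hp)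
  · rintro ⟨u, v, hu, hv, huv, h⟩
    have := conjPoly_eq_zero_of (a := .of fun i j => a (i, j)) (b := .of fun i j => b (i, j))
      hu hv huv h
    exact this

/-- The equations of the involutions in the zero set of `T`. -/
def involutionEqs (T : Set (MvPolynomial (m × m) k)) : Set (MvPolynomial (m × m) k) :=
  T ∪ Set.range fun q : m × m => ∑ i, MvPolynomial.X (q.1, i) * MvPolynomial.X (i, q.2) -
    MvPolynomial.C ((1 : Matrix m m k) q.1 q.2)

theorem isZero_involutionEqs {T : Set (MvPolynomial (m × m) k)} {A : Type} [CommRing A]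
    {f : k →+* A} {M : Matrix m m A} :
    IsZero (involutionEqs T) f M ↔ IsZero T f M ∧ M * M = 1 := by
  have : ∀ q : m × m, (∑ i, MvPolynomial.X (q.1, i) * MvPolynomial.X (i, q.2) -
    MvPolynomial.C ((1 : Matrix m m k) q.1 q.2)).eval₂ f (fun q => M q.1 q.2) =
      (M * M - 1) q.1 q.2 := by
    intro q
    rw [MvPolynomial.eval₂_sub, MvPolynomial.eval₂_sum, Matrix.sub_apply, Matrix.mul_apply]
    simp only [MvPolynomial.eval₂_mul, MvPolynomial.eval₂_X, MvPolynomial.eval₂_C,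
      Matrix.one_apply]
    split_ifs <;> simp
  constructor
  · intro h
    refine ⟨fun p hp => h p (Or.inl hp), ?_⟩
    rw [← sub_eq_zero]
    ext i j
    exact (this (i, j)).symm.trans (h _ (Or.inr ⟨(i, j), rfl⟩))
  · rintro ⟨h1, h2⟩ p (hp | ⟨q, rfl⟩)
    · exact h1 p hp
    · rw [this, h2]
      simp

/-- Over a real closed field, every involution in the zero set of `T` is conjugate, under the
monoid `G`, to an involution over the ground field. -/
theorem exists_conj_involution [IsRealClosed k] {E : Type} [Field E] [IsRealClosed E] [Algebra k E]
    (G T : Finset (MvPolynomial (m × m) k))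
    (hone : ∀ (A : Type) [CommRing A] (f : k →+* A), IsZero G f (1 : Matrix m m A))
    (hmul : ∀ (A : Type) [CommRing A] (f : k →+* A) (M N : Matrix m m A), IsZero G f M →
      IsZero G f N → IsZero G f (M * N))
    (hTT : ∀ (A : Type) [CommRing A] (f : k →+* A) (M N : Matrix m m A), IsZero T f M →
      IsZero T f N → IsZero G f (M * N))
    (M : Matrix m m E) (hM : IsZero T (algebraMap k E) M) (hM2 : M * M = 1) :
    ∃ M₀ : Matrix m m k, IsZero T (RingHom.id k) M₀ ∧ ∃ u v : Matrix m m E,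
      IsZero G (algebraMap k E) u ∧ IsZero G (algebraMap k E) v ∧ u * v = 1 ∧
        u * M * v = M₀.map (algebraMap k E) := by
  have H : IsFormallyOpenRel (involutionEqs (T : Set (MvPolynomial (m × m) k))) (conjPoly G) := by
    constructor
    · intro R _ _ f a ha
      rw [rel_conjPoly_iff]
      exact ⟨1, 1, hone R f, hone R f, one_mul _, by rw [one_mul, mul_one]⟩
    · intro R _ _ f a b ha hb h
      rw [rel_conjPoly_iff] at h ⊢
      obtain ⟨u, v, hu, hv, huv, h⟩ := h
      have hvu := mul_eq_one_comm.1 huv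
      refine ⟨v, u, hv, hu, hvu, ?_⟩
      rw [← h]
      calc _ = (v * u) * (Matrix.of fun i j => a (i, j)) * (v * u) := by noncomm_ring
        _ = _ := by rw [hvu, one_mul, mul_one]
    · intro R _ _ f a b c ha hb hc h h'
      rw [rel_conjPoly_iff] at h h' ⊢
      obtain ⟨u, v, hu, hv, huv, h⟩ := h
      obtain ⟨u', v', hu', hv', huv', h'⟩ := h'
      refine ⟨u' * u, v * v', hmul R f _ _ hu' hu, hmul R f _ _ hv hv', ?_, ?_⟩
      · rw [mul_assoc, ← mul_assoc u, huv, one_mul, huv']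
      · rw [← h', ← h]
        noncomm_ring
    · intro R _ _ f a ha
      have : CharZero R := by
        let _ := linearOrderOfRealClosed R
        have := isStrictOrderedRing_of_realClosed R
        infer_instance
      let f' : k →+* PowerSeries R := PowerSeries.C.comp f
      let j : Matrix m m (PowerSeries R) := .of fun i l => a (i, l)
      let j₀ : Matrix m m (PowerSeries R) := j.map (PowerSeries.C.comp PowerSeries.constantCoeff)
      have hj : IsZero (involutionEqs (T : Set (MvPolynomial (m × m) k))) f' j := ha
      have hj₀ : IsZero (involutionEqs (T : Set (MvPolynomial (m × m) k))) f' j₀ :=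
        hj.map _ (by ext r; simp [f'])
      obtain ⟨hjT, hj2⟩ := isZero_involutionEqs.1 hj
      obtain ⟨hj₀T, hj₀2⟩ := isZero_involutionEqs.1 hj₀
      let r := j * j₀
      let s := j₀ * j
      have hrs : r * s = 1 := by
        simp only [r, s]
        rw [mul_assoc, ← mul_assoc j₀, hj₀2, one_mul, hj2]
      have hr : IsZero G f' r := hTT _ f' _ _ hjT hj₀T
      have hs : IsZero G f' s := hTT _ f' _ _ hj₀T hjT
      have hpow : ∀ N, IsZero G f' (r ^ N) := by
        intro N
        induction N with
        | zero => rw [pow_zero]; exact hone _ f'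
        | succ N ih => rw [pow_succ]; exact hmul _ f' _ _ ih hr
      have hr1 : ∀ x y, PowerSeries.constantCoeff (r x y) = (1 : Matrix m m R) x y := by
        intro x y
        have h1 : (r.map PowerSeries.constantCoeff) = 1 := by
          have h2 : j₀.map PowerSeries.constantCoeff = j.map PowerSeries.constantCoeff := by
            ext x y; simp [j₀]
          simp only [r]
          rw [Matrix.map_mul, h2, ← Matrix.map_mul, hj2]
          exact Matrix.map_one _ (map_zero _) (map_one _)
        exact congrFun (congrFun h1 x) y
      obtain ⟨u, hu, hu1, hall⟩ := exists_half_power hr1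
      have huG : IsZero G f' u := by
        intro p hp
        have := hall (p.map f') fun N => by
          rw [MvPolynomial.eval_map]; exact hpow N p hp
        rwa [MvPolynomial.eval_map] at this
      have huj : u * j₀ * u = j₀ := by
        have hrj : ∀ N, r ^ N * j₀ * r ^ N = j₀ := by
          intro N
          induction N with
          | zero => simp
          | succ N ih =>
            have : r * j₀ * r = j₀ := by
              simp only [r]
              rw [mul_assoc j j₀ j₀, hj₀2, mul_one, ← mul_assoc, hj2, one_mul]
            calc r ^ (N + 1) * j₀ * r ^ (N + 1) = r ^ N * (r * j₀ * r) * r ^ N := by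
                  have h1 : r ^ (N + 1) = r ^ N * r := pow_succ r N
                  have h2 : r ^ (N + 1) = r * r ^ N := pow_succ' r N
                  conv_lhs => enter [2]; rw [h2]
                  rw [h1]
                  simp only [mul_assoc]
              _ = _ := by rw [this, ih]
        ext1 x y
        let Y : Matrix m m (MvPolynomial (m × m) (PowerSeries R)) :=
          .of fun i l => MvPolynomial.X (i, l)
        let Z : Matrix m m (MvPolynomial (m × m) (PowerSeries R)) :=
          j₀.map (MvPolynomial.C : _ →+* MvPolynomial (m × m) (PowerSeries R))
        let F : MvPolynomial (m × m) (PowerSeries R) := (Y * Z * Y - Z) x y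
        have hF : ∀ w : Matrix m m (PowerSeries R),
            MvPolynomial.eval (fun p => w p.1 p.2) F = (w * j₀ * w - j₀) x y := by
          intro w
          simp [F, Y, Z, Matrix.mul_apply, Matrix.sub_apply]
        have := hall F fun N => by rw [hF, hrj N, sub_self]; rfl
        rw [hF] at this
        exact sub_eq_zero.1 this
      have hus : u * (u * s) = 1 := by rw [← mul_assoc, hu, hrs]
      have hus' := mul_eq_one_comm.1 hus
      have hconj : (u * s) * j * u = j₀ := by
        have h1 : j = u * j₀ * (u * s) := by
          calc j = r * j₀ := by simp only [r]; rw [mul_assoc, hj₀2, mul_one]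
            _ = u * (u * j₀ * u) * (u * s) := by
              rw [← hu]
              calc u * u * j₀ = u * (u * j₀) * (u * (u * s)) := by rw [hus, mul_one, mul_assoc]
                _ = _ := by noncomm_ring
            _ = _ := by rw [huj]
        rw [h1]
        calc _ = ((u * s) * u) * j₀ * ((u * s) * u) := by noncomm_ring
          _ = _ := by rw [hus', one_mul, mul_one]
      have hrel := conjPoly_eq_zero_of (hmul _ f' _ _ huG hs) huG hus' hconj
      exact hrel
  have hP : (involutionEqs (T : Set (MvPolynomial (m × m) k))).Finite :=
    T.finite_toSet.union (Set.finite_range _)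
  obtain ⟨b, hb, hrel⟩ := H.exists_rel hP (fun q => M q.1 q.2) (isZero_involutionEqs.2 ⟨hM, hM2⟩)
  rw [rel_conjPoly_iff] at hrel
  obtain ⟨u, v, hu, hv, huv, h⟩ := hrel
  have hvu := mul_eq_one_comm.1 huv
  have hb : IsZero (involutionEqs (T : Set (MvPolynomial (m × m) k))) (RingHom.id k)
    (.of fun i j => b (i, j)) := hb
  refine ⟨.of fun i j => b (i, j), (isZero_involutionEqs.1 hb).1, v, u, hv, hu, hvu, ?_⟩
  have hM : M = .of fun i j => M i j := rfl
  have h' : u * ((Matrix.of fun i j => b (i, j)).map (algebraMap k E)) * v = M := h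
  rw [← h']
  calc _ = (v * u) * ((Matrix.of fun i j => b (i, j)).map (algebraMap k E)) * (v * u) := by
        noncomm_ring
    _ = _ := by rw [hvu, one_mul, mul_one]

end MatrixSets

/-- Derivations over the integers. -/
abbrev ZDer (R : Type) [CommRing R] : Type := Derivation ℤ R R

theorem exists_zDer {R : Type} [CommRing R] (f : R →+ R)
    (hf : ∀ a b, f (a * b) = a * f b + b * f a) : ∃ δ : ZDer R, ∀ a, δ a = f a :=
  ⟨Derivation.mk' f.toIntLinearMap hf, fun _ => rfl⟩

theorem exists_derivation_mvPolynomial {C σ : Type} [CommRing C] (D : ZDer C)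
    (y : σ → MvPolynomial σ C) : ∃ δ : ZDer (MvPolynomial σ C),
      (∀ a, δ (MvPolynomial.C a) = MvPolynomial.C (D a)) ∧ ∀ q, δ (MvPolynomial.X q) = y q := by
  let f : C →+* TrivSqZeroExt (MvPolynomial σ C) (MvPolynomial σ C) :=
    { toFun := fun a => TrivSqZeroExt.inl (MvPolynomial.C a) +
        TrivSqZeroExt.inr (MvPolynomial.C (D a))
      map_zero' := by simp
      map_one' := by simp
      map_add' := fun a b => by
        ext1 <;> simp
      map_mul' := fun a b => by
        ext1
        · simp
        · simp only [Derivation.leibniz, TrivSqZeroExt.snd_add, TrivSqZeroExt.snd_inl,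
            TrivSqZeroExt.snd_inr, TrivSqZeroExt.snd_mul, TrivSqZeroExt.fst_add,
            TrivSqZeroExt.fst_inl, TrivSqZeroExt.fst_inr, smul_eq_mul, map_add, map_mul,
            MulOpposite.smul_eq_mul_unop, MulOpposite.unop_op]
          ring }
  let h : MvPolynomial σ C →+* TrivSqZeroExt (MvPolynomial σ C) (MvPolynomial σ C) :=
    MvPolynomial.eval₂Hom f
      (fun q => TrivSqZeroExt.inl (MvPolynomial.X q) + TrivSqZeroExt.inr (y q))
  have hC : ∀ a, h (MvPolynomial.C a) = TrivSqZeroExt.inl (MvPolynomial.C a) +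
      TrivSqZeroExt.inr (MvPolynomial.C (D a)) := fun a => MvPolynomial.eval₂_C ..
  have hX : ∀ q, h (MvPolynomial.X q) = TrivSqZeroExt.inl (MvPolynomial.X q) +
      TrivSqZeroExt.inr (y q) := fun q => MvPolynomial.eval₂_X ..
  have hf : ∀ p, (h p).fst = p := by
    intro p
    induction p using MvPolynomial.induction_on with
    | C a => rw [hC]; simp
    | add p q hp hq => rw [map_add, TrivSqZeroExt.fst_add, hp, hq]
    | mul_X p q hp => rw [map_mul, TrivSqZeroExt.fst_mul, hp, hX]; simp
  obtain ⟨δ, hδ⟩ := exists_zDer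
    { toFun := fun p => (h p).snd
      map_zero' := by rw [map_zero, TrivSqZeroExt.snd_zero]
      map_add' := fun a b => by rw [map_add, TrivSqZeroExt.snd_add] } fun a b => by
        change (h (a * b)).snd = a * (h b).snd + b * (h a).snd
        rw [map_mul, TrivSqZeroExt.snd_mul, hf, hf]
        simp [mul_comm]
  refine ⟨δ, fun a => ?_, fun q => ?_⟩
  · rw [hδ]
    change (h _).snd = _
    rw [hC, TrivSqZeroExt.snd_add, TrivSqZeroExt.snd_inl, TrivSqZeroExt.snd_inr, zero_add]
  · rw [hδ]
    change (h _).snd = _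
    rw [hX, TrivSqZeroExt.snd_add, TrivSqZeroExt.snd_inl, TrivSqZeroExt.snd_inr, zero_add]

theorem constantCoeff_map' {B C : Type} [CommRing B] [CommRing C] (g : C →+* B)
    (f : PowerSeries C) :
    PowerSeries.constantCoeff (PowerSeries.map g f) = g (PowerSeries.constantCoeff f) := by
  rw [← PowerSeries.coeff_zero_eq_constantCoeff_apply, PowerSeries.coeff_map,
    PowerSeries.coeff_zero_eq_constantCoeff_apply]

section Solutions
variable {C n : Type} [Field C] [CharZero C] [Fintype n] [DecidableEq n]

theorem exists_linDer (D : ZDer C) (A : Matrix n n C) : ∃ δ : ZDer (MvPolynomial (n × n) C),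
    (∀ a, δ (MvPolynomial.C a) = MvPolynomial.C (D a)) ∧
      ∀ q, δ (MvPolynomial.X q) = ∑ l, MvPolynomial.C (A q.1 l) * MvPolynomial.X (l, q.2) :=
  exists_derivation_mvPolynomial D _

/-- The derivation of `C[X_{ij}]` extending `D` with `X' = A X`. -/
noncomputable def linDer (D : ZDer C) (A : Matrix n n C) : ZDer (MvPolynomial (n × n) C) :=
  (exists_linDer D A).choose

theorem linDer_C (D : ZDer C) (A : Matrix n n C) (a : C) :
    linDer D A (MvPolynomial.C a) = MvPolynomial.C (D a) :=
  (exists_linDer D A).choose_spec.1 a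

theorem linDer_X (D : ZDer C) (A : Matrix n n C) (q : n × n) :
    linDer D A (MvPolynomial.X q) = ∑ l, MvPolynomial.C (A q.1 l) * MvPolynomial.X (l, q.2) :=
  (exists_linDer D A).choose_spec.2 q

/-- `F` is a power series solution of `y' = A y`, where scalars are expanded by Taylor series. -/
def IsSol (D : ZDer C) (A : Matrix n n C) (F : Matrix n n (PowerSeries C)) : Prop :=
  F.map (PowerSeries.derivative C) = A.map (taylorHom D) * F

/-- Evaluation of differential polynomials at a matrix of power series. -/
noncomputable def evSol (D : ZDer C) (F : Matrix n n (PowerSeries C)) :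
    MvPolynomial (n × n) C →+* PowerSeries C :=
  MvPolynomial.eval₂Hom (taylorHom D) fun q => F q.1 q.2

theorem evSol_C (D : ZDer C) (F : Matrix n n (PowerSeries C)) (a : C) :
    evSol D F (MvPolynomial.C a) = taylorHom D a := by simp [evSol]

theorem evSol_X (D : ZDer C) (F : Matrix n n (PowerSeries C)) (q : n × n) :
    evSol D F (MvPolynomial.X q) = F q.1 q.2 := by simp [evSol]

theorem derivative_evSol {D : ZDer C} {A : Matrix n n C}
    {F : Matrix n n (PowerSeries C)} (hF : IsSol D A F) (p : MvPolynomial (n × n) C) :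
    PowerSeries.derivative C (evSol D F p) = evSol D F (linDer D A p) := by
  induction p using MvPolynomial.induction_on with
  | C a => rw [evSol_C, linDer_C, evSol_C, derivative_taylorHom]
  | add p q hp hq => rw [map_add, map_add, hp, hq, map_add, map_add]
  | mul_X p q hp =>
    rw [map_mul, Derivation.leibniz, Derivation.leibniz, hp, evSol_X, linDer_X, map_add]
    simp only [smul_eq_mul, map_mul, map_sum, evSol_C, evSol_X]
    have := congrFun (congrFun hF q.1) q.2
    rw [Matrix.map_apply, Matrix.mul_apply] at this
    rw [this]
    simp

theorem constantCoeff_evSol (D : ZDer C) (F : Matrix n n (PowerSeries C))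
    (p : MvPolynomial (n × n) C) : PowerSeries.constantCoeff (evSol D F p) =
      MvPolynomial.eval (fun q => (F.map PowerSeries.constantCoeff) q.1 q.2) p := by
  rw [evSol, MvPolynomial.coe_eval₂Hom, MvPolynomial.hom_eval₂, MvPolynomial.eval]
  congr 1
  ext a
  simp [constantCoeff_taylorHom]

theorem IsSol.ext {D : ZDer C} {A : Matrix n n C} {F G : Matrix n n (PowerSeries C)}
    (hF : IsSol D A F) (hG : IsSol D A G)
    (h : F.map PowerSeries.constantCoeff = G.map PowerSeries.constantCoeff) : F = G := by
  have := powerSeries_hom_ext (linDer D A) (f := (evSol D F).toAddMonoidHom)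
    (g := (evSol D G).toAddMonoidHom) (derivative_evSol hF) (derivative_evSol hG) fun p => by
      change PowerSeries.constantCoeff (evSol D F p) = PowerSeries.constantCoeff (evSol D G p)
      rw [constantCoeff_evSol, constantCoeff_evSol, h]
  ext1 i j
  rw [← evSol_X D F (i, j), ← evSol_X D G (i, j)]
  exact DFunLike.congr_fun this _

theorem exists_isSol (D : ZDer C) (A z : Matrix n n C) :
    ∃ F, IsSol D A F ∧ F.map PowerSeries.constantCoeff = z := by
  let e : MvPolynomial (n × n) C →+* C := MvPolynomial.eval fun q => z q.1 q.2
  let f : MvPolynomial (n × n) C →+* PowerSeries C :=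
    (PowerSeries.map e).comp (taylorHom (linDer D A))
  have hd : ∀ p, PowerSeries.derivative C (f p) = f (linDer D A p) := by
    intro p
    simp only [f, RingHom.comp_apply]
    rw [← derivative_taylorHom]
    ext m
    simp [PowerSeries.coeff_derivative]
  have hfC : ∀ a, f (MvPolynomial.C a) = taylorHom D a := by
    have := powerSeries_hom_ext D (f := (f.comp MvPolynomial.C).toAddMonoidHom)
      (g := (taylorHom D).toAddMonoidHom) (fun a => ?_) (derivative_taylorHom D) fun a => ?_
    · exact fun a => DFunLike.congr_fun this a
    · change PowerSeries.derivative C (f (MvPolynomial.C a)) = f (MvPolynomial.C (D a))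
      rw [hd, linDer_C]
    · change PowerSeries.constantCoeff (f (MvPolynomial.C a)) =
        PowerSeries.constantCoeff (taylorHom D a)
      simp only [f, RingHom.comp_apply]
      rw [constantCoeff_map', constantCoeff_taylorHom, constantCoeff_taylorHom]
      simp [e]
  refine ⟨.of fun i j => f (MvPolynomial.X (i, j)), ?_, ?_⟩
  · ext1 i j
    rw [Matrix.map_apply, Matrix.of_apply, hd, linDer_X, Matrix.mul_apply]
    simp [hfC]
  · ext i j
    simp only [Matrix.map_apply, Matrix.of_apply, f, RingHom.comp_apply]
    rw [constantCoeff_map', constantCoeff_taylorHom]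
    simp [e]

/-- The solution of `y' = A y` with given initial value. -/
noncomputable def sol (D : ZDer C) (A z : Matrix n n C) : Matrix n n (PowerSeries C) :=
  (exists_isSol D A z).choose

theorem isSol_sol (D : ZDer C) (A z : Matrix n n C) : IsSol D A (sol D A z) :=
  (exists_isSol D A z).choose_spec.1

theorem constantCoeff_sol (D : ZDer C) (A z : Matrix n n C) :
    (sol D A z).map PowerSeries.constantCoeff = z :=
  (exists_isSol D A z).choose_spec.2

theorem sol_mul (D : ZDer C) (A z v : Matrix n n C) :
    sol D A (z * v) = sol D A z * v.map PowerSeries.C := by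
  refine (isSol_sol D A _).ext (A := A) ?_ ?_
  · have h := isSol_sol D A z
    ext1 i j
    rw [Matrix.map_apply, ← mul_assoc, ← h]
    simp [Matrix.mul_apply, PowerSeries.derivative_C, mul_comm]
  · rw [constantCoeff_sol, Matrix.map_mul, constantCoeff_sol]
    congr 1

theorem derivative_map {B : Type} [Field B] (g : C →+* B) (f : PowerSeries C) :
    PowerSeries.derivative B (PowerSeries.map g f) =
      PowerSeries.map g (PowerSeries.derivative C f) := by
  ext m
  simp [PowerSeries.coeff_derivative]

theorem map_taylorHom {B : Type} [Field B] [CharZero B] {D : ZDer C}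
    {D' : ZDer B} (g : C →+* B) (hg : ∀ a, g (D a) = D' (g a)) (a : C) :
    PowerSeries.map g (taylorHom D a) = taylorHom D' (g a) := by
  have := powerSeries_hom_ext D (f := ((PowerSeries.map g).comp (taylorHom D)).toAddMonoidHom)
    (g := ((taylorHom D').comp g).toAddMonoidHom) (fun a => ?_) (fun a => ?_) (fun a => ?_)
  · exact DFunLike.congr_fun this a
  · change PowerSeries.derivative B (PowerSeries.map g (taylorHom D a)) =
      PowerSeries.map g (taylorHom D (D a))
    rw [derivative_map, derivative_taylorHom]
  · change PowerSeries.derivative B (taylorHom D' (g a)) = taylorHom D' (g (D a))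
    rw [derivative_taylorHom, hg]
  · change PowerSeries.constantCoeff (PowerSeries.map g (taylorHom D a)) =
      PowerSeries.constantCoeff (taylorHom D' (g a))
    rw [constantCoeff_taylorHom, constantCoeff_map', constantCoeff_taylorHom]

theorem sol_map {B : Type} [Field B] [CharZero B] {D : ZDer C}
    {D' : ZDer B} (g : C →+* B) (hg : ∀ a, g (D a) = D' (g a)) (A z : Matrix n n C) :
    (sol D A z).map (PowerSeries.map g) = sol D' (A.map g) (z.map g) := by
  refine IsSol.ext (D := D') (A := A.map g) ?_ (isSol_sol _ _ _) ?_
  · have h := isSol_sol D A z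
    ext1 i j
    have h := congrArg (PowerSeries.map g) (congrFun (congrFun h i) j)
    rw [Matrix.map_apply, Matrix.map_apply, derivative_map]
    rw [Matrix.map_apply] at h
    rw [h]
    simp [Matrix.mul_apply, map_taylorHom g hg]
  · rw [constantCoeff_sol]
    conv_rhs => rw [← constantCoeff_sol D A z]
    ext i j
    simp only [Matrix.map_apply]
    rw [constantCoeff_map']

end Solutions

/-- Two power series with the same logarithmic derivative are proportional. -/
theorem exists_eq_C_mul {C : Type} [Field C] [CharZero C] {a b : PowerSeries C} (hb : b ≠ 0)
    (h : PowerSeries.derivative C a * b = a * PowerSeries.derivative C b) :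
    ∃ γ, a = PowerSeries.C γ * b := by
  have hX : ∀ (i : ℕ) (u : PowerSeries C), PowerSeries.X * PowerSeries.derivative C
      (PowerSeries.X ^ i * u) = PowerSeries.X ^ i * (PowerSeries.C (i : C) * u +
        PowerSeries.X * PowerSeries.derivative C u) := by
    intro i u
    rw [Derivation.leibniz, Derivation.leibniz_pow, PowerSeries.derivative_X]
    rcases i with _ | i
    · simp
    · simp only [smul_eq_mul, nsmul_eq_mul, Nat.add_sub_cancel, map_natCast, mul_one]
      ring
  have key : ∀ (i j : ℕ) (u v : PowerSeries C), PowerSeries.constantCoeff u ≠ 0 →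
      PowerSeries.constantCoeff v ≠ 0 →
      PowerSeries.derivative C (PowerSeries.X ^ i * u) * (PowerSeries.X ^ j * v) =
        PowerSeries.X ^ i * u * PowerSeries.derivative C (PowerSeries.X ^ j * v) → i = j := by
    intro i j u v hu hv h
    have h1 : (PowerSeries.X : PowerSeries C) ^ (i + j) *
        ((PowerSeries.C (i : C) * u + PowerSeries.X * PowerSeries.derivative C u) * v) =
        PowerSeries.X ^ (i + j) *
        (u * (PowerSeries.C (j : C) * v + PowerSeries.X * PowerSeries.derivative C v)) := by
      rw [pow_add]
      linear_combination PowerSeries.X * h - (PowerSeries.X ^ j * v) * hX i u +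
        (PowerSeries.X ^ i * u) * hX j v
    have h2 := congrArg PowerSeries.constantCoeff
      (mul_left_cancel₀ (pow_ne_zero _ PowerSeries.X_ne_zero) h1)
    simp only [map_mul, map_add, PowerSeries.constantCoeff_C, PowerSeries.constantCoeff_X,
      zero_mul, add_zero] at h2
    have h3 : ((i : C) - j) * (PowerSeries.constantCoeff u * PowerSeries.constantCoeff v) = 0 := by
      linear_combination h2
    have h4 := (mul_eq_zero.1 h3).resolve_right (mul_ne_zero hu hv)
    exact_mod_cast sub_eq_zero.1 h4
  have hdec : ∀ a : PowerSeries C, a ≠ 0 → ∃ (i : ℕ) (u : PowerSeries C),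
      PowerSeries.constantCoeff u ≠ 0 ∧ a = PowerSeries.X ^ i * u := fun a ha =>
    ⟨_, a.divXPowOrder, PowerSeries.constantCoeff_divXPowOrder_eq_zero_iff.not.2 ha,
      PowerSeries.X_pow_order_mul_divXPowOrder.symm⟩
  by_cases ha : a = 0
  · exact ⟨0, by simp [ha]⟩
  obtain ⟨j, v, hv, rfl⟩ := hdec b hb
  obtain ⟨i, u, hu, rfl⟩ := hdec a ha
  obtain rfl := key i j u v hu hv h
  refine ⟨PowerSeries.constantCoeff u / PowerSeries.constantCoeff v, ?_⟩
  rw [← sub_eq_zero]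
  set γ := PowerSeries.constantCoeff u / PowerSeries.constantCoeff v with hγ
  have hd : PowerSeries.X ^ i * u - PowerSeries.C γ * (PowerSeries.X ^ i * v) =
      PowerSeries.X ^ i * (u - PowerSeries.C γ * v) := by ring
  by_contra hc
  rw [hd] at hc
  obtain ⟨l, w, hw, hlw⟩ := hdec _ (right_ne_zero_of_mul hc)
  have h5 := key (i + l) i w v hw hv (by
    rw [pow_add, mul_assoc, ← hlw, ← hd, map_sub, Derivation.leibniz (PowerSeries.derivative C)
      (PowerSeries.C γ), PowerSeries.derivative_C]
    simp only [smul_eq_mul, mul_zero, add_zero]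
    linear_combination h)
  have h6 : l = 0 := by omega
  subst h6
  have := congrArg PowerSeries.constantCoeff hlw
  rw [pow_zero, one_mul, map_sub, map_mul, PowerSeries.constantCoeff_C, hγ,
    div_mul_cancel₀ _ hv, sub_self] at this
  exact hw this.symm

/-- An element `c` of a finitely generated domain such that `c - g` is a unit for infinitely many
scalars `g` is algebraic. -/
theorem isAlgebraic_of_isUnit_sub {C S : Type} [Field C] [CommRing S] [IsDomain S] [Algebra C S]
    [Algebra.FiniteType C S] (c : S) {Γ : Set C} (hΓ : Γ.Infinite)
    (h : ∀ g ∈ Γ, IsUnit (c - algebraMap C S g)) : IsAlgebraic C c := by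
  by_contra hc
  let f : C[X] →+* S := (aeval c : C[X] →ₐ[C] S).toRingHom
  have hf : Function.Injective f := transcendental_iff_injective.1 hc
  have hfC : f.comp Polynomial.C = algebraMap C S := by
    ext a
    simp [f]
  have hfin : f.FiniteType := by
    refine RingHom.FiniteType.of_comp_finiteType (f := Polynomial.C) ?_
    rw [hfC]
    exact RingHom.finiteType_algebraMap.2 inferInstance
  obtain ⟨T, hT⟩ := PrimeSpectrum.exists_constructibleSetData_iff.2
    (PrimeSpectrum.isConstructible_range_comap (RingHom.FinitePresentation.of_finiteType.1 hfin))
  let o : PrimeSpectrum C[X] := ⟨⊥, Ideal.isPrime_bot⟩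
  have ho : o ∈ T.toSet := by
    rw [hT]
    refine ⟨⟨⊥, Ideal.isPrime_bot⟩, ?_⟩
    ext1
    simp only [PrimeSpectrum.comap_asIdeal, o]
    exact (RingHom.injective_iff_ker_eq_bot f).1 hf
  simp only [PrimeSpectrum.ConstructibleSetData.toSet, Set.mem_iUnion] at ho
  obtain ⟨B, hB, ho⟩ := ho
  have h0 : B.f ≠ 0 := fun h0 => ho.2 (by simp [PrimeSpectrum.mem_zeroLocus, h0])
  obtain ⟨g, hgΓ, hg⟩ : ∃ g ∈ Γ, B.f.eval g ≠ 0 := by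
    by_contra! hall
    exact h0 (Polynomial.eq_zero_of_infinite_isRoot _ (hΓ.mono hall))
  have hprime : (Ideal.span {X - Polynomial.C g}).IsPrime :=
    (Ideal.span_singleton_prime (X_sub_C_ne_zero g)).2 (prime_X_sub_C g)
  have hx : (⟨_, hprime⟩ : PrimeSpectrum C[X]) ∈ T.toSet := by
    simp only [PrimeSpectrum.ConstructibleSetData.toSet, Set.mem_iUnion]
    refine ⟨B, hB, ?_, ?_⟩
    · rw [PrimeSpectrum.mem_zeroLocus]
      rintro _ ⟨i, rfl⟩
      have : B.g i ∈ o.asIdeal := ho.1 ⟨i, rfl⟩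
      rw [show B.g i = 0 from this]
      exact zero_mem _
    · rw [PrimeSpectrum.mem_zeroLocus, Set.singleton_subset_iff]
      intro hmem
      rw [SetLike.mem_coe, Ideal.mem_span_singleton, dvd_iff_isRoot] at hmem
      exact hg hmem
  rw [hT] at hx
  obtain ⟨y, hy⟩ := hx
  have hmem : X - Polynomial.C g ∈ (PrimeSpectrum.comap f y).asIdeal := by
    rw [hy]
    exact Ideal.mem_span_singleton_self _
  have hmem' : c - algebraMap C S g ∈ y.asIdeal := by
    have : f (X - Polynomial.C g) ∈ y.asIdeal := hmem
    simpa [f] using this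
  exact y.isPrime.ne_top (Ideal.eq_top_of_isUnit_mem _ hmem' (h g hgΓ))

section MaxPt
variable {C n : Type} [Field C] [CharZero C] [Fintype n] [DecidableEq n]

/-- The initial value `z` is invertible and its solution satisfies a maximal set of algebraic
relations. -/
def IsMaxPt (D : ZDer C) (A z : Matrix n n C) : Prop :=
  IsUnit z.det ∧ ∀ z' : Matrix n n C, IsUnit z'.det →
    RingHom.ker (evSol D (sol D A z)) ≤ RingHom.ker (evSol D (sol D A z')) →
      RingHom.ker (evSol D (sol D A z')) ≤ RingHom.ker (evSol D (sol D A z))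

theorem exists_isMaxPt (D : ZDer C) (A : Matrix n n C) : ∃ z, IsMaxPt D A z := by
  have hne : {I : Ideal (MvPolynomial (n × n) C) | ∃ z : Matrix n n C, IsUnit z.det ∧
      I = RingHom.ker (evSol D (sol D A z))}.Nonempty := ⟨_, 1, by simp, rfl⟩
  obtain ⟨I, ⟨z, hz, rfl⟩, hmax⟩ := WellFounded.has_min
    (wellFounded_gt : WellFounded ((· > ·) : Ideal (MvPolynomial (n × n) C) → _ → Prop)) _ hne
  refine ⟨z, hz, fun z' hz' hle => ?_⟩
  by_contra hcon
  exact hmax _ ⟨z', hz', rfl⟩ (lt_of_le_not_ge hle hcon)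

theorem eval_det_X (z : Matrix n n C) :
    MvPolynomial.eval (fun q : n × n => z q.1 q.2) (Matrix.mvPolynomialX n n C).det = z.det :=
  Matrix.eval_det_mvPolynomialX n C fun q => z q.1 q.2

theorem constantCoeff_evSol_sol (D : ZDer C) (A z : Matrix n n C) (p : MvPolynomial (n × n) C) :
    PowerSeries.constantCoeff (evSol D (sol D A z) p) =
      MvPolynomial.eval (fun q => z q.1 q.2) p := by
  rw [constantCoeff_evSol, constantCoeff_sol]

theorem mem_ker_evSol_of_differential {D : ZDer C} {A z : Matrix n n C}
    {I : Ideal (MvPolynomial (n × n) C)} (hI : ∀ p ∈ I, linDer D A p ∈ I)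
    (hz : ∀ p ∈ I, MvPolynomial.eval (fun q => z q.1 q.2) p = 0) {p : MvPolynomial (n × n) C}
    (hp : p ∈ I) : evSol D (sol D A z) p = 0 := by
  have hiter : ∀ m, (linDer D A)^[m] p ∈ I := by
    intro m
    induction m with
    | zero => exact hp
    | succ m ih => rw [Function.iterate_succ_apply']; exact hI _ ih
  refine powerSeries_ext_derivative (f := fun m => evSol D (sol D A z) ((linDer D A)^[m] p))
    (g := fun _ => 0) (fun m => ?_) (fun m => map_zero _) (fun m => ?_) 0
  · rw [derivative_evSol (isSol_sol D A z), Function.iterate_succ_apply']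
  · rw [constantCoeff_evSol_sol, hz _ (hiter m), map_zero]

theorem IsMaxPt.exists_det_pow_mem [IsAlgClosed C] {D : ZDer C} {A z : Matrix n n C}
    (hz : IsMaxPt D A z) {I : Ideal (MvPolynomial (n × n) C)}
    (hI : ∀ p ∈ I, linDer D A p ∈ I) (hle : RingHom.ker (evSol D (sol D A z)) ≤ I)
    {p₀ : MvPolynomial (n × n) C} (h₀ : p₀ ∈ I) (h₀' : evSol D (sol D A z) p₀ ≠ 0) :
    ∃ e : ℕ, (Matrix.mvPolynomialX n n C).det ^ e ∈ I := by
  by_contra hcon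
  have hrad : (Matrix.mvPolynomialX n n C).det ∉ I.radical := hcon
  rw [← MvPolynomial.vanishingIdeal_zeroLocus_eq_radical (K := C),
    MvPolynomial.mem_vanishingIdeal_iff] at hrad
  push Not at hrad
  obtain ⟨x, hx, hdet⟩ := hrad
  let z' : Matrix n n C := .of fun i j => x (i, j)
  have hz'I : ∀ p ∈ I, MvPolynomial.eval (fun q => z' q.1 q.2) p = 0 := by
    intro p hp
    have := MvPolynomial.mem_zeroLocus_iff.1 hx p hp
    rwa [MvPolynomial.aeval_eq_eval] at this
  have hz'det : IsUnit z'.det := by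
    rw [isUnit_iff_ne_zero, ← eval_det_X]
    rwa [MvPolynomial.aeval_eq_eval] at hdet
  have hIz' : ∀ p ∈ I, evSol D (sol D A z') p = 0 := fun p hp =>
    mem_ker_evSol_of_differential hI hz'I hp
  exact h₀' (hz.2 z' hz'det (fun p hp => hIz' p (hle hp)) (hIz' _ h₀))

/-- The ideal of denominators of a constant. -/
def denIdeal (D : ZDer C) (A z : Matrix n n C) (γ : C) : Ideal (MvPolynomial (n × n) C) where
  carrier := {b | ∃ b', PowerSeries.C γ * evSol D (sol D A z) b = evSol D (sol D A z) b'}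
  zero_mem' := ⟨0, by simp⟩
  add_mem' := by
    rintro a b ⟨a', ha⟩ ⟨b', hb⟩
    exact ⟨a' + b', by rw [map_add, map_add, mul_add, ha, hb]⟩
  smul_mem' := by
    rintro c a ⟨a', ha⟩
    exact ⟨c * a', by rw [smul_eq_mul, map_mul, map_mul, mul_left_comm, ha]⟩

/-- The ideal of numerators of a constant. -/
def numIdeal (D : ZDer C) (A z : Matrix n n C) (γ : C) : Ideal (MvPolynomial (n × n) C) where
  carrier := {b | ∃ b', evSol D (sol D A z) b = PowerSeries.C γ * evSol D (sol D A z) b'}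
  zero_mem' := ⟨0, by simp⟩
  add_mem' := by
    rintro a b ⟨a', ha⟩ ⟨b', hb⟩
    exact ⟨a' + b', by rw [map_add, map_add, mul_add, ha, hb]⟩
  smul_mem' := by
    rintro c a ⟨a', ha⟩
    exact ⟨c * a', by rw [smul_eq_mul, map_mul, map_mul, mul_left_comm, ha]⟩

theorem derivative_C_mul (γ : C) (f : PowerSeries C) :
    PowerSeries.derivative C (PowerSeries.C γ * f) =
      PowerSeries.C γ * PowerSeries.derivative C f := by
  rw [Derivation.leibniz, PowerSeries.derivative_C]
  simp

/-- The constants generated by a maximal solution are constants of the base field. -/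
theorem IsMaxPt.constant_of_eq [IsAlgClosed C] {D : ZDer C} {A z : Matrix n n C}
    (hz : IsMaxPt D A z) {γ : C} {p q : MvPolynomial (n × n) C}
    (h : evSol D (sol D A z) p = PowerSeries.C γ * evSol D (sol D A z) q)
    (hq : evSol D (sol D A z) q ≠ 0) : D γ = 0 := by
  set ev := evSol D (sol D A z) with hev
  have hder : ∀ p, PowerSeries.derivative C (ev p) = ev (linDer D A p) :=
    derivative_evSol (isSol_sol D A z)
  obtain ⟨e, p₁, hp₁⟩ := hz.exists_det_pow_mem (I := denIdeal D A z γ)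
    (by
      rintro p ⟨b, hb⟩
      exact ⟨linDer D A b, by rw [← hev, ← hder, ← hder, ← derivative_C_mul, hb]⟩)
    (fun p hp => ⟨0, by rw [show evSol D (sol D A z) p = 0 from hp]; simp⟩)
    (p₀ := q) ⟨p, h.symm⟩ hq
  rw [← hev] at hp₁
  set d := ev (Matrix.mvPolynomialX n n C).det with hd
  have hd0 : IsUnit d := by
    rw [PowerSeries.isUnit_iff_constantCoeff, hd, hev, constantCoeff_evSol_sol, eval_det_X]
    exact hz.1
  obtain ⟨d', hdd'⟩ := hd0.exists_right_inv
  let f : MvPolynomial (Option (n × n)) C →+* PowerSeries C :=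
    MvPolynomial.eval₂Hom (taylorHom D) (fun o => o.elim d' fun q => sol D A z q.1 q.2)
  have hfev : ∀ p, ∃ y, f y = ev p := by
    intro p
    refine ⟨MvPolynomial.rename some p, ?_⟩
    simp only [f, MvPolynomial.coe_eval₂Hom, MvPolynomial.eval₂_rename]
    rfl
  have hfd' : ∃ y, f y = d' := ⟨MvPolynomial.X none, by simp [f]⟩
  let S := f.range
  let _ : Algebra C S := (f.rangeRestrict.comp MvPolynomial.C).toAlgebra
  have hfin : Algebra.FiniteType C S := by
    have h1 : (f.rangeRestrict.comp MvPolynomial.C).FiniteType :=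
      (RingHom.FiniteType.of_surjective _ f.rangeRestrict_surjective).comp
        (RingHom.finiteType_algebraMap.2 (inferInstance :
          Algebra.FiniteType C (MvPolynomial (Option (n × n)) C)))
    exact h1
  have hcoe : ∀ g : C, ((algebraMap C S g : S) : PowerSeries C) = taylorHom D g := by
    intro g
    change f (MvPolynomial.C g) = _
    simp [f]
  have hd'mem : ∀ (p) (i : ℕ), ev p * d' ^ i ∈ S := by
    intro p i
    obtain ⟨y, hy⟩ := hfev p
    obtain ⟨w, hw⟩ := hfd'
    exact ⟨y * w ^ i, by rw [map_mul, map_pow, hy, hw]⟩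
  have hγ : PowerSeries.C γ ∈ S := by
    have : PowerSeries.C γ = ev p₁ * d' ^ e := by
      rw [← hp₁, map_pow, ← hd, mul_assoc, ← mul_pow, hdd', one_pow, mul_one]
    rw [this]
    exact hd'mem _ _
  have hΓ : ({g : C | D g = 0} \ {γ}).Infinite := by
    refine Set.Infinite.sdiff ?_ (Set.finite_singleton γ)
    refine Set.infinite_of_injective_forall_mem (f := fun i : ℕ => (i : C)) Nat.cast_injective ?_
    intro i
    exact D.map_natCast i
  have halg : IsAlgebraic C (⟨_, hγ⟩ : S) := by
    refine isAlgebraic_of_isUnit_sub _ hΓ fun g hg => ?_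
    have hg0 : D g = 0 := hg.1
    have hgγ : γ - g ≠ 0 := fun h => hg.2 (sub_eq_zero.1 h).symm
    have hCg : ∀ y, PowerSeries.C (γ - g) * ev y =
        PowerSeries.C γ * ev y - ev (MvPolynomial.C g * y) := by
      intro y
      rw [map_mul, hev, evSol_C, taylorHom_of_eq_zero D hg0, map_sub, sub_mul]
    obtain ⟨i, y, hy⟩ := hz.exists_det_pow_mem (I := numIdeal D A z (γ - g))
      (by
        rintro p ⟨b, hb⟩
        exact ⟨linDer D A b, by rw [← hev, ← hder, ← hder, ← derivative_C_mul, hb]⟩)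
      (fun p hp => ⟨0, by rw [show evSol D (sol D A z) p = 0 from hp]; simp⟩)
      (p₀ := p - MvPolynomial.C g * q) ⟨q, by rw [← hev, hCg, map_sub, h]⟩ (by
        rw [← hev, map_sub, h, ← hCg]
        exact mul_ne_zero ((map_ne_zero_iff _ PowerSeries.C_injective).2 hgγ) hq)
    rw [← hev, map_pow, ← hd] at hy
    refine IsUnit.of_mul_eq_one (⟨_, hd'mem y i⟩ : S) ?_
    ext1
    change (PowerSeries.C γ - ((algebraMap C S g : S) : PowerSeries C)) * (ev y * d' ^ i) = 1
    rw [hcoe, taylorHom_of_eq_zero D hg0, ← map_sub, ← mul_assoc, ← hy, ← mul_pow, hdd', one_pow]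
  obtain ⟨a, ha⟩ := minpoly.mem_range_of_degree_eq_one C _
    (IsAlgClosed.degree_eq_one_of_irreducible C (minpoly.irreducible halg.isIntegral))
  have ha' : taylorHom D a = PowerSeries.C γ := by
    rw [← hcoe, ha]
  have haγ : a = γ := by
    have := congrArg PowerSeries.constantCoeff ha'
    rwa [constantCoeff_taylorHom, PowerSeries.constantCoeff_C] at this
  have := congrArg (fun s => PowerSeries.constantCoeff (PowerSeries.derivative C s)) ha'
  simp only [derivative_taylorHom, constantCoeff_taylorHom, PowerSeries.derivative_C,
    map_zero] at this
  rwa [haγ] at this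

end MaxPt

section Disjoint
variable {C n : Type} [Field C] [CharZero C] [Fintype n] [DecidableEq n]

/-- Values of a maximal solution are linearly disjoint from the scalars over the constants. -/
theorem IsMaxPt.eq_zero_of_sum_eq_zero [IsAlgClosed C] {D : ZDer C} {A z : Matrix n n C}
    (hz : IsMaxPt D A z) {ι : Type} (c : ι → C)
    (hc : ∀ (s : Finset ι) (γ : ι → C), (∀ i ∈ s, D (γ i) = 0) → ∑ i ∈ s, γ i * c i = 0 →
      ∀ i ∈ s, γ i = 0) (s : Finset ι) (p : ι → MvPolynomial (n × n) C)
    (h : ∑ i ∈ s, evSol D (sol D A z) (p i) * PowerSeries.C (c i) = 0) :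
    ∀ i ∈ s, evSol D (sol D A z) (p i) = 0 := by
  classical
  set ev := evSol D (sol D A z) with hev
  have hder : ∀ p, PowerSeries.derivative C (ev p) = ev (linDer D A p) :=
    derivative_evSol (isSol_sol D A z)
  induction s using Finset.induction_on generalizing p with
  | empty => simp
  | insert j s hj ih =>
    have hjz : ev (p j) = 0 := by
      by_contra hne
      have h' : ∑ i ∈ insert j s, ev (linDer D A (p i)) * PowerSeries.C (c i) = 0 := by
        have := congrArg (PowerSeries.derivative C) h
        rw [map_sum, map_zero] at this
        rw [← this]
        refine Finset.sum_congr rfl fun i _ => ?_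
        rw [mul_comm, mul_comm (ev (p i)), derivative_C_mul, hder]
      have h1 := ih (fun i => p j * linDer D A (p i) - linDer D A (p j) * p i) (by
        have : ∑ i ∈ insert j s, ev (p j * linDer D A (p i) - linDer D A (p j) * p i) *
            PowerSeries.C (c i) = 0 := by
          have h3 : ∀ i, ev (p j * linDer D A (p i) - linDer D A (p j) * p i) *
              PowerSeries.C (c i) = ev (p j) * (ev (linDer D A (p i)) * PowerSeries.C (c i)) -
                ev (linDer D A (p j)) * (ev (p i) * PowerSeries.C (c i)) := fun i => by
            rw [map_sub, map_mul, map_mul]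
            ring
          simp only [h3]
          rw [Finset.sum_sub_distrib, ← Finset.mul_sum, ← Finset.mul_sum, h, h']
          ring
        rw [Finset.sum_insert hj, mul_comm (p j), sub_self, map_zero, zero_mul, zero_add] at this
        exact this)
      have h2 : ∀ i, ∃ γ, D γ = 0 ∧ (i ∈ s → ev (p i) = PowerSeries.C γ * ev (p j)) := by
        intro i
        by_cases hi : i ∈ s
        · have := h1 i hi
          rw [map_sub, map_mul, map_mul, ← hder, ← hder] at this
          obtain ⟨γ, hγ⟩ := exists_eq_C_mul (a := ev (p i)) hne (by linear_combination this)
          exact ⟨γ, hz.constant_of_eq hγ hne, fun _ => hγ⟩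
        · exact ⟨0, map_zero _, fun h => absurd h hi⟩
      choose γ hγ hγ' using h2
      have h4 : ∀ i ∈ insert j s, ev (p i) =
          PowerSeries.C (Function.update γ j 1 i) * ev (p j) := by
        intro i hi
        by_cases hij : i = j
        · subst hij
          simp
        · rw [Function.update_of_ne hij]
          exact hγ' i (Finset.mem_of_mem_insert_of_ne hi hij)
      have h5 : ev (p j) * PowerSeries.C (∑ i ∈ insert j s, Function.update γ j 1 i * c i) = 0 := by
        rw [← h, map_sum, Finset.mul_sum]
        refine Finset.sum_congr rfl fun i hi => ?_
        rw [h4 i hi, map_mul]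
        ring
      have h6 := (mul_eq_zero.1 h5).resolve_left hne
      rw [map_eq_zero_iff _ PowerSeries.C_injective] at h6
      have := hc _ _ (fun i _ => by
        by_cases hij : i = j
        · subst hij
          simp
        · rw [Function.update_of_ne hij]
          exact hγ i) h6 j (Finset.mem_insert_self _ _)
      simp at this
    rw [Finset.sum_insert hj, hjz, zero_mul, zero_add] at h
    intro i hi
    rcases Finset.mem_insert.1 hi with rfl | hi
    · exact hjz
    · exact ih p h i hi

end Disjoint

open scoped TensorProduct

section Act
variable {k K n A B : Type} [Field k] [CommRing K] [Algebra k K] [Fintype n] [DecidableEq n]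
  [CommRing A] [Algebra k A] [CommRing B] [Algebra k B]

/-- The matrix `a + i b` with entries in the tensor product. -/
noncomputable def hat (i : K) (a b : Matrix n n A) : Matrix n n (MvPolynomial (n × n) K ⊗[k] A) :=
  .of fun r s => 1 ⊗ₜ a r s + MvPolynomial.C i ⊗ₜ b r s

/-- The twisted right translation `X ↦ X (a + i b)` on polynomials. -/
noncomputable def actX (i : K) (σ : K →ₐ[k] K) (a b : Matrix n n A) :
    MvPolynomial (n × n) K →ₐ[k] MvPolynomial (n × n) K ⊗[k] A where
  __ := MvPolynomial.eval₂Hom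
    ((Algebra.TensorProduct.includeLeftRingHom.comp MvPolynomial.C).comp (σ : K →+* K))
    fun q => ∑ l, MvPolynomial.X (q.1, l) ⊗ₜ 1 * hat i a b l q.2
  commutes' r := by
    have h : (algebraMap k (MvPolynomial (n × n) K)) r = MvPolynomial.C (algebraMap k K r) := rfl
    have h' : σ (algebraMap k K r) = algebraMap k K r := σ.commutes r
    simp only [h, AlgHom.toRingHom_eq_coe, RingHom.toMonoidHom_eq_coe, OneHom.toFun_eq_coe,
      MonoidHom.toOneHom_coe, MonoidHom.coe_coe, MvPolynomial.coe_eval₂Hom, MvPolynomial.eval₂_C,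
      RingHom.comp_apply, RingHom.coe_coe, h']
    rw [← h]
    rfl

/-- The twisted right translation on polynomials with scalars extended to `A`. -/
noncomputable def act (i : K) (σ : K →ₐ[k] K) (a b : Matrix n n A) :
    MvPolynomial (n × n) K ⊗[k] A →ₐ[k] MvPolynomial (n × n) K ⊗[k] A :=
  Algebra.TensorProduct.lift (actX i σ a b) Algebra.TensorProduct.includeRight
    fun _ _ => Commute.all _ _

theorem act_one_tmul (i : K) (σ : K →ₐ[k] K) (a b : Matrix n n A) (x : A) :
    act i σ a b (1 ⊗ₜ x) = 1 ⊗ₜ x := by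
  simp [act]

theorem act_C (i : K) (σ : K →ₐ[k] K) (a b : Matrix n n A) (x : K) :
    act i σ a b (MvPolynomial.C x ⊗ₜ 1) = MvPolynomial.C (σ x) ⊗ₜ 1 := by
  simp [act, actX]

theorem act_X (i : K) (σ : K →ₐ[k] K) (a b : Matrix n n A) (q : n × n) :
    act i σ a b (MvPolynomial.X q ⊗ₜ 1) =
      ∑ l, MvPolynomial.X (q.1, l) ⊗ₜ 1 * hat i a b l q.2 := by
  rw [act, Algebra.TensorProduct.lift_tmul, map_one, mul_one]
  exact MvPolynomial.eval₂_X ..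

theorem tensor_hom_ext {S : Type} [CommRing S] {f g : MvPolynomial (n × n) K ⊗[k] A →+* S}
    (hC : ∀ x, f (MvPolynomial.C x ⊗ₜ 1) = g (MvPolynomial.C x ⊗ₜ 1))
    (hX : ∀ q, f (MvPolynomial.X q ⊗ₜ 1) = g (MvPolynomial.X q ⊗ₜ 1))
    (hA : ∀ x, f (1 ⊗ₜ x) = g (1 ⊗ₜ x)) : f = g := by
  have h : f.comp Algebra.TensorProduct.includeLeftRingHom =
      g.comp Algebra.TensorProduct.includeLeftRingHom :=
    MvPolynomial.ringHom_ext hC hX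
  refine RingHom.ext fun x => ?_
  induction x using TensorProduct.induction_on with
  | zero => rw [map_zero, map_zero]
  | add x y hx hy => rw [map_add, map_add, hx, hy]
  | tmul p a =>
    have h1 : p ⊗ₜ[k] a = (p ⊗ₜ[k] (1 : A)) * ((1 : MvPolynomial (n × n) K) ⊗ₜ[k] a) := by simp
    have h2 : f (p ⊗ₜ 1) = g (p ⊗ₜ 1) := DFunLike.congr_fun h p
    rw [h1, map_mul, map_mul, h2, hA]

theorem tmul_eq (i : K) (x : A) :
    (MvPolynomial.C i ⊗ₜ[k] x : MvPolynomial (n × n) K ⊗[k] A) =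
      (MvPolynomial.C i ⊗ₜ[k] (1 : A)) * ((1 : MvPolynomial (n × n) K) ⊗ₜ[k] x) := by simp

theorem act_hat (i : K) (σ : K →ₐ[k] K) {ε : k} (hσ : σ i = ε • i)
    (a b a' b' : Matrix n n A) (r s : n) :
    act i σ a b (hat i a' b' r s) = hat i a' (ε • b') r s := by
  simp only [hat, Matrix.of_apply, map_add, act_one_tmul, Matrix.smul_apply]
  rw [tmul_eq, map_mul, act_C, act_one_tmul, hσ, Algebra.TensorProduct.tmul_mul_tmul, mul_one,
    one_mul, ← TensorProduct.smul_tmul]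
  congr 2
  exact (MvPolynomial.smul_monomial ε).symm

theorem hat_mul (i : K) (hi : i * i = -1) (a b a' b' : Matrix n n A) :
    hat (k := k) i a b * hat i a' b' = hat i (a * a' - b * b') (a * b' + b * a') := by
  ext1 r s
  simp only [hat, Matrix.mul_apply, Matrix.of_apply, Matrix.sub_apply, Matrix.add_apply,
    add_mul, mul_add, Algebra.TensorProduct.tmul_mul_tmul, one_mul, mul_one, ← map_mul, hi,
    Finset.sum_add_distrib, TensorProduct.tmul_add, TensorProduct.tmul_sub,
    TensorProduct.tmul_sum, map_neg, map_one, TensorProduct.neg_tmul, Finset.sum_neg_distrib]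
  ring

theorem act_comp_act (i : K) (hi : i * i = -1) (σ τ : K →ₐ[k] K) {ε : k} (hσ : σ i = ε • i)
    (a b a' b' : Matrix n n A) :
    (act i σ a b).comp (act i τ a' b') =
      act i (σ.comp τ) (a * a' - b * (ε • b')) (a * (ε • b') + b * a') := by
  have : ((act i σ a b).comp (act i τ a' b')).toRingHom =
      (act i (σ.comp τ) (a * a' - b * (ε • b')) (a * (ε • b') + b * a')).toRingHom := by
    refine tensor_hom_ext (fun x => ?_) (fun q => ?_) (fun x => ?_)
    · simp [act_C]
    · simp only [AlgHom.toRingHom_eq_coe, RingHom.coe_coe, AlgHom.comp_apply, act_X, map_sum,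
        map_mul, act_hat i σ hσ]
      simp only [← hat_mul i hi, Matrix.mul_apply, Finset.sum_mul, Finset.mul_sum]
      rw [Finset.sum_comm]
      refine Finset.sum_congr rfl fun _ _ => Finset.sum_congr rfl fun _ _ => ?_
      ring
    · simp [act_one_tmul]
  exact AlgHom.ext fun x => DFunLike.congr_fun this x

theorem act_natural (i : K) (σ : K →ₐ[k] K) (e : A →ₐ[k] B) (a b : Matrix n n A)
    (x : MvPolynomial (n × n) K ⊗[k] A) :
    Algebra.TensorProduct.map (AlgHom.id k _) e (act i σ a b x) =
      act i σ (a.map e) (b.map e) (Algebra.TensorProduct.map (AlgHom.id k _) e x) := by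
  have : ((Algebra.TensorProduct.map (AlgHom.id k (MvPolynomial (n × n) K)) e).comp
      (act i σ a b)).toRingHom = ((act i σ (a.map e) (b.map e)).comp
      (Algebra.TensorProduct.map (AlgHom.id k _) e)).toRingHom := by
    refine tensor_hom_ext (fun x => ?_) (fun q => ?_) (fun x => ?_)
    · simp [act_C]
    · simp [act_X, hat]
    · simp [act_one_tmul]
  exact DFunLike.congr_fun this x

theorem act_one (i : K) (x : MvPolynomial (n × n) K ⊗[k] A) :
    act i (AlgHom.id k K) (1 : Matrix n n A) 0 x = x := by
  have : (act i (AlgHom.id k K) (1 : Matrix n n A) 0).toRingHom = RingHom.id _ := by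
    refine tensor_hom_ext (fun x => ?_) (fun q => ?_) (fun x => ?_)
    · simp [act_C]
    · simp only [AlgHom.toRingHom_eq_coe, RingHom.coe_coe, act_X, hat, Matrix.of_apply,
        Matrix.zero_apply, TensorProduct.tmul_zero, add_zero, RingHom.id_apply]
      rw [Finset.sum_eq_single q.2]
      · simp
      · intro l _ hl
        rw [Matrix.one_apply_ne hl]
        simp
      · simp
    · simp [act_one_tmul]
  exact DFunLike.congr_fun this x

end Act

section Functional
variable {k P A B : Type} [Field k] [CommRing P] [Algebra k P] [CommRing A] [Algebra k A]
  [CommRing B] [Algebra k B]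

/-- Apply a linear functional to the first tensor factor. -/
noncomputable def functional (A : Type) [CommRing A] [Algebra k A] (l : P →ₗ[k] k) :
    P ⊗[k] A →ₗ[k] A :=
  (TensorProduct.lid k A).toLinearMap.comp (l.rTensor A)

theorem functional_tmul (l : P →ₗ[k] k) (p : P) (a : A) :
    functional A l (p ⊗ₜ a) = l p • a := by simp [functional]

theorem functional_natural (l : P →ₗ[k] k) (e : A →ₐ[k] B) (x : P ⊗[k] A) :
    functional B l (Algebra.TensorProduct.map (AlgHom.id k P) e x) = e (functional A l x) := by
  induction x using TensorProduct.induction_on with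
  | zero => simp
  | add x y hx hy => simp only [map_add, hx, hy]
  | tmul p a => simp [functional_tmul]

/-- The extension of an ideal to a tensor product. -/
noncomputable def extIdeal (A : Type) [CommRing A] [Algebra k A] (m : Ideal P) :
    Ideal (P ⊗[k] A) :=
  m.map (Algebra.TensorProduct.includeLeftRingHom : P →+* P ⊗[k] A)

theorem exists_basis_sum (x : P ⊗[k] A) : ∃ (ι : Type) (b : Module.Basis ι k A) (s : Finset ι)
    (p : ι → P), x = ∑ i ∈ s, p i ⊗ₜ b i := by
  classical
  let b := Module.Basis.ofVectorSpace k A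
  refine ⟨_, b, ?_⟩
  induction x using TensorProduct.induction_on with
  | zero => exact ⟨∅, 0, by simp⟩
  | add x y hx hy =>
    obtain ⟨s, p, rfl⟩ := hx
    obtain ⟨t, q, rfl⟩ := hy
    refine ⟨s ∪ t, fun i => (if i ∈ s then p i else 0) + if i ∈ t then q i else 0, ?_⟩
    simp only [TensorProduct.add_tmul, Finset.sum_add_distrib]
    congr 1
    · rw [← Finset.sum_subset (Finset.subset_union_left) fun i _ hi => by simp [hi]]
      exact Finset.sum_congr rfl fun i hi => by simp [hi]
    · rw [← Finset.sum_subset (Finset.subset_union_right) fun i _ hi => by simp [hi]]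
      exact Finset.sum_congr rfl fun i hi => by simp [hi]
  | tmul p a =>
    refine ⟨(b.repr a).support, fun i => b.repr a i • p, ?_⟩
    conv_lhs => rw [← b.linearCombination_repr a]
    rw [Finsupp.linearCombination_apply, Finsupp.sum, TensorProduct.tmul_sum]
    exact Finset.sum_congr rfl fun i _ => by rw [TensorProduct.tmul_smul, TensorProduct.smul_tmul']

theorem mem_extIdeal_iff (m : Ideal P) (x : P ⊗[k] A) :
    x ∈ extIdeal A m ↔ ∀ l : P →ₗ[k] k, (∀ p ∈ m, l p = 0) → functional A l x = 0 := by
  constructor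
  · intro hx l hl
    induction hx using Submodule.span_induction generalizing l with
    | zero => exact map_zero _
    | add x y _ _ hx hy => rw [map_add, hx l hl, hy l hl, add_zero]
    | mem x hx =>
      obtain ⟨p, hp, rfl⟩ := hx
      change functional A l (p ⊗ₜ 1) = 0
      rw [functional_tmul, hl p hp, zero_smul]
    | smul c x _ hx =>
      rw [smul_eq_mul]
      induction c using TensorProduct.induction_on with
      | zero => rw [zero_mul, map_zero]
      | add c d hc hd => rw [add_mul, map_add, hc, hd, add_zero]
      | tmul q a =>
        have h : ∀ x, functional A l (q ⊗ₜ a * x) =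
            a * functional A (l.comp (LinearMap.mulLeft k q)) x := by
          intro x
          induction x using TensorProduct.induction_on with
          | zero => simp
          | add x y hx hy => simp only [mul_add, map_add, hx, hy]
          | tmul p b => simp [functional_tmul]
        rw [h, hx _ fun p hp => hl (q * p) (m.mul_mem_left q hp), mul_zero]
  · intro h
    obtain ⟨ι, b, s, p, rfl⟩ := exists_basis_sum x
    refine Ideal.sum_mem _ fun i hi => ?_
    have hp : p i ∈ m := by
      by_contra hp
      obtain ⟨l, hl, hle⟩ := Submodule.exists_le_ker_of_notMem (K := k) (p :=
          m.restrictScalars k) hp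
      have := h l fun q hq => hle hq
      rw [map_sum] at this
      simp only [functional_tmul] at this
      exact hl (linearIndependent_iff'.1 b.linearIndependent s _ this i hi)
    have h1 : p i ⊗ₜ[k] b i = ((1 : P) ⊗ₜ[k] b i) * (p i ⊗ₜ[k] (1 : A)) := by simp
    rw [h1]
    exact Ideal.mul_mem_left _ _ (Ideal.mem_map_of_mem _ hp)

end Functional

section FiniteSubset
variable {k m : Type} [Field k] [Fintype m] [DecidableEq m]

theorem isZero_iff_span_le {S : Set (MvPolynomial (m × m) k)} {A : Type} [CommRing A]
    {f : k →+* A} {M : Matrix m m A} : IsZero S f M ↔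
      Ideal.span S ≤ RingHom.ker (MvPolynomial.eval₂Hom f fun q => M q.1 q.2) := by
  rw [Ideal.span_le]
  rfl

theorem exists_finset_isZero_iff (S : Set (MvPolynomial (m × m) k)) :
    ∃ T : Finset (MvPolynomial (m × m) k), ∀ (A : Type) [CommRing A] (f : k →+* A)
      (M : Matrix m m A), IsZero (T : Set (MvPolynomial (m × m) k)) f M ↔ IsZero S f M := by
  obtain ⟨T, -, hT⟩ := Submodule.fg_span_iff_fg_span_finset_subset S |>.1
    (IsNoetherian.noetherian (Ideal.span S))
  refine ⟨T, fun A _ f M => ?_⟩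
  rw [isZero_iff_span_le, isZero_iff_span_le]
  change Submodule.span _ _ ≤ _ ↔ Submodule.span _ _ ≤ _
  rw [hT]

end FiniteSubset

section Stab
variable {k K n : Type} [Field k] [CommRing K] [Algebra k K] [Fintype n] [DecidableEq n]

/-- The twisted right translation by `a + i b` preserves the ideal `m`. -/
def IsStab {A : Type} [CommRing A] [Algebra k A] (m : Ideal (MvPolynomial (n × n) K)) (i : K)
    (σ : K →ₐ[k] K) (a b : Matrix n n A) : Prop :=
  ∀ p ∈ m, act i σ a b (p ⊗ₜ 1) ∈ extIdeal A m

theorem IsStab.comp {A : Type} [CommRing A] [Algebra k A] {m : Ideal (MvPolynomial (n × n) K)}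
    {i : K} (hi : i * i = -1) {σ τ : K →ₐ[k] K} {ε : k} (hσ : σ i = ε • i)
    {a b a' b' : Matrix n n A} (h : IsStab m i σ a b) (h' : IsStab m i τ a' b') :
    IsStab m i (σ.comp τ) (a * a' - b * (ε • b')) (a * (ε • b') + b * a') := by
  intro p hp
  rw [← act_comp_act i hi σ τ hσ, AlgHom.comp_apply]
  have hle : extIdeal A m ≤ (extIdeal A m).comap (act i σ a b) := by
    refine Ideal.map_le_iff_le_comap.2 fun p hp => ?_
    rw [Ideal.mem_comap, Ideal.mem_comap]
    exact h p hp
  exact Ideal.mem_comap.1 (hle (h' p hp))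

/-- The generic matrix. -/
noncomputable def genMat (k n : Type) [Field k] :
    Matrix (n ⊕ n) (n ⊕ n) (MvPolynomial ((n ⊕ n) × (n ⊕ n)) k) :=
  .of fun r s => MvPolynomial.X (r, s)

/-- Equations for the real matrices representing semilinear maps whose translation preserves
`m`. -/
def stabSet (m : Ideal (MvPolynomial (n × n) K)) (i : K) (σ : K →ₐ[k] K) (ε : k) :
    Set (MvPolynomial ((n ⊕ n) × (n ⊕ n)) k) :=
  (Set.range fun q : n × n => MvPolynomial.X (.inl q.1, .inr q.2) +
      MvPolynomial.C ε * MvPolynomial.X (.inr q.1, .inl q.2)) ∪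
    (Set.range fun q : n × n => MvPolynomial.X (.inr q.1, .inr q.2) -
      MvPolynomial.C ε * MvPolynomial.X (.inl q.1, .inl q.2)) ∪
    {f | ∃ p ∈ m, ∃ l : MvPolynomial (n × n) K →ₗ[k] k, (∀ p ∈ m, l p = 0) ∧
      f = functional _ l (act i σ (genMat k n).toBlocks₁₁ (genMat k n).toBlocks₂₁ (p ⊗ₜ 1))}

theorem isZero_stabSet_iff {A : Type} [CommRing A] [Algebra k A]
    {m : Ideal (MvPolynomial (n × n) K)} {i : K} {σ : K →ₐ[k] K} {ε : k}
    {M : Matrix (n ⊕ n) (n ⊕ n) A} : IsZero (stabSet m i σ ε) (algebraMap k A) M ↔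
      M.toBlocks₁₂ = -(ε • M.toBlocks₂₁) ∧ M.toBlocks₂₂ = ε • M.toBlocks₁₁ ∧
        IsStab m i σ M.toBlocks₁₁ M.toBlocks₂₁ := by
  let e : MvPolynomial ((n ⊕ n) × (n ⊕ n)) k →ₐ[k] A := MvPolynomial.aeval fun q => M q.1 q.2
  have h11 : (genMat k n).toBlocks₁₁.map e = M.toBlocks₁₁ := by
    ext r s
    simp [e, genMat, Matrix.toBlocks₁₁]
  have h21 : (genMat k n).toBlocks₂₁.map e = M.toBlocks₂₁ := by
    ext r s
    simp [e, genMat, Matrix.toBlocks₂₁]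
  have hkey : ∀ (p : MvPolynomial (n × n) K) (l : MvPolynomial (n × n) K →ₗ[k] k),
      e (functional _ l (act i σ (genMat k n).toBlocks₁₁ (genMat k n).toBlocks₂₁ (p ⊗ₜ 1))) =
        functional A l (act i σ M.toBlocks₁₁ M.toBlocks₂₁ (p ⊗ₜ 1)) := by
    intro p l
    rw [← functional_natural, act_natural, h11, h21]
    simp
  have he : ∀ p, p.eval₂ (algebraMap k A) (fun q => M q.1 q.2) = e p := fun p => rfl
  simp only [IsZero, he]
  constructor
  · intro h
    refine ⟨?_, ?_, fun p hp => (mem_extIdeal_iff m _).2 fun l hl => ?_⟩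
    · ext r s
      have := h _ (.inl (.inl ⟨(r, s), rfl⟩))
      simpa [e, ← Algebra.smul_def, Matrix.toBlocks₁₂, Matrix.toBlocks₂₁, add_eq_zero_iff_eq_neg]
        using this
    · ext r s
      have := h _ (.inl (.inr ⟨(r, s), rfl⟩))
      simpa [e, ← Algebra.smul_def, Matrix.toBlocks₂₂, Matrix.toBlocks₁₁, sub_eq_zero] using this
    · rw [← hkey]
      exact h _ (.inr ⟨p, hp, l, hl, rfl⟩)
  · rintro ⟨h1, h2, h3⟩ p ((⟨q, rfl⟩ | ⟨q, rfl⟩) | ⟨p, hp, l, hl, rfl⟩)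
    · have := congrFun (congrFun h1 q.1) q.2
      simpa [e, ← Algebra.smul_def, Matrix.toBlocks₁₂, Matrix.toBlocks₂₁, add_eq_zero_iff_eq_neg]
        using this
    · have := congrFun (congrFun h2 q.1) q.2
      simpa [e, ← Algebra.smul_def, Matrix.toBlocks₂₂, Matrix.toBlocks₁₁, sub_eq_zero] using this
    · rw [hkey]
      exact (mem_extIdeal_iff m _).1 (h3 p hp) l hl

theorem isZero_stabSet_mul {A : Type} [CommRing A] (f : k →+* A)
    {m : Ideal (MvPolynomial (n × n) K)} {i : K} (hi : i * i = -1) {σ τ ρ : K →ₐ[k] K}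
    (hρ : σ.comp τ = ρ) {ε δ η : k} (hσ : σ i = ε • i) (hε : ε * ε = 1) (hη : ε * δ = η)
    {M N : Matrix (n ⊕ n) (n ⊕ n) A} (hM : IsZero (stabSet m i σ ε) f M)
    (hN : IsZero (stabSet m i τ δ) f N) : IsZero (stabSet m i ρ η) f (M * N) := by
  let _ := f.toAlgebra
  obtain ⟨h1, h2, h3⟩ := isZero_stabSet_iff.1 hM
  obtain ⟨h1', h2', h3'⟩ := isZero_stabSet_iff.1 hN
  refine isZero_stabSet_iff.2 ?_
  rw [← Matrix.fromBlocks_toBlocks M, ← Matrix.fromBlocks_toBlocks N, Matrix.fromBlocks_multiply]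
  simp only [Matrix.toBlocks_fromBlocks₁₁, Matrix.toBlocks_fromBlocks₁₂,
    Matrix.toBlocks_fromBlocks₂₁, Matrix.toBlocks_fromBlocks₂₂, h1, h1', h2, h2']
  refine ⟨?_, ?_, ?_⟩
  · simp only [smul_add, smul_smul, Matrix.mul_neg, Matrix.neg_mul, Matrix.mul_smul,
      Matrix.smul_mul, neg_add, smul_neg, ← hη]
    rw [show ε * δ * ε = δ by rw [mul_right_comm, hε, one_mul], mul_comm ε δ]
    abel
  · simp only [smul_add, smul_smul, Matrix.mul_neg, Matrix.neg_mul, Matrix.mul_smul,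
      Matrix.smul_mul, ← hη, smul_neg]
    rw [show ε * δ * ε = δ by rw [mul_right_comm, hε, one_mul], mul_comm ε δ]
    abel
  · have := h3.comp hi hσ h3'
    rw [hρ] at this
    convert this using 1
    · simp only [Matrix.neg_mul, Matrix.mul_smul, Matrix.smul_mul]
      abel
    · simp only [Matrix.mul_smul, Matrix.smul_mul]
      abel

theorem isZero_stabSet_one {A : Type} [CommRing A] (f : k →+* A)
    (m : Ideal (MvPolynomial (n × n) K)) (i : K) :
    IsZero (stabSet m i (AlgHom.id k K) 1) f (1 : Matrix (n ⊕ n) (n ⊕ n) A) := by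
  let _ := f.toAlgebra
  refine isZero_stabSet_iff.2 ?_
  rw [← Matrix.fromBlocks_one]
  simp only [Matrix.toBlocks_fromBlocks₁₁, Matrix.toBlocks_fromBlocks₁₂,
    Matrix.toBlocks_fromBlocks₂₁, Matrix.toBlocks_fromBlocks₂₂]
  refine ⟨by simp, by simp, fun p hp => ?_⟩
  rw [act_one]
  exact Ideal.mem_map_of_mem _ hp

end Stab

section CxMat
variable {R n : Type} [CommRing R] [Fintype n] [DecidableEq n]

/-- The matrix `a + i b`. -/
def cxMat (a b : Matrix n n R) : Matrix n n (Cx R) := .of fun r s => ⟨a r s, b r s⟩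

theorem re_sum_cx {ι : Type} (s : Finset ι) (f : ι → Cx R) :
    (∑ i ∈ s, f i).re = ∑ i ∈ s, (f i).re :=
  map_sum (⟨⟨fun z : Cx R => z.re, rfl⟩, fun _ _ => rfl⟩ : Cx R →+ R) f s

theorem im_sum_cx {ι : Type} (s : Finset ι) (f : ι → Cx R) :
    (∑ i ∈ s, f i).im = ∑ i ∈ s, (f i).im :=
  map_sum (⟨⟨fun z : Cx R => z.im, rfl⟩, fun _ _ => rfl⟩ : Cx R →+ R) f s

theorem cxMat_mul (a b a' b' : Matrix n n R) :
    cxMat a b * cxMat a' b' = cxMat (a * a' - b * b') (a * b' + b * a') := by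
  ext r s
  · simp only [Matrix.mul_apply, cxMat, Matrix.of_apply, re_sum_cx, QuadraticAlgebra.re_mul,
      Matrix.sub_apply, ← Finset.sum_sub_distrib]
    exact Finset.sum_congr rfl fun _ _ => by ring
  · simp only [Matrix.mul_apply, cxMat, Matrix.of_apply, im_sum_cx, QuadraticAlgebra.im_mul,
      Matrix.add_apply, ← Finset.sum_add_distrib]
    exact Finset.sum_congr rfl fun _ _ => by ring

theorem cxMat_one : cxMat (1 : Matrix n n R) 0 = 1 := by
  ext r s <;> by_cases h : r = s <;> simp [cxMat, Matrix.one_apply, h, QuadraticAlgebra.re_one,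
      QuadraticAlgebra.im_one]

theorem cxMat_conj (a b : Matrix n n R) {k : Type} [CommRing k] [Algebra k R] :
    (cxMat a b).map (conjHom k R) = cxMat a (-b) := by
  ext r s <;> simp [cxMat]

theorem exists_cxMat (s : Matrix n n (Cx R)) : ∃ a b, s = cxMat a b :=
  ⟨s.map fun z => z.re, s.map fun z => z.im, rfl⟩

theorem cxMat_inj {a b a' b' : Matrix n n R} (h : cxMat a b = cxMat a' b') : a = a' ∧ b = b' := by
  constructor <;> ext r s
  · exact congrArg QuadraticAlgebra.re (congrFun (congrFun h r) s)
  · exact congrArg QuadraticAlgebra.im (congrFun (congrFun h r) s)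

/-- The imaginary unit. -/
def cxI : Cx R := ⟨0, 1⟩

theorem cxI_mul_cxI : (cxI : Cx R) * cxI = -1 := by
  ext <;> simp [cxI, QuadraticAlgebra.re_one, QuadraticAlgebra.im_one]

theorem cx_eq (x y : R) : (⟨x, y⟩ : Cx R) =
    algebraMap R (Cx R) x + cxI * algebraMap R (Cx R) y := by
  ext <;> simp [cxI, QuadraticAlgebra.algebraMap_eq]

theorem conjHom_cxI {k : Type} [CommRing k] [Algebra k R] :
    conjHom k R cxI = (-1 : k) • cxI := by
  ext <;> simp [cxI, QuadraticAlgebra.re_one, QuadraticAlgebra.im_one]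

theorem conjHom_comp_conjHom {k : Type} [CommRing k] [Algebra k R] :
    (conjHom k R).comp (conjHom k R) = AlgHom.id k (Cx R) := by
  ext z <;> simp

theorem exists_cxDer (D : ZDer R) : ∃ D' : ZDer (Cx R), ∀ z, D' z = ⟨D z.re, D z.im⟩ :=
  exists_zDer
    { toFun := fun z : Cx R => (⟨D z.re, D z.im⟩ : Cx R)
      map_zero' := by ext <;> simp
      map_add' := fun a b => by ext <;> simp }
    fun a b => by
      ext
      · simp
        ring
      · simp
        ring

end CxMat

section Theta
variable {k R n : Type} [Field k] [Field R] [IsRealClosed R] [Algebra k R]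
  [Fintype n] [DecidableEq n]

theorem exists_theta {D' : ZDer (Cx R)}
    (hk : ∀ a : k, D' (algebraMap k (Cx R) a) = 0) (F : Matrix n n (PowerSeries (Cx R))) :
    ∃ θ : MvPolynomial (n × n) (Cx R) ⊗[k] R →+* PowerSeries (Cx R),
      ∀ p r, θ (p ⊗ₜ r) = evSol D' F p * PowerSeries.C (algebraMap R (Cx R) r) := by
  let f : MvPolynomial (n × n) (Cx R) →ₐ[k] PowerSeries (Cx R) :=
    { __ := evSol D' F
      commutes' := fun a => by
        have h : algebraMap k (MvPolynomial (n × n) (Cx R)) a =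
          MvPolynomial.C (algebraMap k (Cx R) a) := rfl
        change evSol D' F (algebraMap k (MvPolynomial (n × n) (Cx R)) a) = _
        rw [h, evSol_C, taylorHom_of_eq_zero _ (hk a), PowerSeries.algebraMap_apply] }
  let g : R →ₐ[k] PowerSeries (Cx R) :=
    { __ := (PowerSeries.C (R := Cx R)).comp (algebraMap R (Cx R))
      commutes' := fun a => by
        change PowerSeries.C (algebraMap R (Cx R) (algebraMap k R a)) = _
        rw [← IsScalarTower.algebraMap_apply, PowerSeries.algebraMap_apply] }
  exact ⟨(Algebra.TensorProduct.lift f g fun _ _ => Commute.all _ _).toRingHom, fun p r =>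
    Algebra.TensorProduct.lift_tmul ..⟩

variable {D' : ZDer (Cx R)} {F : Matrix n n (PowerSeries (Cx R))}
  {θ : MvPolynomial (n × n) (Cx R) ⊗[k] R →+* PowerSeries (Cx R)}

theorem theta_hat (hθ : ∀ p r, θ (p ⊗ₜ r) = evSol D' F p * PowerSeries.C (algebraMap R (Cx R) r))
    (hI : D' cxI = 0) (a b : Matrix n n R) (r s : n) :
    θ (hat cxI a b r s) = PowerSeries.C (cxMat a b r s) := by
  simp only [hat, Matrix.of_apply, map_add, hθ, map_one, one_mul, evSol_C,
    taylorHom_of_eq_zero D' hI, cxMat, cx_eq, map_mul]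

theorem theta_act (hθ : ∀ p r, θ (p ⊗ₜ r) = evSol D' F p * PowerSeries.C (algebraMap R (Cx R) r))
    (hI : D' cxI = 0) (σ : Cx R →ₐ[k] Cx R) (a b : Matrix n n R)
    (p : MvPolynomial (n × n) (Cx R)) : θ (act cxI σ a b (p ⊗ₜ 1)) =
      p.eval₂ ((taylorHom D').comp (σ : Cx R →+* Cx R))
        (fun q => (F * (cxMat a b).map PowerSeries.C) q.1 q.2) := by
  have h1 : ∀ p, θ (p ⊗ₜ 1) = evSol D' F p := fun p => by rw [hθ, map_one, map_one, mul_one]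
  have : (θ.comp (act cxI σ a b).toRingHom).comp Algebra.TensorProduct.includeLeftRingHom =
      MvPolynomial.eval₂Hom ((taylorHom D').comp (σ : Cx R →+* Cx R))
        (fun q => (F * (cxMat a b).map PowerSeries.C) q.1 q.2) := by
    refine MvPolynomial.ringHom_ext (fun x => ?_) fun q => ?_
    · change θ (act cxI σ a b (MvPolynomial.C x ⊗ₜ 1)) = _
      rw [act_C, h1, evSol_C]
      simp
    · change θ (act cxI σ a b (MvPolynomial.X q ⊗ₜ 1)) = _
      rw [act_X, map_sum, MvPolynomial.eval₂Hom_X', Matrix.mul_apply]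
      refine Finset.sum_congr rfl fun l _ => ?_
      rw [map_mul, h1, theta_hat hθ hI, evSol_X]
      rfl
  exact DFunLike.congr_fun this p

theorem theta_eq_zero_iff [CharZero R] {D : ZDer R} (hD : ∀ r, D r =
    0 ↔ r ∈ Set.range (algebraMap k R))
    (hD' : ∀ z, D' z = ⟨D z.re, D z.im⟩) {A z : Matrix n n (Cx R)} (hz : IsMaxPt D' A z)
    (hθ : ∀ p r, θ (p ⊗ₜ r) = evSol D' (sol D' A z) p * PowerSeries.C (algebraMap R (Cx R) r))
    (x : MvPolynomial (n × n) (Cx R) ⊗[k] R) :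
    θ x = 0 ↔ x ∈ extIdeal R (RingHom.ker (evSol D' (sol D' A z))) := by
  constructor
  · intro hx
    obtain ⟨ι, b, s, p, rfl⟩ := exists_basis_sum x
    rw [map_sum] at hx
    simp only [hθ] at hx
    have := hz.eq_zero_of_sum_eq_zero (fun i => algebraMap R (Cx R) (b i)) (fun t γ hγ h => by
      have hγ' : ∀ i, ∃ x y : k, i ∈ t → γ i = ⟨algebraMap k R x, algebraMap k R y⟩ := by
        intro i
        by_cases hi : i ∈ t
        · have := hγ i hi
          rw [hD'] at this
          obtain ⟨x, hx⟩ := (hD _).1 (congrArg QuadraticAlgebra.re this)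
          obtain ⟨y, hy⟩ := (hD _).1 (congrArg QuadraticAlgebra.im this)
          exact ⟨x, y, fun _ => by rw [hx, hy]⟩
        · exact ⟨0, 0, fun h => absurd h hi⟩
      choose x y hxy using hγ'
      have hre := congrArg QuadraticAlgebra.re h
      have him := congrArg QuadraticAlgebra.im h
      rw [re_sum_cx, QuadraticAlgebra.re_zero, Finset.sum_congr rfl (fun i hi =>
        show _ = x i • b i by
          rw [hxy i hi, Algebra.smul_def]
          simp [QuadraticAlgebra.algebraMap_eq])] at hre
      rw [im_sum_cx, QuadraticAlgebra.im_zero, Finset.sum_congr rfl (fun i hi =>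
        show _ = y i • b i by
          rw [hxy i hi, Algebra.smul_def]
          simp [QuadraticAlgebra.algebraMap_eq])] at him
      intro i hi
      rw [hxy i hi, linearIndependent_iff'.1 b.linearIndependent t _ hre i hi,
        linearIndependent_iff'.1 b.linearIndependent t _ him i hi]
      ext <;> simp) s p hx
    refine Ideal.sum_mem _ fun i hi => ?_
    have h1 : p i ⊗ₜ[k] b i = ((1 : MvPolynomial (n × n) (Cx R)) ⊗ₜ[k] b i) *
      (p i ⊗ₜ[k] (1 : R)) := by simp
    rw [h1]
    exact Ideal.mul_mem_left _ _ (Ideal.mem_map_of_mem _ (this i hi))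
  · have hle : extIdeal R (RingHom.ker (evSol D' (sol D' A z))) ≤ RingHom.ker θ := by
      refine Ideal.map_le_iff_le_comap.2 fun p hp => ?_
      rw [Ideal.mem_comap, RingHom.mem_ker]
      change θ (p ⊗ₜ 1) = 0
      rw [hθ, RingHom.mem_ker.1 hp, zero_mul]
    exact fun h => hle h

end Theta

section ConjugationInvariant

variable {k R n : Type} [Field k] [Field R] [IsRealClosed R] [CharZero R] [Algebra k R]
  [Fintype n] [DecidableEq n]

set_option maxHeartbeats 400000 in
theorem exists_isMaxPt_conj [IsRealClosed k] {D : ZDer R} (hD : ∀ r, D r =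
    0 ↔ r ∈ Set.range (algebraMap k R))
    {D' : ZDer (Cx R)} (hD' : ∀ z, D' z = ⟨D z.re, D z.im⟩) (A : Matrix n n R) :
    ∃ z, IsMaxPt D' (A.map (algebraMap R (Cx R))) z ∧ ∃ a b : Matrix n n k,
      z.map (conjHom k R) = z * cxMat (a.map (algebraMap k R)) (b.map (algebraMap k R)) := by
  set A' := A.map (algebraMap R (Cx R)) with hA'
  obtain ⟨z, hz⟩ := exists_isMaxPt D' A'
  have hk : ∀ a : k, D' (algebraMap k (Cx R) a) = 0 := by
    intro a
    rw [hD', IsScalarTower.algebraMap_apply k R (Cx R), QuadraticAlgebra.algebraMap_eq]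
    change (⟨D _, D 0⟩ : Cx R) = 0
    rw [(hD _).2 ⟨a, rfl⟩, map_zero]
    rfl
  have hI : D' cxI = 0 := by
    rw [hD']
    change (⟨D 0, D 1⟩ : Cx R) = 0
    rw [map_zero, D.map_one_eq_zero]
    rfl
  obtain ⟨θ, hθ⟩ := exists_theta hk (sol D' A' z)
  set m := RingHom.ker (evSol D' (sol D' A' z)) with hm
  obtain ⟨G, hG⟩ := exists_finset_isZero_iff (stabSet (n := n) m cxI (AlgHom.id k (Cx R)) 1)
  obtain ⟨T, hT⟩ := exists_finset_isZero_iff (stabSet (n := n) m cxI (conjHom k R) (-1))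
  obtain ⟨a, b, hab⟩ := exists_cxMat (z⁻¹ * z.map (conjHom k R))
  have hzs : z.map (conjHom k R) = z * cxMat a b := by
    rw [← hab, Matrix.mul_nonsing_inv_cancel_left _ _ hz.1]
  have hcomm : ∀ x, conjHom k R (D' x) = D' (conjHom k R x) := by
    intro x
    rw [hD', hD']
    ext <;> simp
  have hconj : ∀ x : Cx R, conjHom k R (conjHom k R x) = x := fun x =>
    DFunLike.congr_fun (conjHom_comp_conjHom (k := k)) x
  have hzz : (z.map (conjHom k R)).map (conjHom k R) = z := by
    ext1 r s
    exact hconj _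
  have hA'c : A'.map (conjHom k R) = A' := by
    ext1 r s
    rw [hA']
    ext <;> simp [QuadraticAlgebra.algebraMap_eq]
  have hss : cxMat a b * cxMat a (-b) = 1 := by
    have h1 : z * (cxMat a b * cxMat a (-b)) = z * 1 := by
      conv_rhs => rw [mul_one, ← hzz, hzs, ← RingHom.coe_coe, Matrix.map_mul, RingHom.coe_coe,
        hzs, cxMat_conj, mul_assoc]
    have := congrArg (z⁻¹ * ·) h1
    simpa only [Matrix.nonsing_inv_mul_cancel_left _ _ hz.1] using this
  rw [cxMat_mul, ← cxMat_one] at hss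
  obtain ⟨hss1, hss2⟩ := cxMat_inj hss
  have hMM : Matrix.fromBlocks a b b (-a) * Matrix.fromBlocks a b b (-a) = 1 := by
    rw [Matrix.fromBlocks_multiply, ← Matrix.fromBlocks_one]
    simp only [mul_neg, neg_mul, sub_neg_eq_add, neg_neg] at hss1 hss2 ⊢
    congr 1
    · rw [neg_add_eq_zero.1 hss2]; abel
    · rw [neg_add_eq_zero.1 hss2]; abel
    · rw [← hss1]; abel
  have hM : IsZero (T : Set (MvPolynomial ((n ⊕ n) × (n ⊕ n)) k)) (algebraMap k R)
      (Matrix.fromBlocks a b b (-a)) := by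
    rw [hT, isZero_stabSet_iff]
    simp only [Matrix.toBlocks_fromBlocks₁₁, Matrix.toBlocks_fromBlocks₁₂,
      Matrix.toBlocks_fromBlocks₂₁, Matrix.toBlocks_fromBlocks₂₂]
    refine ⟨by simp, by simp, fun p hp => ?_⟩
    rw [hm, ← theta_eq_zero_iff hD hD' hz hθ, theta_act hθ hI, ← sol_mul, ← hzs]
    have h1 : (sol D' A' z).map (PowerSeries.map (conjHom k R : Cx R →+* Cx R)) =
        sol D' A' (z.map (conjHom k R)) := by
      have := sol_map (conjHom k R : Cx R →+* Cx R) hcomm A' z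
      rwa [RingHom.coe_coe, hA'c] at this
    rw [← h1]
    have h2 := congrArg (PowerSeries.map (conjHom k R : Cx R →+* Cx R)) (RingHom.mem_ker.1 hp)
    rw [evSol, MvPolynomial.coe_eval₂Hom, MvPolynomial.hom_eval₂, map_zero] at h2
    rw [← h2]
    congr 1
    ext1 x
    exact (map_taylorHom _ hcomm x).symm
  have hone : ∀ (A : Type) [CommRing A] (f : k →+* A),
      IsZero (G : Set (MvPolynomial ((n ⊕ n) × (n ⊕ n)) k)) f
        (1 : Matrix (n ⊕ n) (n ⊕ n) A) := by
    intro A _ f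
    rw [hG]
    exact isZero_stabSet_one f m cxI
  have hmul : ∀ (A : Type) [CommRing A] (f : k →+* A) (M N : Matrix (n ⊕ n) (n ⊕ n) A),
      IsZero (G : Set (MvPolynomial ((n ⊕ n) × (n ⊕ n)) k)) f M →
      IsZero (G : Set (MvPolynomial ((n ⊕ n) × (n ⊕ n)) k)) f N →
      IsZero (G : Set (MvPolynomial ((n ⊕ n) × (n ⊕ n)) k)) f (M * N) := by
    intro A _ f M N hM hN
    rw [hG] at hM hN ⊢
    exact isZero_stabSet_mul f cxI_mul_cxI (AlgHom.comp_id _) (one_smul k _).symm (mul_one _)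
      (mul_one _) hM hN
  have hTT : ∀ (A : Type) [CommRing A] (f : k →+* A) (M N : Matrix (n ⊕ n) (n ⊕ n) A),
      IsZero (T : Set (MvPolynomial ((n ⊕ n) × (n ⊕ n)) k)) f M →
      IsZero (T : Set (MvPolynomial ((n ⊕ n) × (n ⊕ n)) k)) f N →
      IsZero (G : Set (MvPolynomial ((n ⊕ n) × (n ⊕ n)) k)) f (M * N) := by
    intro A _ f M N hM hN
    rw [hT] at hM hN
    rw [hG]
    exact isZero_stabSet_mul f cxI_mul_cxI conjHom_comp_conjHom conjHom_cxI (by simp) (by simp)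
      hM hN
  obtain ⟨M₀, -, u, v, hu, hv, huv, huMv⟩ :=
    exists_conj_involution G T hone hmul hTT _ hM hMM
  obtain ⟨hu1, hu2, -⟩ := isZero_stabSet_iff.1 ((hG R _ _).1 hu)
  obtain ⟨hv1, hv2, hv3⟩ := isZero_stabSet_iff.1 ((hG R _ _).1 hv)
  rw [one_smul] at hu1 hu2 hv1 hv2
  have hu' := Matrix.fromBlocks_toBlocks u
  have hv' := Matrix.fromBlocks_toBlocks v
  rw [hu1, hu2] at hu'
  rw [hv1, hv2] at hv'
  set ua := u.toBlocks₁₁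
  set ub := u.toBlocks₂₁
  set va := v.toBlocks₁₁
  set vb := v.toBlocks₂₁
  rw [← hu', ← hv'] at huv huMv
  rw [Matrix.fromBlocks_multiply, ← Matrix.fromBlocks_one, Matrix.fromBlocks_inj] at huv
  have huv1 : cxMat ua ub * cxMat va vb = 1 := by
    rw [cxMat_mul, ← cxMat_one]
    congr 1
    · rw [← huv.1]; noncomm_ring
    · rw [← huv.2.2.1]; abel
  have hvu1 : cxMat va vb * cxMat ua ub = 1 := mul_eq_one_comm.1 huv1
  have hvdet : IsUnit (cxMat va vb).det :=
    (Matrix.isUnit_iff_isUnit_det _).1 (IsUnit.of_mul_eq_one _ hvu1)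
  refine ⟨z * cxMat va vb, ⟨?_, ?_⟩, M₀.toBlocks₁₁, M₀.toBlocks₂₁, ?_⟩
  · rw [Matrix.det_mul]
    exact hz.1.mul hvdet
  · have hle : m ≤ RingHom.ker (evSol D' (sol D' A' (z * cxMat va vb))) := by
      intro p hp
      have h1 := hv3 p hp
      rw [hm, ← theta_eq_zero_iff hD hD' hz hθ, theta_act hθ hI, ← sol_mul] at h1
      exact h1
    intro z' hz' hle'
    exact (hz.2 z' hz' (hle.trans hle')).trans hle
  · have h1 : cxMat (M₀.toBlocks₁₁.map (algebraMap k R)) (M₀.toBlocks₂₁.map (algebraMap k R)) =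
        cxMat ua ub * cxMat a b * cxMat va (-vb) := by
      rw [cxMat_mul, cxMat_mul]
      rw [Matrix.fromBlocks_multiply, Matrix.fromBlocks_multiply] at huMv
      have e1 := congrArg Matrix.toBlocks₁₁ huMv
      have e2 := congrArg Matrix.toBlocks₂₁ huMv
      rw [Matrix.toBlocks_fromBlocks₁₁] at e1
      rw [Matrix.toBlocks_fromBlocks₂₁] at e2
      congr 1
      · refine e1.symm.trans ?_
        noncomm_ring
      · refine e2.symm.trans ?_
        noncomm_ring
    rw [← RingHom.coe_coe, Matrix.map_mul, RingHom.coe_coe, hzs, cxMat_conj, h1, mul_assoc z,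
      mul_assoc (cxMat ua ub), mul_assoc z (cxMat va vb), ← mul_assoc (cxMat va vb) (cxMat ua ub),
      hvu1, one_mul]

end ConjugationInvariant

theorem exists_nat_det_ne_zero {F n : Type} [Field F] [CharZero F] [Fintype n] [DecidableEq n]
    (i : F) (hi : i ≠ 0) (s : Matrix n n F) :
    ∃ x : ℕ, (((x : F) + i) • (1 : Matrix n n F) + ((x : F) - i) • s).det ≠ 0 := by
  let P : F[X] := ((X + C i) • (1 : Matrix n n F[X]) + (X - C i) • s.map C).det
  have hP : ∀ x, P.eval x = ((x + i) • (1 : Matrix n n F) + (x - i) • s).det := by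
    intro x
    rw [← Polynomial.coe_evalRingHom, RingHom.map_det]
    congr 1
    ext r t
    by_cases h : r = t <;> simp [Matrix.one_apply, h]
  have hP0 : P ≠ 0 := by
    intro h
    have := hP i
    rw [h, eval_zero, sub_self, zero_smul, add_zero, Matrix.det_smul, Matrix.det_one, mul_one,
      ← two_mul] at this
    exact pow_ne_zero _ (mul_ne_zero two_ne_zero hi) this.symm
  by_contra! h
  refine (Set.infinite_of_injective_forall_mem (f := fun x : ℕ => (x : F)) Nat.cast_injective
    fun x => ?_) (Polynomial.finite_setOfPred_isRoot hP0)
  change P.eval (x : F) = 0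
  rw [hP, h]

section Descent
variable {k R n : Type} [Field k] [Field R] [IsRealClosed R] [CharZero R] [Algebra k R]
  [Fintype n] [DecidableEq n]

theorem exists_real_of_conj [IsRealClosed k] {D : ZDer R} (hD : ∀ r, D r =
    0 ↔ r ∈ Set.range (algebraMap k R))
    {D' : ZDer (Cx R)} (hD' : ∀ z, D' z = ⟨D z.re, D z.im⟩) (A : Matrix n n R) :
    ∃ (z V : Matrix n n (Cx R)) (w : Matrix n n R),
      IsMaxPt D' (A.map (algebraMap R (Cx R))) z ∧ (∀ i j, D' (V i j) = 0) ∧ IsUnit V.det ∧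
        z * V = w.map (algebraMap R (Cx R)) := by
  obtain ⟨z, hz, a, b, hab⟩ := exists_isMaxPt_conj hD hD' A
  set s := cxMat (a.map (algebraMap k R)) (b.map (algebraMap k R)) with hs
  have hs0 : ∀ i j, D' (s i j) = 0 := by
    intro i j
    rw [hD']
    change (⟨D (algebraMap k R _), D (algebraMap k R _)⟩ : Cx R) = 0
    rw [(hD _).2 ⟨_, rfl⟩, (hD _).2 ⟨_, rfl⟩]
    rfl
  have hI : D' cxI = 0 := by
    rw [hD']
    change (⟨D 0, D 1⟩ : Cx R) = 0
    rw [map_zero, D.map_one_eq_zero]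
    rfl
  have hI0 : (cxI : Cx R) ≠ 0 := by
    intro h
    have := cxI_mul_cxI (R := R)
    rw [h, mul_zero] at this
    exact neg_ne_zero.2 one_ne_zero this.symm
  have hss : s * s.map (conjHom k R) = 1 := by
    have hzz : (z.map (conjHom k R)).map (conjHom k R) = z := by
      ext1 r t
      exact DFunLike.congr_fun (conjHom_comp_conjHom (k := k)) _
    have h1 : z * (s * s.map (conjHom k R)) = z * 1 := by
      conv_rhs => rw [mul_one, ← hzz, hab, ← RingHom.coe_coe, Matrix.map_mul, RingHom.coe_coe,
        hab, mul_assoc]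
    have := congrArg (z⁻¹ * ·) h1
    simpa only [Matrix.nonsing_inv_mul_cancel_left _ _ hz.1] using this
  obtain ⟨x, hx⟩ := exists_nat_det_ne_zero cxI hI0 s
  set V := ((x : Cx R) + cxI) • (1 : Matrix n n (Cx R)) + ((x : Cx R) - cxI) • s with hV
  have hcI : conjHom k R cxI = -cxI := by rw [conjHom_cxI, neg_one_smul]
  have hsV : s * V.map (conjHom k R) = V := by
    have : V.map (conjHom k R) = ((x : Cx R) - cxI) • (1 : Matrix n n (Cx R)) +
        ((x : Cx R) + cxI) • s.map (conjHom k R) := by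
      ext1 r t
      by_cases h : r = t <;>
        simp only [hV, Matrix.map_apply, Matrix.add_apply, Matrix.smul_apply, smul_eq_mul,
          map_add, map_mul, map_sub, map_natCast, hcI, sub_neg_eq_add, ← sub_eq_add_neg,
          Matrix.one_apply, h, if_true, if_false, map_one, map_zero]
    rw [this, mul_add, Matrix.mul_smul, Matrix.mul_smul, hss, mul_one, add_comm]
  have hreal : (z * V).map (conjHom k R) = z * V := by
    rw [← RingHom.coe_coe, Matrix.map_mul, RingHom.coe_coe, hab, mul_assoc, hsV]
  refine ⟨z, V, (z * V).map fun y => y.re, hz, fun i j => ?_, hx.isUnit, ?_⟩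
  · by_cases h : i = j <;>
      simp [hV, Matrix.one_apply, h, Derivation.leibniz, hI, hs0, D'.map_natCast]
  · ext1 r t
    have h1 := congrFun (congrFun hreal r) t
    rw [Matrix.map_apply] at h1
    have h2 := congrArg QuadraticAlgebra.im h1
    rw [conjHom_im] at h2
    have h3 : ((z * V) r t).im = 0 := self_eq_neg.1 h2.symm
    rw [Matrix.map_apply, Matrix.map_apply]
    ext
    · simp [QuadraticAlgebra.algebraMap_eq]
    · simp [QuadraticAlgebra.algebraMap_eq, h3]

theorem exists_translate {D' : ZDer (Cx R)} {A : Matrix n n (Cx R)} {V : Matrix n n (Cx R)}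
    (hV : ∀ i j, D' (V i j) = 0) (z : Matrix n n (Cx R)) (p : MvPolynomial (n × n) (Cx R)) :
    ∃ p', evSol D' (sol D' A (z * V)) p = evSol D' (sol D' A z) p' := by
  let τ : MvPolynomial (n × n) (Cx R) →+* MvPolynomial (n × n) (Cx R) :=
    MvPolynomial.eval₂Hom MvPolynomial.C
      fun q => ∑ l, MvPolynomial.X (q.1, l) * MvPolynomial.C (V l q.2)
  have : evSol D' (sol D' A (z * V)) = (evSol D' (sol D' A z)).comp τ := by
    refine MvPolynomial.ringHom_ext (fun a => ?_) fun q => ?_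
    · simp [τ, evSol_C]
    · rw [evSol_X, sol_mul]
      simp [τ, evSol_C, evSol_X, Matrix.mul_apply, taylorHom_of_eq_zero D' (hV _ _)]
  exact ⟨τ p, by rw [this]; rfl⟩

/-- Over a real closed differential field with real closed constants, some formal fundamental
solution introduces no new constants. -/
theorem exists_constants_eq [IsRealClosed k] {D : ZDer R}
    (hD : ∀ r, D r = 0 ↔ r ∈ Set.range (algebraMap k R)) (A : Matrix n n R) :
    ∃ w : Matrix n n R, IsUnit w.det ∧ ∀ (p q : MvPolynomial (n × n) R) (γ : R),
      evSol D (sol D A w) p = PowerSeries.C γ * evSol D (sol D A w) q →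
        evSol D (sol D A w) q ≠ 0 → D γ = 0 := by
  obtain ⟨D', hD'⟩ := exists_cxDer D
  obtain ⟨z, V, w, hz, hV, hVdet, hw⟩ := exists_real_of_conj hD hD' A
  set g := algebraMap R (Cx R) with hg
  have hginj : Function.Injective g := g.injective
  have hcomm : ∀ a, g (D a) = D' (g a) := by
    intro a
    rw [hD', hg, QuadraticAlgebra.algebraMap_eq, QuadraticAlgebra.algebraMap_eq]
    ext <;> simp
  refine ⟨w, ?_, fun p q γ h hq => ?_⟩
  · have h1 : IsUnit (w.map g).det := by
      rw [← hw, Matrix.det_mul]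
      exact hz.1.mul hVdet
    rw [← RingHom.mapMatrix_apply, ← RingHom.map_det, isUnit_iff_ne_zero] at h1
    exact isUnit_iff_ne_zero.2 fun h => h1 (by rw [h, map_zero])
  · have hmap : ∀ p, PowerSeries.map g (evSol D (sol D A w) p) =
        evSol D' (sol D' (A.map g) (z * V)) (MvPolynomial.map g p) := by
      intro p
      have : (PowerSeries.map g).comp (evSol D (sol D A w)) =
          (evSol D' (sol D' (A.map g) (z * V))).comp (MvPolynomial.map g) := by
        refine MvPolynomial.ringHom_ext (fun a => ?_) fun q => ?_
        · simp only [RingHom.comp_apply, MvPolynomial.map_C, evSol_C]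
          exact map_taylorHom g hcomm a
        · simp only [RingHom.comp_apply, MvPolynomial.map_X, evSol_X]
          rw [hw, ← sol_map g hcomm, Matrix.map_apply]
      exact DFunLike.congr_fun this p
    obtain ⟨p', hp'⟩ := exists_translate (A := A.map g) hV z (MvPolynomial.map g p)
    obtain ⟨q', hq'⟩ := exists_translate (A := A.map g) hV z (MvPolynomial.map g q)
    have h1 := congrArg (PowerSeries.map g) h
    rw [map_mul, PowerSeries.map_C, hmap, hmap, hp', hq'] at h1
    have h2 : evSol D' (sol D' (A.map g) z) q' ≠ 0 := by
      rw [← hq', ← hmap]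
      exact (map_ne_zero_iff _ (PowerSeries.map_injective g hginj)).2 hq
    have h3 := hz.constant_of_eq h1 h2
    rw [← hcomm] at h3
    exact hginj (h3.trans (map_zero g).symm)

end Descent

section Constants

theorem exists_zDer_extension {A B : Type} [CommRing A] [CommRing B] [Algebra A B]
    [Algebra.FormallyEtale A B] (D : ZDer A) :
    ∃ D' : ZDer B, ∀ a, D' (algebraMap A B a) = algebraMap A B (D a) :=
  exists_derivation_extension <|
    Derivation.mk' ((algebraMap A B).toAddMonoidHom.toIntLinearMap.comp D.toLinearMap)
      fun a b => by simp [Algebra.smul_def]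

theorem isAlgebraic_of_derivation_eq_zero {k K R : Type} [Field k] [Field K] [Field R] [Algebra k K]
    [Algebra K R] [Algebra k R] [IsScalarTower k K R] [Algebra.IsAlgebraic K R] {D : ZDer K}
    {D' : ZDer R} (hD : ∀ a, D a = 0 ↔ a ∈ Set.range (algebraMap k K))
    (hDD' : ∀ a, D' (algebraMap K R a) = algebraMap K R (D a)) {γ : R} (hγ : D' γ = 0) :
    IsAlgebraic k γ := by
  have hInt : IsIntegral K γ := (Algebra.IsAlgebraic.isAlgebraic γ).isIntegral
  set p := minpoly K γ with hp
  let q : K[X] := ∑ i ∈ Finset.range p.natDegree, monomial i (D (p.coeff i))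
  have hpow : ∀ i : ℕ, D' (γ ^ i) = 0 := by
    intro i
    rw [Derivation.leibniz_pow, hγ, smul_zero, smul_zero]
  have hqc : ∀ i < p.natDegree, q.coeff i = D (p.coeff i) := by
    intro i hi
    simp only [q, finsetSum_coeff, coeff_monomial]
    rw [Finset.sum_ite_eq' (Finset.range p.natDegree) i, if_pos (Finset.mem_range.2 hi)]
  have hq0 : aeval γ q = 0 := by
    have h1 : D' (aeval γ p) = 0 := by rw [minpoly.aeval, map_zero]
    rw [aeval_eq_sum_range, Finset.sum_range_succ, map_add, map_sum] at h1
    simp only [q, map_sum, aeval_monomial]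
    rw [← h1]
    have h2 : ∀ i, D' (p.coeff i • γ ^ i) = algebraMap K R (D (p.coeff i)) * γ ^ i := by
      intro i
      rw [Algebra.smul_def, Derivation.leibniz, hpow, hDD', smul_zero, zero_add, smul_eq_mul,
        mul_comm]
    simp only [h2]
    rw [(minpoly.monic hInt).coeff_natDegree, D.map_one_eq_zero, map_zero, zero_mul, add_zero]
  have hdeg : q.degree < p.degree := by
    rw [degree_eq_natDegree (minpoly.ne_zero hInt), degree_lt_iff_coeff_zero]
    intro m hm
    simp only [q, finsetSum_coeff, coeff_monomial]
    refine Finset.sum_eq_zero fun i hi => if_neg fun h => ?_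
    exact absurd (Finset.mem_range.1 hi) (not_lt.2 (h ▸ hm))
  have hq : q = 0 := by
    by_contra h
    exact absurd (minpoly.degree_le_of_ne_zero K γ h hq0) (not_le.2 hdeg)
  have hlift : p ∈ lifts (algebraMap k K) := by
    rw [lifts_iff_coeff_lifts]
    intro i
    rw [← hD]
    rcases lt_trichotomy i p.natDegree with h | h | h
    · rw [← hqc i h, hq, coeff_zero]
    · rw [h, (minpoly.monic hInt).coeff_natDegree, D.map_one_eq_zero]
    · rw [coeff_eq_zero_of_natDegree_lt h, map_zero]
  obtain ⟨p₀, hp₀⟩ := (mem_lifts _).1 hlift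
  refine ⟨p₀, ?_, ?_⟩
  · rintro rfl
    rw [Polynomial.map_zero] at hp₀
    exact minpoly.ne_zero hInt hp₀.symm
  · rw [← aeval_map_algebraMap K, hp₀, minpoly.aeval]

/-- A real differential field with real closed constants has a real closed algebraic differential
extension with the same constants. -/
theorem exists_realClosed_differential {k K : Type} [Field k] [Field K] [CharZero K] [Algebra k K]
    [IsRealClosed k] {D : ZDer K} (hD : ∀ a, D a = 0 ↔ a ∈ Set.range (algebraMap k K))
    (hK : IsFormallyRealField K) :
    ∃ (R : Type) (_ : Field R) (_ : Algebra K R) (D' : ZDer R), IsRealClosedField R ∧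
      (∀ a, D' (algebraMap K R a) = algebraMap K R (D a)) ∧
      ∀ r, D' r = 0 ↔ ∃ a : k, algebraMap K R (algebraMap k K a) = r := by
  obtain ⟨R, _, _, halg, hR⟩ := exists_realClosed_algebraic K hK
  have hRc := IsRealClosedField.isRealClosed hR
  have : Algebra.FormallyEtale K R := Algebra.FormallyEtale.of_isSeparable K R
  obtain ⟨D', hD'⟩ := exists_zDer_extension (B := R) D
  let _ : Algebra k R := ((algebraMap K R).comp (algebraMap k K)).toAlgebra
  have : IsScalarTower k K R := IsScalarTower.of_algebraMap_eq fun _ => rfl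
  refine ⟨R, _, _, D', hR, hD', fun r => ⟨fun h => ?_, ?_⟩⟩
  · exact mem_range_of_isAlgebraic (isAlgebraic_of_derivation_eq_zero hD hD' h)
  · rintro ⟨a, rfl⟩
    rw [hD', (hD _).2 ⟨a, rfl⟩, map_zero]

end Constants

theorem exists_laurentDer {R : Type} [Field R] : ∃ D : ZDer (LaurentSeries R),
    ∀ f : PowerSeries R, D (algebraMap (PowerSeries R) (LaurentSeries R) f) =
      algebraMap (PowerSeries R) (LaurentSeries R) (PowerSeries.derivative R f) := by
  have : Algebra.FormallyEtale (PowerSeries R) (LaurentSeries R) :=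
    Algebra.FormallyEtale.of_isLocalization (nonZeroDivisors (PowerSeries R))
  obtain ⟨δ, hδ⟩ := exists_zDer (PowerSeries.derivative R).toLinearMap.toAddMonoidHom
    (PowerSeries.derivative R).leibniz
  obtain ⟨D, hD⟩ := exists_zDer_extension (B := LaurentSeries R) δ
  exact ⟨D, fun f => (hD f).trans (congrArg _ (hδ f))⟩

/-- A fundamental matrix in a real differential field without new constants generates a real
Picard–Vessiot field. -/
theorem exists_picardVessiot {K Ω : Type} [Field K] [Field Ω] {dK : FieldDeriv K} {n : ℕ}
    {A : Matrix (Fin n) (Fin n) K} (D : ZDer Ω) (ψ : K →+* Ω) (hψ : ∀ a, D (ψ a) = ψ (dK.d a))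
    (hΩ : IsFormallyRealField Ω) (F : Matrix (Fin n) (Fin n) Ω) (hF : IsUnit F.det)
    (hFA : ∀ i j, D (F i j) = (A.map ψ * F) i j)
    (hc : ∀ p q : MvPolynomial (Fin n × Fin n) K,
      MvPolynomial.eval₂Hom ψ (fun q => F q.1 q.2) q ≠ 0 →
      D (MvPolynomial.eval₂Hom ψ (fun q => F q.1 q.2) p /
        MvPolynomial.eval₂Hom ψ (fun q => F q.1 q.2) q) = 0 →
      ∃ a, dK.d a = 0 ∧ ψ a = MvPolynomial.eval₂Hom ψ (fun q => F q.1 q.2) p /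
        MvPolynomial.eval₂Hom ψ (fun q => F q.1 q.2) q) :
    ∃ (L : Type) (_ : Field L) (_ : Algebra K L) (dL : FieldDeriv L),
      IsPicardVessiot dK dL A ∧ IsFormallyRealField L := by
  let _ : Algebra K Ω := ψ.toAlgebra
  let S : Set Ω := Set.range fun q : Fin n × Fin n => F q.1 q.2
  let L := IntermediateField.adjoin K S
  have hFL : ∀ i j, F i j ∈ L := fun i j => IntermediateField.subset_adjoin K S ⟨(i, j), rfl⟩
  have hψL : ∀ a, ψ a ∈ L := fun a => L.algebraMap_mem a
  have hDL : ∀ x ∈ L, D x ∈ L := by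
    intro x hx
    induction hx using IntermediateField.adjoin_induction with
    | mem x hx =>
      obtain ⟨q, rfl⟩ := hx
      rw [hFA, Matrix.mul_apply]
      exact sum_mem fun l _ => mul_mem (hψL _) (hFL _ _)
    | algebraMap a =>
      have : D (algebraMap K Ω a) = ψ (dK.d a) := hψ a
      rw [this]
      exact hψL _
    | add x y hx hy h1 h2 => rw [map_add]; exact add_mem h1 h2
    | inv x hx h =>
      rw [Derivation.leibniz_inv, smul_eq_mul]
      exact mul_mem (neg_mem (pow_mem (inv_mem hx) 2)) h
    | mul x y hx hy h1 h2 =>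
      rw [Derivation.leibniz, smul_eq_mul, smul_eq_mul]
      exact add_mem (mul_mem hx h2) (mul_mem hy h1)
  let dL : FieldDeriv L :=
    { d := fun x => ⟨D x, hDL x x.2⟩
      map_add := fun x y => Subtype.ext (map_add D (x : Ω) y)
      leibniz := fun x y => Subtype.ext (by
        have := D.leibniz (x : Ω) y
        rw [smul_eq_mul, smul_eq_mul, mul_comm (y : Ω)] at this
        exact this) }
  let F' : Matrix (Fin n) (Fin n) L := .of fun i j => ⟨F i j, hFL i j⟩
  have hF' : F'.map (algebraMap L Ω) = F := rfl
  refine ⟨L, inferInstance, inferInstance, dL, ⟨fun a => Subtype.ext (hψ a), F', ?_, ?_, ?_, ?_⟩,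
    not_isSumSq_of_injective (algebraMap L Ω) hΩ⟩
  · rw [isUnit_iff_ne_zero] at hF ⊢
    intro h
    apply hF
    rw [← hF', ← RingHom.mapMatrix_apply, ← RingHom.map_det, h, map_zero]
  · intro i j
    ext1
    change D (F i j) = algebraMap L Ω _
    rw [hFA, Matrix.mul_apply, Matrix.mul_apply, map_sum]
    exact Finset.sum_congr rfl fun l _ => rfl
  · refine IntermediateField.map_injective L.val ?_
    rw [IntermediateField.adjoin_map, ← AlgHom.fieldRange_eq_map, IntermediateField.fieldRange_val,
      ← Set.range_comp]
    rfl
  · intro x hx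
    obtain ⟨p, q, hpq⟩ := (IntermediateField.mem_adjoin_range_iff K _ _).1 x.2
    have hx' : D (x : Ω) = 0 := congrArg Subtype.val hx
    by_cases hq : MvPolynomial.aeval (fun q : Fin n × Fin n => F q.1 q.2) q = 0
    · rw [hq, div_zero] at hpq
      have hd0 : dK.d 0 = 0 := by simpa using dK.map_add 0 0
      exact ⟨0, hd0, Subtype.ext ((map_zero ψ).trans hpq.symm)⟩
    · rw [hpq] at hx'
      obtain ⟨a, ha, hax⟩ := hc p q hq hx'
      exact ⟨a, ha, Subtype.ext (hax.trans hpq.symm)⟩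

theorem zDer_div {F : Type} [Field F] (D : ZDer F) (a b : F) :
    D (a / b) = b⁻¹ ^ 2 * (b * D a - a * D b) :=
  D.leibniz_div a b

theorem exists_picardVessiot_of_realClosed {K k : Type} [Field K] [CharZero K] {dK : FieldDeriv K}
    (hK : IsFormallyRealField K) [Field k] [Algebra k K]
    (hconst : ∀ a : K, dK.d a = 0 ↔ a ∈ Set.range (algebraMap k K)) (hk : IsRealClosedField k)
    {n : ℕ} (A : Matrix (Fin n) (Fin n) K) :
    ∃ (L : Type) (_ : Field L) (_ : Algebra K L) (dL : FieldDeriv L),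
      IsPicardVessiot dK dL A ∧ IsFormallyRealField L := by
  have := IsRealClosedField.isRealClosed hk
  obtain ⟨D, hD⟩ := exists_zDer (AddMonoidHom.mk' dK.d dK.map_add) fun a b => by
    change dK.d (a * b) = a * dK.d b + b * dK.d a
    rw [dK.leibniz, mul_comm (dK.d a)]
  replace hD : ∀ a, D a = dK.d a := hD
  obtain ⟨R, _, _, D', hR, hDD', hD'⟩ :=
    exists_realClosed_differential (D := D) (fun a => by rw [hD, hconst]) hK
  have := IsRealClosedField.isRealClosed hR
  have : CharZero R := charZero_of_injective_algebraMap (algebraMap K R).injective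
  let _ := linearOrderOfRealClosed R
  have := isStrictOrderedRing_of_realClosed R
  set g := algebraMap K R with hg
  let _ : Algebra k R := (g.comp (algebraMap k K)).toAlgebra
  have hD'' : ∀ r, D' r = 0 ↔ r ∈ Set.range (algebraMap k R) := hD'
  obtain ⟨w, hw, hwc⟩ := exists_constants_eq hD'' (A.map g)
  obtain ⟨δ, hδ⟩ := exists_laurentDer (R := R)
  set F := sol D' (A.map g) w with hF
  set j := algebraMap (PowerSeries R) (LaurentSeries R) with hj
  have hjinj : Function.Injective j := IsFractionRing.injective _ _
  let ψ : K →+* LaurentSeries R := j.comp ((taylorHom D').comp g)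
  have hev : ∀ p : MvPolynomial (Fin n × Fin n) K,
      MvPolynomial.eval₂Hom ψ (fun q => (F.map j) q.1 q.2) p =
        j (evSol D' F (MvPolynomial.map g p)) := by
    intro p
    have : MvPolynomial.eval₂Hom ψ (fun q => (F.map j) q.1 q.2) =
        j.comp ((evSol D' F).comp (MvPolynomial.map g)) := by
      refine MvPolynomial.ringHom_ext (fun a => ?_) fun q => ?_
      · simp [ψ, evSol_C]
      · simp [evSol_X]
    exact DFunLike.congr_fun this p
  refine exists_picardVessiot δ ψ (fun a => ?_) isFormallyRealField_laurentSeries (F.map j) ?_ ?_ ?_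
  · simp only [ψ, RingHom.comp_apply]
    rw [hδ, derivative_taylorHom, hDD', hD]
  · have h1 : IsUnit F.det := by
      rw [PowerSeries.isUnit_iff_constantCoeff, RingHom.map_det, RingHom.mapMatrix_apply, hF,
        constantCoeff_sol]
      exact hw
    rw [← RingHom.mapMatrix_apply, ← RingHom.map_det]
    exact h1.map j
  · intro r s
    have h1 := congrFun (congrFun (isSol_sol D' (A.map g) w) r) s
    rw [← hF, Matrix.map_apply] at h1
    rw [Matrix.map_apply, hδ, h1, Matrix.mul_apply, Matrix.mul_apply, map_sum]
    exact Finset.sum_congr rfl fun l _ => map_mul j _ _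
  · intro p q hq h
    rw [hev, hev] at h ⊢
    rw [hev] at hq
    set a := evSol D' F (MvPolynomial.map g p) with ha
    set b := evSol D' F (MvPolynomial.map g q) with hb
    have hb0 : b ≠ 0 := fun h => hq (by rw [h, map_zero])
    rw [zDer_div, mul_eq_zero,
      or_iff_right (pow_ne_zero _ (inv_ne_zero hq)), hδ, hδ, ← map_mul,
      ← map_mul, sub_eq_zero] at h
    obtain ⟨γ, hγ⟩ := exists_eq_C_mul hb0 ((mul_comm _ _).trans (hjinj h))
    obtain ⟨c, hc⟩ := (hD' γ).1 (hwc _ _ γ hγ hb0)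
    have hc0 : dK.d (algebraMap k K c) = 0 := (hconst _).2 ⟨c, rfl⟩
    refine ⟨algebraMap k K c, hc0, ?_⟩
    rw [eq_div_iff hq, hγ, map_mul]
    congr 1
    simp only [ψ, RingHom.comp_apply]
    rw [hc, taylorHom_of_eq_zero D' ((hD' γ).2 ⟨c, hc⟩)]

end RealPV

/-- If `K` is a real differential field (characteristic zero) whose field of
constants `k` is real closed and `k ≠ K`, then for every `n ≥ 1` and every matrix
`A ∈ Mat_n(K)` there exists a real Picard--Vessiot field for `y' = A y` over `K`. -/
theorem real_picard_vessiot_exists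
    (K : Type) [Field K] [CharZero K] (dK : FieldDeriv K)
    (hKreal : IsFormallyRealField K)
    (k : Type) [Field k] [Algebra k K]
    (hconst : ∀ a : K, dK.d a = 0 ↔ a ∈ Set.range (algebraMap k K))
    (hkrc : IsRealClosedField k)
    (hkK : ∃ a : K, dK.d a ≠ 0)
    (n : ℕ) (hn : 1 ≤ n) (A : Matrix (Fin n) (Fin n) K) :
    ∃ (L : Type) (_ : Field L) (_ : Algebra K L) (dL : FieldDeriv L),
      IsPicardVessiot dK dL A ∧ IsFormallyRealField L := by
  exact RealPV.exists_picardVessiot_of_realClosed hKreal hconst hkrc A
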